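/- arXiv:2409.06115 — 4 statements merged into one kernel-verified Lean document; each statement's English description precedes it below -/
import Mathlib

section
/- There exists an absolute constant C > 0 such that for every finite set P of n points in ℝ² and every positive integer D, there exists a nonzero polynomial F ∈ ℝ[x,y] of degree at most D such that the open set ℝ² ∖ Z(F) has at most D² connected components (cells), and each such connected component contains at most C·n/D² points of P. -/
open MvPolynomial

/-- The set where a polynomial `F ∈ ℝ[x,y]` does not vanish, i.e. `ℝ² ∖ Z(F)`. -/
def offZeroSet (F : MvPolynomial (Fin 2) ℝ) : Set (Fin 2 → ℝ) :=
  {x | eval x F ≠ 0}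

/-- The set of connected components (cells) of `ℝ² ∖ Z(F)`. -/
def cells (F : MvPolynomial (Fin 2) ℝ) : Set (Set (Fin 2 → ℝ)) :=
  {U | ∃ x ∈ offZeroSet F, U = connectedComponentIn (offZeroSet F) x}

/-- Ordered simplicial chains modulo 2: a list of vertices stands for a (possibly degenerate) simplex. -/
abbrev ListChain (V : Type*) := List V →₀ ZMod 2

namespace ListChain

variable {V W : Type*}

theorem add_self (c : ListChain V) : c + c = 0 := by
  ext l; exact CharTwo.add_self_eq_zero _

/-- The cone over a chain with apex `x`. -/
noncomputable def cone (x : V) : ListChain V →ₗ[ZMod 2] ListChain V :=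
  Finsupp.lmapDomain _ _ (List.cons x)

@[simp] theorem cone_single (x : V) (l : List V) (a : ZMod 2) :
    cone x (Finsupp.single l a) = Finsupp.single (x :: l) a := by
  simp [cone]

noncomputable def faces : List V → ListChain V
  | [] => 0
  | x :: l => Finsupp.single l 1 + cone x (faces l)

/-- The (augmented) simplicial boundary. -/
noncomputable def bdry : ListChain V →ₗ[ZMod 2] ListChain V :=
  Finsupp.linearCombination (ZMod 2) faces

@[simp] theorem bdry_single (l : List V) : bdry (Finsupp.single l 1) = faces l := by
  simp [bdry]

theorem hom_ext {M : Type*} [AddCommMonoid M] [Module (ZMod 2) M]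
    {f g : ListChain V →ₗ[ZMod 2] M}
    (h : ∀ l, f (Finsupp.single l 1) = g (Finsupp.single l 1)) (c : ListChain V) : f c = g c := by
  have : f = g := by
    ext l
    simpa using h l
  rw [this]

theorem hom_ext₂ {M N P : Type*} [AddCommMonoid M] [Module (ZMod 2) M]
    [AddCommMonoid N] [Module (ZMod 2) N] [AddCommMonoid P] [Module (ZMod 2) P]
    (f : ListChain V →ₗ[ZMod 2] M) (f' : M →ₗ[ZMod 2] P)
    (g : ListChain V →ₗ[ZMod 2] N) (g' : N →ₗ[ZMod 2] P)
    (h : ∀ l, f' (f (Finsupp.single l 1)) = g' (g (Finsupp.single l 1))) (c : ListChain V) :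
    f' (f c) = g' (g c) :=
  hom_ext (f := f' ∘ₗ f) (g := g' ∘ₗ g) h c

theorem bdry_cone (x : V) (c : ListChain V) : bdry (cone x c) = c + cone x (bdry c) :=
  hom_ext (f := bdry ∘ₗ cone x) (g := LinearMap.id + cone x ∘ₗ bdry)
    (fun l => by simp [faces]) c

theorem bdry_faces (l : List V) : bdry (faces l) = 0 := by
  induction l with
  | nil => simp [faces]
  | cons x l ih => rw [faces, map_add, bdry_single, bdry_cone, ih, map_zero, add_zero, add_self]

theorem bdry_bdry (c : ListChain V) : bdry (bdry c) = 0 :=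
  hom_ext (f := bdry ∘ₗ bdry) (g := 0) (fun l => by simp [bdry_faces]) c

noncomputable def map (f : V → W) : ListChain V →ₗ[ZMod 2] ListChain W :=
  Finsupp.lmapDomain _ _ (List.map f)

@[simp] theorem map_single (f : V → W) (l : List V) (a : ZMod 2) :
    map f (Finsupp.single l a) = Finsupp.single (l.map f) a := by
  simp [map]

theorem map_cone (f : V → W) (x : V) (c : ListChain V) :
    map f (cone x c) = cone (f x) (map f c) :=
  hom_ext (f := map f ∘ₗ cone x) (g := cone (f x) ∘ₗ map f) (fun l => by simp) c

theorem map_faces (f : V → W) (l : List V) : map f (faces l) = faces (l.map f) := by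
  induction l with
  | nil => simp [faces]
  | cons x l ih => simp [faces, map_cone, ih]

theorem map_bdry (f : V → W) (c : ListChain V) : map f (bdry c) = bdry (map f c) :=
  hom_ext (f := map f ∘ₗ bdry) (g := bdry ∘ₗ map f) (fun l => by simp [map_faces]) c

theorem mem_of_supported {M : Type*} [AddCommMonoid M] [Module (ZMod 2) M]
    (f : ListChain V →ₗ[ZMod 2] M) {s : Set (List V)} {N : Submodule (ZMod 2) M}
    (h : ∀ l ∈ s, f (Finsupp.single l 1) ∈ N) {c : ListChain V}
    (hc : c ∈ Finsupp.supported (ZMod 2) (ZMod 2) s) : f c ∈ N := by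
  rw [Finsupp.supported_eq_span_single] at hc
  have : Submodule.span (ZMod 2) ((fun i => Finsupp.single i (1 : ZMod 2)) '' s) ≤ N.comap f := by
    rw [Submodule.span_le]
    rintro _ ⟨l, hl, rfl⟩
    exact h l hl
  exact this hc

theorem faces_mem (l : List V) :
    faces l ∈ Finsupp.supported (ZMod 2) (ZMod 2)
      {l' | l'.length + 1 = l.length ∧ ∀ x ∈ l', x ∈ l} := by
  induction l with
  | nil => simp [faces]
  | cons x l ih =>
    rw [faces]
    refine add_mem (Finsupp.single_mem_supported _ _ ?_) (mem_of_supported _ ?_ ih)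
    · exact ⟨rfl, fun y hy => List.mem_cons_of_mem _ hy⟩
    · rintro l' ⟨h1, h2⟩
      rw [cone_single]
      refine Finsupp.single_mem_supported _ _ ⟨by simp [h1], ?_⟩
      intro y hy
      rcases List.mem_cons.1 hy with rfl | hy
      · simp
      · exact List.mem_cons_of_mem _ (h2 y hy)

section Subdivision

variable {E : Type*} [NormedAddCommGroup E] [NormedSpace ℝ E]

noncomputable def barycenter (l : List E) : E := (l.length : ℝ)⁻¹ • l.sum

theorem barycenter_eq (l : List E) :
    barycenter l = ∑ i : Fin l.length, (l.length : ℝ)⁻¹ • l[i] := by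
  rw [barycenter, ← Finset.smul_sum]
  congr 1
  simp

theorem barycenter_mem {K : Set E} (hK : Convex ℝ K) {l : List E} (hl : l ≠ [])
    (h : ∀ x ∈ l, x ∈ K) : barycenter l ∈ K := by
  rw [barycenter_eq]
  have : (l.length : ℝ) ≠ 0 := by simpa using hl
  refine hK.sum_mem (fun _ _ => by positivity) (by simp [this]) (fun i _ => h _ ?_)
  simp

theorem norm_sub_barycenter_le {n : ℕ} {δ : ℝ} {l : List E} (hlen : l.length ≤ n + 1)
    (hδ : ∀ x ∈ l, ∀ y ∈ l, ‖x - y‖ ≤ δ) {x : E} (hx : x ∈ l) :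
    ‖x - barycenter l‖ ≤ n / (n + 1) * δ := by
  have hδ0 : 0 ≤ δ := (norm_nonneg _).trans (hδ x hx x hx)
  obtain ⟨i, hi, rfl⟩ := List.getElem_of_mem hx
  have hm : 0 < l.length := by omega
  have hm' : (0 : ℝ) < l.length := by exact_mod_cast hm
  have h1 : l[i] - barycenter l = ∑ j : Fin l.length, (l.length : ℝ)⁻¹ • (l[i] - l[j]) := by
    rw [barycenter_eq]
    simp only [smul_sub, Finset.sum_sub_distrib]
    simp [← Nat.cast_smul_eq_nsmul ℝ, smul_smul, hm'.ne']
  have h2 : ∀ j : Fin l.length, ‖(l.length : ℝ)⁻¹ • (l[i] - l[j])‖ ≤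
      if j = ⟨i, hi⟩ then 0 else (l.length : ℝ)⁻¹ * δ := by
    intro j
    split_ifs with h
    · subst h; simp
    · rw [norm_smul, Real.norm_of_nonneg (by positivity)]
      exact mul_le_mul_of_nonneg_left (hδ _ (by simp) _ (by simp)) (by positivity)
  rw [h1]
  refine (norm_sum_le _ _).trans ((Finset.sum_le_sum fun j _ => h2 j).trans ?_)
  rw [Finset.sum_ite]
  simp only [Finset.sum_const_zero, zero_add, Finset.sum_const, nsmul_eq_mul]
  rw [Finset.filter_ne', Finset.card_erase_of_mem (Finset.mem_univ _), Finset.card_univ,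
    Fintype.card_fin, ← mul_assoc]
  refine mul_le_mul_of_nonneg_right ?_ hδ0
  rw [Nat.cast_sub hm, ← div_eq_mul_inv, div_le_div_iff₀ hm' (by positivity)]
  have : (l.length : ℝ) ≤ n + 1 := by exact_mod_cast hlen
  push_cast
  nlinarith

noncomputable def subdiv : ℕ → ListChain E →ₗ[ZMod 2] ListChain E
  | 0 => LinearMap.id
  | n + 1 => Finsupp.linearCombination (ZMod 2) fun l => cone (barycenter l) (subdiv n (faces l))

theorem subdiv_zero (c : ListChain E) : subdiv 0 c = c := rfl

theorem subdiv_succ_single (n : ℕ) (l : List E) :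
    subdiv (n + 1) (Finsupp.single l 1) = cone (barycenter l) (subdiv n (faces l)) := by
  simp [subdiv]

attribute [irreducible] subdiv

theorem bdry_subdiv (n : ℕ) (c : ListChain E) : bdry (subdiv (n + 1) c) = subdiv n (bdry c) := by
  induction n generalizing c with
  | zero =>
    refine hom_ext (f := bdry ∘ₗ subdiv (0 + 1)) (g := subdiv 0 ∘ₗ bdry) (fun l => ?_) c
    simp only [LinearMap.comp_apply, subdiv_succ_single, bdry_cone, bdry_single]
    simp only [subdiv_zero, bdry_faces, map_zero, add_zero]
  | succ n ih =>
    have key (l : List E) : bdry (subdiv (n + 1 + 1) (Finsupp.single l 1)) =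
        subdiv (n + 1) (bdry (Finsupp.single l 1)) := by
      rw [subdiv_succ_single (n + 1), bdry_cone, bdry_single, ih, bdry_faces, map_zero, map_zero,
        add_zero]
    exact hom_ext₂ (subdiv (n + 1 + 1)) bdry bdry (subdiv (n + 1)) key c

theorem barycenter_map_neg (l : List E) : barycenter (l.map Neg.neg) = -barycenter l := by
  simp only [barycenter, List.length_map, ← smul_neg]
  congr 1
  induction l with
  | nil => simp
  | cons x l ih => simp [ih, add_comm]

theorem map_neg_subdiv (n : ℕ) (c : ListChain E) :
    map Neg.neg (subdiv n c) = subdiv n (map Neg.neg c) := by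
  induction n generalizing c with
  | zero => simp only [subdiv_zero]
  | succ n ih =>
    refine hom_ext (f := map Neg.neg ∘ₗ subdiv (n + 1)) (g := subdiv (n + 1) ∘ₗ map Neg.neg)
      (fun l => ?_) c
    simp only [LinearMap.comp_apply, subdiv_succ_single, map_cone, map_single, ih, map_faces,
      barycenter_map_neg]

theorem subdiv_single_mem_convex {K : Set E} (hK : Convex ℝ K) (n : ℕ) {l : List E}
    (hl : l.length = n) (h : ∀ x ∈ l, x ∈ K) :
    subdiv n (Finsupp.single l 1) ∈ Finsupp.supported (ZMod 2) (ZMod 2)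
      {l' | l'.length = n ∧ ∀ x ∈ l', x ∈ K} := by
  induction n generalizing l with
  | zero => rw [subdiv_zero]; exact Finsupp.single_mem_supported _ _ ⟨hl, h⟩
  | succ n ih =>
    have hb : barycenter l ∈ K := barycenter_mem hK (by rintro rfl; simp at hl) h
    rw [subdiv_succ_single]
    refine mem_of_supported (cone _ ∘ₗ subdiv n) (fun l' hl' => ?_) (faces_mem l)
    refine mem_of_supported (cone _) (fun l'' hl'' => ?_)
      (ih (l := l') (by have := hl'.1; omega) (fun x hx => h x (hl'.2 x hx)))
    rw [cone_single]
    refine Finsupp.single_mem_supported _ _ ⟨by simp [hl''.1], ?_⟩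
    simpa [hb] using hl''.2

theorem subdiv_single_mem_dist {N : ℕ} {δ : ℝ} (n : ℕ) (hn : n ≤ N + 1) {l : List E}
    (hl : l.length = n) (h : ∀ x ∈ l, ∀ y ∈ l, ‖x - y‖ ≤ δ) :
    subdiv n (Finsupp.single l 1) ∈ Finsupp.supported (ZMod 2) (ZMod 2)
      {l' | ∀ x ∈ l', ∀ y ∈ l', ‖x - y‖ ≤ N / (N + 1) * δ} := by
  induction n generalizing l with
  | zero =>
    rw [List.length_eq_zero_iff] at hl
    subst hl
    rw [subdiv_zero]
    exact Finsupp.single_mem_supported _ _ (by simp)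
  | succ n ih =>
    rw [subdiv_succ_single]
    refine mem_of_supported (cone _ ∘ₗ subdiv n) (fun l' hl' => ?_) (faces_mem l)
    have h1 := ih (l := l') (by omega) (by have := hl'.1; omega)
      (fun x hx y hy => h x (hl'.2 x hx) y (hl'.2 y hy))
    have h2 := subdiv_single_mem_convex
      (convex_closedBall (barycenter l) (N / (N + 1) * δ)) n (l := l')
      (by have := hl'.1; omega)
      (fun x hx => by
        rw [mem_closedBall_iff_norm]
        exact norm_sub_barycenter_le (by omega) h (hl'.2 x hx))
    have h3 := (Finsupp.supported_inter (M := ZMod 2) (R := ZMod 2) _ _).ge ⟨h1, h2⟩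
    refine mem_of_supported (cone _) (fun l'' hl'' => ?_) h3
    rw [cone_single]
    refine Finsupp.single_mem_supported _ _ ?_
    have hb : ∀ x ∈ l'', ‖x - barycenter l‖ ≤ N / (N + 1) * δ := fun x hx => by
      have := hl''.2.2 x hx
      rwa [mem_closedBall_iff_norm] at this
    have hδ : 0 ≤ N / (N + 1) * δ := by
      cases l with
      | nil => simp at hl
      | cons x l =>
        have := (norm_nonneg _).trans (h x (by simp) x (by simp))
        positivity
    intro x hx y hy
    rcases List.mem_cons.1 hx with rfl | hx <;> rcases List.mem_cons.1 hy with rfl | hy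
    · simpa using hδ
    · rw [norm_sub_rev]; exact hb y hy
    · exact hb x hx
    · exact hl''.1 x hx y hy

theorem subdiv_iterate_mem {N : ℕ} {δ : ℝ} {P : Set (Set E)} (hP : ∀ K ∈ P, Convex ℝ K)
    {c : ListChain E}
    (hc : c ∈ Finsupp.supported (ZMod 2) (ZMod 2) {l | l.length = N + 1 ∧
      (∃ K ∈ P, ∀ x ∈ l, x ∈ K) ∧ ∀ x ∈ l, ∀ y ∈ l, ‖x - y‖ ≤ δ}) (r : ℕ) :
    (subdiv (N + 1))^[r] c ∈ Finsupp.supported (ZMod 2) (ZMod 2) {l | l.length = N + 1 ∧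
      (∃ K ∈ P, ∀ x ∈ l, x ∈ K) ∧ ∀ x ∈ l, ∀ y ∈ l, ‖x - y‖ ≤ (N / (N + 1)) ^ r * δ} := by
  induction r with
  | zero => simpa using hc
  | succ r ih =>
    rw [Function.iterate_succ_apply']
    refine mem_of_supported _ (fun l hl => ?_) ih
    obtain ⟨h1, ⟨K, hK, hlK⟩, h2⟩ := hl
    have h3 := (Finsupp.supported_inter (M := ZMod 2) (R := ZMod 2) _ _).ge
      ⟨subdiv_single_mem_convex (hP K hK) _ h1 hlK, subdiv_single_mem_dist _ le_rfl h1 h2⟩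
    refine Finsupp.supported_mono ?_ h3
    rintro l' ⟨⟨h4, h5⟩, h6⟩
    refine ⟨h4, ⟨K, hK, h5⟩, fun x hx y hy => (h6 x hx y hy).trans_eq ?_⟩
    ring

end Subdivision

end ListChain

namespace ListChain

variable {V : Type*}

def alternation (s : ℕ → V → ZMod 2) : ℕ → List V → ZMod 2
  | 0, [_] => 1
  | j + 1, x :: y :: l => (s j x + s j y) * alternation s j (y :: l)
  | _, _ => 0

def signedAlternation (s : ℕ → V → ZMod 2) (j : ℕ) : List V → ZMod 2
  | [] => 0
  | x :: l => s j x * alternation s j (x :: l)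

noncomputable def evalOn (w : List V → ZMod 2) : ListChain V →ₗ[ZMod 2] ZMod 2 :=
  Finsupp.linearCombination (ZMod 2) w

@[simp] theorem evalOn_single (w : List V → ZMod 2) (l : List V) :
    evalOn w (Finsupp.single l 1) = w l := by
  simp [evalOn]

theorem evalOn_alternation_zero (s : ℕ → V → ZMod 2) (c : ListChain V) :
    evalOn (alternation s 0) c = bdry c [] := by
  refine hom_ext (f := evalOn (alternation s 0)) (g := Finsupp.lapply [] ∘ₗ bdry) (fun l => ?_) c
  rw [LinearMap.comp_apply, bdry_single, evalOn_single]
  match l with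
  | [] => simp [faces, alternation]
  | [x] => simp [faces, alternation]
  | x :: y :: l =>
    have : cone x (faces (y :: l)) [] = 0 :=
      Finsupp.mapDomain_of_notMem_range _ _ (by simp)
    rw [faces, Finsupp.lapply_apply, Finsupp.add_apply, this]
    simp [alternation]

theorem evalOn_cone_cone (s : ℕ → V → ZMod 2) (j : ℕ) (x y : V) (c : ListChain V) :
    evalOn (signedAlternation s j) (cone x (cone y c)) =
      s j x * evalOn (alternation s j) (cone x (cone y c)) := by
  refine hom_ext (f := evalOn (signedAlternation s j) ∘ₗ cone x ∘ₗ cone y)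
    (g := s j x • (evalOn (alternation s j) ∘ₗ cone x ∘ₗ cone y)) (fun l => ?_) c
  simp [signedAlternation]

theorem evalOn_alternation_succ_of_cocycle (s : ℕ → V → ZMod 2) (j : ℕ)
    (hj : ∀ c, evalOn (alternation s j) (bdry c) = 0) (c : ListChain V) :
    evalOn (alternation s (j + 1)) c = evalOn (signedAlternation s j) (bdry c) := by
  refine hom_ext (f := evalOn (alternation s (j + 1))) (g := evalOn (signedAlternation s j) ∘ₗ bdry)
    (fun l => ?_) c
  rw [LinearMap.comp_apply, bdry_single, evalOn_single]
  match l with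
  | [] => simp [faces, alternation]
  | [x] => simp [faces, alternation, signedAlternation]
  | x :: y :: l =>
    have h := hj (Finsupp.single (x :: y :: l) 1)
    simp only [bdry_single, faces, map_add, cone_single, evalOn_single, evalOn_cone_cone,
      alternation, signedAlternation] at h ⊢
    have h2 := CharTwo.add_self_eq_zero (s j x * alternation s j (y :: l))
    linear_combination -s j x * h + h2

theorem evalOn_alternation_succ (s : ℕ → V → ZMod 2) (j : ℕ) (c : ListChain V) :
    evalOn (alternation s (j + 1)) c = evalOn (signedAlternation s j) (bdry c) := by
  induction j generalizing c with
  | zero =>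
    exact evalOn_alternation_succ_of_cocycle s 0
      (fun c => by rw [evalOn_alternation_zero, bdry_bdry, Finsupp.zero_apply]) c
  | succ j ih =>
    exact evalOn_alternation_succ_of_cocycle s (j + 1)
      (fun c => by rw [ih, bdry_bdry, map_zero]) c

theorem alternation_map (s : ℕ → V → ZMod 2) (f : V → V) (j : ℕ) (l : List V)
    (hs : ∀ j, ∀ x ∈ l, s j (f x) = s j x + 1) :
    alternation s j (l.map f) = alternation s j l := by
  induction j generalizing l with
  | zero =>
    match l with
    | [] => rfl
    | [x] => rfl
    | x :: y :: l => rfl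
  | succ j ih =>
    match l with
    | [] => rfl
    | [x] => rfl
    | x :: y :: l =>
      have := ih (y :: l) (fun j x hx => hs j x (List.mem_cons_of_mem _ hx))
      simp only [List.map_cons, alternation] at this ⊢
      rw [this, hs j x (by simp), hs j y (by simp)]
      congr 1
      linear_combination CharTwo.add_self_eq_zero (1 : ZMod 2)

theorem evalOn_signedAlternation_map (s : ℕ → V → ZMod 2) (f : V → V) (j : ℕ) {c : ListChain V}
    (hc : c ∈ Finsupp.supported (ZMod 2) (ZMod 2)
      {l | l.length = j + 1 ∧ ∀ j, ∀ x ∈ l, s j (f x) = s j x + 1}) :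
    evalOn (signedAlternation s j) (c + map f c) = evalOn (alternation s j) c := by
  have h := mem_of_supported
    (evalOn (signedAlternation s j) + evalOn (signedAlternation s j) ∘ₗ map f -
      evalOn (alternation s j)) (N := ⊥) (fun l hl => ?_) hc
  · rw [Submodule.mem_bot] at h
    simpa [sub_eq_zero] using h
  · rw [Submodule.mem_bot]
    obtain ⟨h1, h2⟩ := hl
    match l with
    | [] => simp at h1
    | x :: l =>
      have h3 := alternation_map s f j (x :: l) h2
      have h4 := h2 j x (by simp)
      rw [List.map_cons] at h3
      simp only [LinearMap.sub_apply, LinearMap.add_apply, LinearMap.comp_apply, map_single,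
        evalOn_single, List.map_cons, signedAlternation, h3, h4]
      linear_combination s j x * alternation s j (x :: l) *
        CharTwo.add_self_eq_zero (1 : ZMod 2)

theorem exists_ne_of_alternation_ne_zero (s : ℕ → V → ZMod 2) {n : ℕ} {l : List V}
    (h : alternation s n l ≠ 0) {j : ℕ} (hj : j < n) : ∃ x ∈ l, ∃ y ∈ l, s j x ≠ s j y := by
  induction n generalizing l with
  | zero => omega
  | succ n ih =>
    match l with
    | [] => simp [alternation] at h
    | [x] => simp [alternation] at h
    | x :: y :: l =>
      rw [alternation] at h
      rcases Nat.lt_succ_iff_lt_or_eq.1 hj with hj | rfl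
      · obtain ⟨a, ha, b, hb, hab⟩ := ih (right_ne_zero_of_mul h) hj
        exact ⟨a, List.mem_cons_of_mem _ ha, b, List.mem_cons_of_mem _ hb, hab⟩
      · refine ⟨x, by simp, y, by simp, fun hxy => left_ne_zero_of_mul h ?_⟩
        rw [hxy, CharTwo.add_self_eq_zero]

/-- A form of the Borsuk-Ulam theorem for chains: `h i` plays the role of an `i`-dimensional
hemisphere, whose boundary is an `(i - 1)`-sphere. -/
theorem exists_alternating (s : ℕ → V → ZMod 2) (f : V → V) (h : ℕ → ListChain V) {n : ℕ}
    (h0 : bdry (h 0) = Finsupp.single [] 1)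
    (hs : ∀ i < n, bdry (h (i + 1)) = h i + map f (h i))
    (hc : ∀ i < n, h i ∈ Finsupp.supported (ZMod 2) (ZMod 2)
      {l | l.length = i + 1 ∧ ∀ j, ∀ x ∈ l, s j (f x) = s j x + 1}) :
    ∃ l ∈ (h n).support, ∀ j < n, ∃ x ∈ l, ∃ y ∈ l, s j x ≠ s j y := by
  have key : ∀ i ≤ n, evalOn (alternation s i) (h i) = 1 := by
    intro i hi
    induction i with
    | zero => simp [evalOn_alternation_zero, h0]
    | succ i ih =>
      rw [evalOn_alternation_succ, hs i hi, evalOn_signedAlternation_map s f i (hc i hi),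
        ih (by omega)]
  have h1 := key n le_rfl
  rw [evalOn, Finsupp.linearCombination_apply, Finsupp.sum] at h1
  obtain ⟨l, hl, hne⟩ := Finset.exists_ne_zero_of_sum_ne_zero (h1.trans_ne one_ne_zero)
  exact ⟨l, hl, fun j hj => exists_ne_of_alternation_ne_zero s (right_ne_zero_of_mul hne) hj⟩

end ListChain

namespace ListChain

section Sphere

variable {E : Type*} [AddCommGroup E]

/-- The boundary chain of the cross-polytope with vertices `± e 0, …, ± e (i - 1)`. -/
noncomputable def sphere (e : ℕ → E) : ℕ → ListChain E
  | 0 => Finsupp.single [] 1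
  | i + 1 => cone (e i) (sphere e i) + map Neg.neg (cone (e i) (sphere e i))

theorem map_neg_map_neg (c : ListChain E) : map Neg.neg (map Neg.neg c) = c :=
  hom_ext (f := map Neg.neg ∘ₗ map Neg.neg) (g := LinearMap.id) (fun l => by simp) c

theorem map_neg_sphere (e : ℕ → E) (i : ℕ) : map Neg.neg (sphere e i) = sphere e i := by
  cases i with
  | zero => simp [sphere]
  | succ i => rw [sphere, map_add, map_neg_map_neg, add_comm]

theorem bdry_sphere (e : ℕ → E) (i : ℕ) : bdry (sphere e i) = 0 := by
  induction i with
  | zero => simp [sphere, faces]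
  | succ i ih =>
    rw [sphere, map_add, ← map_bdry, bdry_cone, ih, map_zero, add_zero, map_neg_sphere, add_self]

theorem bdry_cone_sphere (e : ℕ → E) (i : ℕ) : bdry (cone (e i) (sphere e i)) = sphere e i := by
  rw [bdry_cone, bdry_sphere, map_zero, add_zero]

end Sphere

theorem bdry_iterate_subdiv {E : Type*} [NormedAddCommGroup E] [NormedSpace ℝ E] (n r : ℕ)
    (c : ListChain E) : bdry ((subdiv (n + 1))^[r] c) = (subdiv n)^[r] (bdry c) := by
  induction r generalizing c with
  | zero => rfl
  | succ r ih => rw [Function.iterate_succ_apply, ih, bdry_subdiv, Function.iterate_succ_apply]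

theorem map_neg_iterate_subdiv {E : Type*} [NormedAddCommGroup E] [NormedSpace ℝ E] (n r : ℕ)
    (c : ListChain E) : map Neg.neg ((subdiv n)^[r] c) = (subdiv n)^[r] (map Neg.neg c) := by
  induction r generalizing c with
  | zero => rfl
  | succ r ih => rw [Function.iterate_succ_apply, ih, map_neg_subdiv, Function.iterate_succ_apply]

/-- A facet of the cross-polytope, up to a choice of signs `σ`. -/
def facet {n : ℕ} (σ : Fin (n + 1) → ℝ) : Set (Fin (n + 1) → ℝ) :=
  {x | ‖x‖ ≤ 1 ∧ ∑ k, σ k * x k = 1}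

theorem convex_facet {n : ℕ} (σ : Fin (n + 1) → ℝ) : Convex ℝ (facet σ) := by
  intro x hx y hy a b ha hb hab
  refine ⟨?_, ?_⟩
  · have := convex_closedBall (0 : Fin (n + 1) → ℝ) 1 (x := x) (by simpa using hx.1) (y := y)
      (by simpa using hy.1) ha hb hab
    simpa using this
  · have h1 := hx.2
    have h2 := hy.2
    calc ∑ k, σ k * (a • x + b • y) k = a * ∑ k, σ k * x k + b * ∑ k, σ k * y k := by
          simp only [Finset.mul_sum, ← Finset.sum_add_distrib]
          refine Finset.sum_congr rfl fun k _ => ?_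
          simp only [Pi.add_apply, Pi.smul_apply, smul_eq_mul]
          ring
      _ = 1 := by rw [h1, h2]; linarith

def basisVec (n i : ℕ) : Fin (n + 1) → ℝ := fun k => if (k : ℕ) = i then 1 else 0

theorem cone_sphere_mem_of_sphere_mem {n i : ℕ} (hi : i < n + 1)
    (h : sphere (basisVec n) i ∈ Finsupp.supported (ZMod 2) (ZMod 2)
      {l | l.length = i ∧ ∃ σ : Fin (n + 1) → ℝ, (∀ k, |σ k| ≤ 1) ∧
        ∀ x ∈ l, x ∈ facet σ ∧ ∀ k : Fin (n + 1), i ≤ k → x k = 0}) :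
    cone (basisVec n i) (sphere (basisVec n) i) ∈ Finsupp.supported (ZMod 2) (ZMod 2)
      {l | l.length = i + 1 ∧ ∃ σ : Fin (n + 1) → ℝ, (∀ k, |σ k| ≤ 1) ∧
        ∀ x ∈ l, x ∈ facet σ ∧ ∀ k : Fin (n + 1), i + 1 ≤ k → x k = 0} := by
  refine mem_of_supported _ ?_ h
  rintro l ⟨h1, σ, hσ, hl⟩
  rw [cone_single]
  refine Finsupp.single_mem_supported _ _ ⟨by simp [h1], Function.update σ ⟨i, hi⟩ 1, ?_, ?_⟩
  · intro k
    by_cases hk : k = ⟨i, hi⟩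
    · subst hk; simp
    · simpa [hk] using hσ k
  · intro x hx
    rcases List.mem_cons.1 hx with rfl | hx
    · refine ⟨⟨?_, ?_⟩, ?_⟩
      · rw [pi_norm_le_iff_of_nonneg zero_le_one]
        intro k
        unfold basisVec
        split_ifs <;> simp
      · rw [Finset.sum_eq_single ⟨i, hi⟩]
        · simp [basisVec]
        · intro k _ hk
          have : (k : ℕ) ≠ i := fun h => hk (Fin.ext h)
          simp [basisVec, this]
        · simp
      · intro k hk
        have : (k : ℕ) ≠ i := by omega
        simp [basisVec, this]
    · obtain ⟨⟨h2, h3⟩, h4⟩ := hl x hx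
      refine ⟨⟨h2, ?_⟩, fun k hk => h4 k (by omega)⟩
      rw [← h3]
      refine Finset.sum_congr rfl fun k _ => ?_
      by_cases hk : k = ⟨i, hi⟩
      · subst hk; simp [h4]
      · simp [hk]

theorem sphere_mem {n i : ℕ} (hi : i ≤ n + 1) :
    sphere (basisVec n) i ∈ Finsupp.supported (ZMod 2) (ZMod 2)
      {l | l.length = i ∧ ∃ σ : Fin (n + 1) → ℝ, (∀ k, |σ k| ≤ 1) ∧
        ∀ x ∈ l, x ∈ facet σ ∧ ∀ k : Fin (n + 1), i ≤ k → x k = 0} := by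
  induction i with
  | zero => exact Finsupp.single_mem_supported _ _ ⟨rfl, 0, by simp, by simp⟩
  | succ i ih =>
    have h := cone_sphere_mem_of_sphere_mem hi (ih (by omega))
    rw [sphere]
    refine add_mem h (mem_of_supported _ ?_ h)
    rintro l ⟨h1, σ, hσ, hl⟩
    rw [map_single]
    refine Finsupp.single_mem_supported _ _ ⟨by simp [h1], -σ, by simpa using hσ, ?_⟩
    intro x hx
    obtain ⟨y, hy, rfl⟩ := List.mem_map.1 hx
    obtain ⟨⟨h2, h3⟩, h4⟩ := hl y hy
    exact ⟨⟨by simpa using h2, by simpa using h3⟩, fun k hk => by simpa using h4 k hk⟩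

theorem exists_small_alternating {n : ℕ} (s : ℕ → (Fin (n + 1) → ℝ) → ZMod 2)
    (hs : ∀ j, ∀ x ≠ 0, s j (-x) = s j x + 1) (r : ℕ) :
    ∃ l : List (Fin (n + 1) → ℝ), l.length = n + 1 ∧
      (∀ x ∈ l, ‖x‖ ≤ 1 ∧ 1 ≤ ∑ k, |x k|) ∧
      (∀ x ∈ l, ∀ y ∈ l, ‖x - y‖ ≤ (n / (n + 1)) ^ r * 2) ∧
      ∀ j < n, ∃ x ∈ l, ∃ y ∈ l, s j x ≠ s j y := by
  let h (i : ℕ) : ListChain (Fin (n + 1) → ℝ) :=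
    (subdiv (i + 1))^[r] (cone (basisVec n i) (sphere (basisVec n) i))
  have hmem (i : ℕ) (hi : i < n + 1) : h i ∈ Finsupp.supported (ZMod 2) (ZMod 2)
      {l | l.length = i + 1 ∧ (∃ K ∈ {K | ∃ σ : Fin (n + 1) → ℝ, (∀ k, |σ k| ≤ 1) ∧ K = facet σ},
        ∀ x ∈ l, x ∈ K) ∧ ∀ x ∈ l, ∀ y ∈ l, ‖x - y‖ ≤ (i / (i + 1)) ^ r * 2} := by
    refine subdiv_iterate_mem ?_ (Finsupp.supported_mono ?_
      (cone_sphere_mem_of_sphere_mem hi (sphere_mem hi.le))) r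
    · rintro _ ⟨σ, -, rfl⟩
      exact convex_facet σ
    · rintro l ⟨h1, σ, hσ, hl⟩
      refine ⟨h1, ⟨_, ⟨σ, hσ, rfl⟩, fun x hx => (hl x hx).1⟩, fun x hx y hy => ?_⟩
      have h1 := (hl x hx).1.1
      have h2 := (hl y hy).1.1
      linarith [norm_sub_le x y]
  have hfacet {σ : Fin (n + 1) → ℝ} (hσ : ∀ k, |σ k| ≤ 1) {x : Fin (n + 1) → ℝ}
      (hx : x ∈ facet σ) : 1 ≤ ∑ k, |x k| := by
    rw [← hx.2]
    refine Finset.sum_le_sum fun k _ => ?_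
    calc σ k * x k ≤ |σ k| * |x k| := (le_abs_self _).trans (abs_mul _ _).le
      _ ≤ |x k| := mul_le_of_le_one_left (abs_nonneg _) (hσ k)
  obtain ⟨l, hl, halt⟩ := exists_alternating s Neg.neg h (n := n)
    (by simp only [h]; rw [bdry_iterate_subdiv, bdry_cone_sphere, sphere]
        exact Function.iterate_fixed (subdiv_zero _) r)
    (fun i hi => by
      simp only [h]
      rw [bdry_iterate_subdiv, bdry_cone_sphere, map_neg_iterate_subdiv, sphere, iterate_map_add])
    (fun i hi => by
      refine Finsupp.supported_mono ?_ (hmem i (by omega))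
      rintro l ⟨h1, ⟨_, ⟨σ, hσ, rfl⟩, hl⟩, -⟩
      refine ⟨h1, fun j x hx => hs j x ?_⟩
      rintro rfl
      have := hfacet hσ (hl _ hx)
      norm_num at this)
  obtain ⟨h1, ⟨_, ⟨σ, hσ, rfl⟩, h2⟩, h3⟩ := (Finsupp.mem_supported _ _).1 (hmem n (by omega)) hl
  exact ⟨l, h1, fun x hx => ⟨(h2 x hx).1, hfacet hσ (h2 x hx)⟩, h3, halt⟩

end ListChain

theorem exists_odd_sign (ι : Type*) :
    ∃ o : (ι → ℝ) → ZMod 2, ∀ x ≠ 0, o (-x) = o x + 1 := by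
  classical
  refine ⟨fun x => if h : ∃ k, x k ≠ 0 then if 0 < x h.choose then 1 else 0 else 0,
    fun x hx => ?_⟩
  have h : ∃ k, x k ≠ 0 := Function.ne_iff.1 hx
  have h' : ∃ k, (-x) k ≠ 0 := by simpa using h
  have hk : h'.choose = h.choose := by
    simp only [Pi.neg_apply, ne_eq, neg_eq_zero]
  have h0 := h.choose_spec
  beta_reduce
  rw [dif_pos h, dif_pos h', hk, Pi.neg_apply]
  rcases lt_or_gt_of_ne h0 with h1 | h1
  · rw [if_pos (by linarith), if_neg (by linarith), zero_add]
  · rw [if_neg (by linarith), if_pos h1, CharTwo.add_self_eq_zero]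

open Classical in
/-- The discrete ham sandwich theorem. -/
theorem ham_sandwich {X : Type*} {n : ℕ} (b : Fin (n + 1) → X → ℝ) (A : Fin n → Finset X) :
    ∃ x : Fin (n + 1) → ℝ, x ≠ 0 ∧ ∀ j,
      2 * ((A j).filter fun p => 0 < ∑ k, x k * b k p).card ≤ (A j).card ∧
      2 * ((A j).filter fun p => ∑ k, x k * b k p < 0).card ≤ (A j).card := by
  let v (x : Fin (n + 1) → ℝ) (p : X) : ℝ := ∑ k, x k * b k p
  have hv_neg (x p) : v (-x) p = -v x p := by simp [v]
  have hv_cont (p) : Continuous fun x => v x p := by fun_prop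
  let pos (j : Fin n) (x : Fin (n + 1) → ℝ) : Prop :=
    (A j).card < 2 * ((A j).filter fun p => 0 < v x p).card
  have hpos_neg (j x) : pos j (-x) ↔ (A j).card < 2 * ((A j).filter fun p => v x p < 0).card := by
    simp only [pos, hv_neg, Left.neg_pos_iff]
  have hpos_excl (j x) (h1 : pos j x) (h2 : pos j (-x)) : False := by
    rw [hpos_neg] at h2
    have h3 : ((A j).filter fun p => 0 < v x p).card + ((A j).filter fun p => v x p < 0).card ≤
        (A j).card := by
      rw [← Finset.card_union_of_disjoint]
      · exact Finset.card_le_card (Finset.union_subset (Finset.filter_subset _ _)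
          (Finset.filter_subset _ _))
      · exact Finset.disjoint_filter.2 fun p _ h h' => lt_asymm h h'
    simp only [pos] at h1
    omega
  have hpos_open (j x) (h : pos j x) : ∃ ε > 0, ∀ y, dist y x < ε → pos j y := by
    have h1 : ∀ᶠ y in nhds x, ∀ p ∈ (A j).filter (fun p => 0 < v x p), 0 < v y p := by
      rw [Filter.eventually_all_finset]
      intro p hp
      exact (hv_cont p).continuousAt.eventually_const_lt (Finset.mem_filter.1 hp).2
    obtain ⟨ε, hε, h2⟩ := Metric.eventually_nhds_iff.1 h1
    refine ⟨ε, hε, fun y hy => lt_of_lt_of_le h ?_⟩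
    refine Nat.mul_le_mul_left 2 (Finset.card_le_card fun p hp => ?_)
    exact Finset.mem_filter.2 ⟨(Finset.mem_filter.1 hp).1, h2 hy p hp⟩
  obtain ⟨o, ho⟩ := exists_odd_sign (Fin (n + 1))
  let s (j : ℕ) (x : Fin (n + 1) → ℝ) : ZMod 2 :=
    if h : j < n then if pos ⟨j, h⟩ x then 1 else if pos ⟨j, h⟩ (-x) then 0 else o x else o x
  have hs (j x) (hx : x ≠ 0) : s j (-x) = s j x + 1 := by
    simp only [s, neg_neg]
    by_cases h : j < n
    · simp only [dif_pos h]
      by_cases h1 : pos ⟨j, h⟩ x <;> by_cases h2 : pos ⟨j, h⟩ (-x)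
      · exact (hpos_excl _ _ h1 h2).elim
      · simp [h1, h2, CharTwo.add_self_eq_zero]
      · simp [h1, h2]
      · simp [h1, h2, ho x hx]
    · simp only [dif_neg h, ho x hx]
  choose l hlen hmem hdist halt using ListChain.exists_small_alternating s hs
  have hne (r) : l r ≠ [] := by
    intro h
    simpa [h] using hlen r
  let S : Set (Fin (n + 1) → ℝ) := {x | ‖x‖ ≤ 1 ∧ 1 ≤ ∑ k, |x k|}
  have hS : IsCompact S := by
    refine (isCompact_closedBall (0 : Fin (n + 1) → ℝ) 1).of_isClosed_subset ?_
      (fun x hx => by simpa using hx.1)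
    exact (isClosed_le continuous_norm continuous_const).inter
      (isClosed_le continuous_const
        (continuous_finsetSum _ fun k _ => (continuous_apply k).abs))
  obtain ⟨x, hxS, φ, hφ, hlim⟩ := hS.tendsto_subseq
    (x := fun r => (l r).head (hne r)) (fun r => hmem r _ (List.head_mem _))
  have hmesh : Filter.Tendsto (fun r => ((n : ℝ) / (n + 1)) ^ (φ r) * 2) Filter.atTop (nhds 0) := by
    have h1 := tendsto_pow_atTop_nhds_zero_of_lt_one (r := (n : ℝ) / (n + 1)) (by positivity)
      (by rw [div_lt_one (by positivity)]; linarith)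
    simpa using (h1.comp hφ.tendsto_atTop).mul_const 2
  have hclose (ε : ℝ) (hε : 0 < ε) : ∃ r, ∀ y ∈ l r, dist y x < ε := by
    obtain ⟨r, h1, h2⟩ := ((Metric.tendsto_nhds.1 hlim (ε / 2) (by positivity)).and
      (hmesh.eventually_lt_const (by positivity : 0 < ε / 2))).exists
    refine ⟨φ r, fun y hy => ?_⟩
    have h3 := hdist (φ r) y hy _ (List.head_mem (hne (φ r)))
    rw [← dist_eq_norm] at h3
    simp only [Function.comp_apply] at h1
    linarith [dist_triangle y ((l (φ r)).head (hne (φ r))) x]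
  have hnot (j) : ¬ pos j x ∧ ¬ pos j (-x) := by
    constructor
    · intro h
      obtain ⟨ε, hε, h1⟩ := hpos_open j x h
      obtain ⟨r, hr⟩ := hclose ε hε
      obtain ⟨y, hy, z, hz, hyz⟩ := halt r j j.2
      exact hyz (by simp [s, h1 y (hr y hy), h1 z (hr z hz)])
    · intro h
      obtain ⟨ε, hε, h1⟩ := hpos_open j (-x) h
      obtain ⟨r, hr⟩ := hclose ε hε
      obtain ⟨y, hy, z, hz, hyz⟩ := halt r j j.2
      have hyp := h1 (-y) (by rw [dist_neg_neg]; exact hr y hy)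
      have hzp := h1 (-z) (by rw [dist_neg_neg]; exact hr z hz)
      have hyn : ¬ pos j y := fun h => hpos_excl j y h hyp
      have hzn : ¬ pos j z := fun h => hpos_excl j z h hzp
      exact hyz (by simp [s, hyp, hzp, hyn, hzn])
  refine ⟨x, ?_, fun j => ⟨not_lt.1 (hnot j).1, ?_⟩⟩
  · rintro rfl
    have := hxS.2
    norm_num at this
  · have := (hnot j).2
    rw [hpos_neg] at this
    exact not_lt.1 this

theorem two_mul_finrank_restrictTotalDegree (t : ℕ) :
    2 * Module.finrank ℝ (restrictTotalDegree (Fin 2) ℝ t) = (t + 1) * (t + 2) := by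
  have hsum (n : Fin 2 →₀ ℕ) : (n.sum fun _ e => e) = n 0 + n 1 := by
    rw [Finsupp.sum_fintype _ _ (fun _ => rfl), Fin.sum_univ_two]
  have h1 : {n : Fin 2 →₀ ℕ | (n.sum fun _ e => e) ≤ t} =
      (fun p : (_ : ℕ) × ℕ => Finsupp.equivFunOnFinite.symm ![p.1, p.2]) ''
        ((Finset.range (t + 1)).sigma fun i => Finset.range (t + 1 - i)) := by
    ext n
    simp only [Set.mem_ofPred_eq, Set.mem_image, Finset.mem_coe, Finset.mem_sigma, Finset.mem_range,
      hsum]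
    constructor
    · intro h
      refine ⟨⟨n 0, n 1⟩, ⟨by dsimp only; omega, by dsimp only; omega⟩, ?_⟩
      ext i
      fin_cases i <;> simp
    · rintro ⟨⟨i, j⟩, ⟨h, h'⟩, rfl⟩
      simp at h h' ⊢
      omega
  have hinj : Function.Injective
      (fun p : (_ : ℕ) × ℕ => (Finsupp.equivFunOnFinite.symm ![p.1, p.2] : Fin 2 →₀ ℕ)) := by
    rintro ⟨i, j⟩ ⟨i', j'⟩ h
    have h2 := Finsupp.equivFunOnFinite.symm.injective h
    have h3 := congrFun h2 0
    have h4 := congrFun h2 1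
    simp_all
  have h2 : Module.finrank ℝ (restrictTotalDegree (Fin 2) ℝ t) =
      ∑ i ∈ Finset.range (t + 1), (t + 1 - i) := by
    refine (Module.finrank_eq_nat_card_basis (basisRestrictSupport ℝ
      {n : Fin 2 →₀ ℕ | (n.sum fun _ e => e) ≤ t})).trans ?_
    rw [Nat.card_coe_set_eq, h1, Set.ncard_image_of_injective _ hinj, Set.ncard_coe_finset,
      Finset.card_sigma]
    simp
  rw [h2, ← Finset.sum_range_reflect]
  have h3 : ∑ j ∈ Finset.range (t + 1), (t + 1 - (t + 1 - 1 - j)) =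
      ∑ j ∈ Finset.range (t + 1), (j + 1) := by
    refine Finset.sum_congr rfl fun j hj => ?_
    rw [Finset.mem_range] at hj
    omega
  rw [h3]
  clear h1 hinj h2 h3
  induction t with
  | zero => rfl
  | succ t ih => rw [Finset.sum_range_succ, mul_add, ih]; ring

theorem exists_eval_ne_zero_of_notMem {σ : Type*} (Z : Finset (σ → ℝ)) (z : σ → ℝ)
    (hz : z ∉ Z) : ∃ f : MvPolynomial σ ℝ, f.totalDegree ≤ Z.card ∧ eval z f ≠ 0 ∧
      ∀ w ∈ Z, eval w f = 0 := by
  classical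
  induction Z using Finset.induction_on with
  | empty => exact ⟨1, by simp, by simp, by simp⟩
  | insert w Z hw ih =>
    obtain ⟨f, h1, h2, h3⟩ := ih (fun h => hz (Finset.mem_insert_of_mem h))
    have hwz : z ≠ w := fun h => hz (h ▸ Finset.mem_insert_self _ _)
    obtain ⟨i, hi⟩ := Function.ne_iff.1 hwz
    refine ⟨f * (X i - C (w i)), ?_, ?_, ?_⟩
    · rw [Finset.card_insert_of_notMem hw]
      refine (totalDegree_mul _ _).trans (add_le_add h1 ?_)
      refine (totalDegree_sub_C_le _ _).trans (by simp)
    · simpa [h2, sub_eq_zero] using hi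
    · intro v hv
      rcases Finset.mem_insert.1 hv with rfl | hv
      · simp
      · simp [h3 v hv]

theorem finrank_map_mulLeft {p : MvPolynomial (Fin 2) ℝ} (hp : p ≠ 0) (t : ℕ) :
    Module.finrank ℝ ((restrictTotalDegree (Fin 2) ℝ t).map (LinearMap.mulLeft ℝ p)) =
      Module.finrank ℝ (restrictTotalDegree (Fin 2) ℝ t) :=
  (Submodule.equivMapOfInjective _ (mul_right_injective₀ hp) _).finrank_eq.symm

/-- The upper bound in Bézout's theorem for affine plane curves. -/
theorem card_common_zeros_le {p q : MvPolynomial (Fin 2) ℝ} (hp : p ≠ 0) (hq : q ≠ 0)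
    (hpq : IsRelPrime p q) (Z : Finset (Fin 2 → ℝ))
    (hZ : ∀ z ∈ Z, eval z p = 0 ∧ eval z q = 0) :
    Z.card ≤ p.totalDegree * q.totalDegree := by
  classical
  set a := p.totalDegree with ha
  set b := q.totalDegree with hb
  set N := Z.card with hN
  let W₁ := (restrictTotalDegree (Fin 2) ℝ (b + N)).map (LinearMap.mulLeft ℝ p)
  let W₂ := (restrictTotalDegree (Fin 2) ℝ (a + N)).map (LinearMap.mulLeft ℝ q)
  let Φ : restrictTotalDegree (Fin 2) ℝ (a + b + N) →ₗ[ℝ] (Z → ℝ) :=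
    (LinearMap.pi fun z : Z => (aeval (R := ℝ) (z : Fin 2 → ℝ)).toLinearMap) ∘ₗ
      Submodule.subtype _
  have hΦ (f z) : Φ f z = eval (z : Fin 2 → ℝ) (f : MvPolynomial (Fin 2) ℝ) := by
    simp [Φ, aeval_eq_eval]
  have hsurj : LinearMap.range Φ = ⊤ := by
    rw [eq_top_iff, ← (Pi.basisFun ℝ Z).span_eq, Submodule.span_le]
    rintro _ ⟨z, rfl⟩
    obtain ⟨f, h1, h2, h3⟩ := exists_eval_ne_zero_of_notMem (Z.erase z) z (by simp)
    have hf : f ∈ restrictTotalDegree (Fin 2) ℝ (a + b + N) := by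
      rw [mem_restrictTotalDegree]
      refine h1.trans ((Finset.card_erase_le).trans (by omega))
    refine ⟨(eval (z : Fin 2 → ℝ) f)⁻¹ • ⟨f, hf⟩, ?_⟩
    ext w
    rw [map_smul, Pi.smul_apply, hΦ, Pi.basisFun_apply]
    by_cases hw : w = z
    · subst hw; simp [h2]
    · have : (w : Fin 2 → ℝ) ∈ Z.erase z :=
        Finset.mem_erase.2 ⟨fun h => hw (Subtype.ext h), w.2⟩
      simp [hw, h3 _ this]
  have hrank := LinearMap.finrank_range_add_finrank_ker Φ
  rw [hsurj, finrank_top, Module.finrank_fintype_fun_eq_card, Fintype.card_coe] at hrank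
  have hker : W₁ ⊔ W₂ ≤ (LinearMap.ker Φ).map (Submodule.subtype _) := by
    refine sup_le ?_ ?_
    · rintro _ ⟨f, hf, rfl⟩
      have hf := (mem_restrictTotalDegree _ _ _).1 hf
      refine ⟨⟨p * f, ?_⟩, ?_, rfl⟩
      · rw [mem_restrictTotalDegree]
        refine (totalDegree_mul _ _).trans (by omega)
      · rw [SetLike.mem_coe, LinearMap.mem_ker]
        ext z
        simp [hΦ, (hZ z z.2).1]
    · rintro _ ⟨f, hf, rfl⟩
      have hf := (mem_restrictTotalDegree _ _ _).1 hf
      refine ⟨⟨q * f, ?_⟩, ?_, rfl⟩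
      · rw [mem_restrictTotalDegree]
        refine (totalDegree_mul _ _).trans (by omega)
      · rw [SetLike.mem_coe, LinearMap.mem_ker]
        ext z
        simp [hΦ, (hZ z z.2).2]
  have hinf : W₁ ⊓ W₂ ≤ (restrictTotalDegree (Fin 2) ℝ N).map (LinearMap.mulLeft ℝ (p * q)) := by
    rintro _ ⟨⟨f, hf, rfl⟩, ⟨g, hg, hfg⟩⟩
    have hf := (mem_restrictTotalDegree _ _ _).1 hf
    simp only [LinearMap.mulLeft_apply] at hfg ⊢
    obtain ⟨c, rfl⟩ : q ∣ f := hpq.symm.dvd_of_dvd_mul_left ⟨g, hfg.symm⟩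
    refine ⟨c, ?_, by simp⟩
    rw [SetLike.mem_coe, mem_restrictTotalDegree]
    by_cases hc : c = 0
    · simp [hc]
    · rw [totalDegree_mul_of_isDomain hq hc] at hf
      omega
  have hsum := Submodule.finrank_sup_add_finrank_inf_eq W₁ W₂
  have h1 := Submodule.finrank_mono hker
  have h2 := Submodule.finrank_mono hinf
  rw [Submodule.finrank_map_subtype_eq] at h1
  rw [finrank_map_mulLeft (mul_ne_zero hp hq)] at h2
  rw [finrank_map_mulLeft hp, finrank_map_mulLeft hq] at hsum
  have d1 := two_mul_finrank_restrictTotalDegree (a + b + N)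
  have d2 := two_mul_finrank_restrictTotalDegree (b + N)
  have d3 := two_mul_finrank_restrictTotalDegree (a + N)
  have d4 := two_mul_finrank_restrictTotalDegree N
  nlinarith

/-- Adding a generic constant makes a polynomial coprime to a given one. -/
theorem finite_not_isRelPrime_sub_C {p : MvPolynomial (Fin 2) ℝ} (hp : p ≠ 0)
    (q : MvPolynomial (Fin 2) ℝ) : {b : ℝ | ¬ IsRelPrime p (q - C b)}.Finite := by
  classical
  by_contra hinf
  have hinf : {b : ℝ | ¬ IsRelPrime p (q - C b)}.Infinite := hinf
  have hex : ∀ b ∈ {b : ℝ | ¬ IsRelPrime p (q - C b)},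
      ∃ g ∈ UniqueFactorizationMonoid.factors p, g ∣ q - C b := by
    intro b hb
    have : ¬ ∀ ⦃d⦄, d ∣ p → d ∣ q - C b → ¬ Prime d := fun h =>
      hb ((UniqueFactorizationMonoid.isRelPrime_iff_no_prime_factors hp).2 h)
    push Not at this
    obtain ⟨d, hdp, hdq, hd⟩ := this
    obtain ⟨g, hg, hdg⟩ :=
      UniqueFactorizationMonoid.exists_mem_factors_of_dvd hp hd.irreducible hdp
    exact ⟨g, hg, hdg.dvd_iff_dvd_left.1 hdq⟩
  choose! g hg hgq using hex
  obtain ⟨b, hb, b', hb', hne, heq⟩ := hinf.exists_ne_map_eq_of_mapsTo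
    (t := ((UniqueFactorizationMonoid.factors p).toFinset : Set (MvPolynomial (Fin 2) ℝ)))
    (fun b hb => by simpa using hg b hb) (Finset.finite_toSet _)
  have h1 : g b ∣ C (b' - b) := by
    have := dvd_sub (hgq b hb) (heq ▸ hgq b' hb')
    rwa [sub_sub_sub_cancel_left, ← C_sub] at this
  have h2 : IsUnit (C (b' - b) : MvPolynomial (Fin 2) ℝ) :=
    (isUnit_iff_ne_zero.2 (sub_ne_zero.2 hne.symm)).map C
  exact (UniqueFactorizationMonoid.prime_of_factor _ (hg b hb)).not_isUnit
    (isUnit_of_dvd_unit h1 h2)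

theorem totalDegree_pderiv_le {σ R : Type*} [CommSemiring R] (i : σ) (p : MvPolynomial σ R) :
    (pderiv i p).totalDegree ≤ p.totalDegree - 1 := by
  classical
  rw [totalDegree, Finset.sup_le_iff]
  intro m hm
  rw [mem_support_iff, coeff_pderiv] at hm
  have h := le_totalDegree (mem_support_iff.2 (left_ne_zero_of_mul hm))
  rw [Finsupp.sum_add_index' (fun _ => rfl) (fun _ _ _ => rfl),
    Finsupp.sum_single_index rfl] at h
  omega

theorem hasDerivAt_eval_update {σ : Type*} [DecidableEq σ] (p : MvPolynomial σ ℝ)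
    (y : σ → ℝ) (i : σ) (t : ℝ) :
    HasDerivAt (fun t => eval (Function.update y i t) p)
      (eval (Function.update y i t) (pderiv i p)) t := by
  induction p using MvPolynomial.induction_on with
  | C a => simpa using hasDerivAt_const t a
  | add p q hp hq => simp only [map_add]; exact hp.add hq
  | mul_X p j hp =>
    have hX : HasDerivAt (fun t => Function.update y i t j) (if j = i then 1 else 0) t := by
      by_cases h : j = i
      · subst h; simpa using hasDerivAt_id' t
      · simpa [h] using hasDerivAt_const t (y j)
    have := hp.mul hX
    simp only [map_mul, eval_X, Derivation.leibniz, map_add, smul_eq_mul, pderiv_X]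
    refine this.congr_deriv ?_
    by_cases h : j = i
    · subst h; simp; ring
    · simp [h]; ring

/-- A polynomial has a critical point in a bounded open set if its value at some point of the set
exceeds all boundary values. -/
theorem exists_critical_point {σ : Type*} [Fintype σ] (q : MvPolynomial σ ℝ) {W : Set (σ → ℝ)}
    (hW : IsOpen W) (hb : Bornology.IsBounded W) {x : σ → ℝ} (hx : x ∈ W)
    (h : ∀ y ∈ closure W, y ∉ W → eval y q < eval x q) :
    ∃ y ∈ W, ∀ i, eval y (pderiv i q) = 0 := by
  classical
  obtain ⟨y, hy, hmax⟩ := hb.isCompact_closure.exists_isMaxOn ⟨x, subset_closure hx⟩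
    (f := fun y => eval y q) (continuous_eval q).continuousOn
  have hyW : y ∈ W := by
    by_contra hyW
    exact absurd (hmax (subset_closure hx)) (not_le.2 (h y hy hyW))
  refine ⟨y, hyW, fun i => ?_⟩
  have hloc : IsLocalMax (fun t => eval (Function.update y i t) q) (y i) := by
    have hc : Continuous fun t : ℝ => Function.update y i t :=
      continuous_const.update i continuous_id
    filter_upwards [hc.continuousAt.preimage_mem_nhds
      (by simpa using hW.mem_nhds hyW : W ∈ nhds (Function.update y i (y i)))] with t ht
    have := hmax (subset_closure ht)
    simpa using this
  have := hloc.hasDerivAt_eq_zero (hasDerivAt_eval_update q y i (y i))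
  simpa using this

theorem isOpen_offZeroSet (F : MvPolynomial (Fin 2) ℝ) : IsOpen (offZeroSet F) :=
  isOpen_ne_fun (continuous_eval F) continuous_const

theorem mem_connectedComponentIn_of_mem_closure {α : Type*} [TopologicalSpace α] {S : Set α}
    {x y : α} (hx : x ∈ S) (hy : y ∈ S) (h : y ∈ closure (connectedComponentIn S x)) :
    y ∈ connectedComponentIn S x := by
  have hpre : IsPreconnected (insert y (connectedComponentIn S x)) :=
    isPreconnected_connectedComponentIn.subset_closure (Set.subset_insert _ _)
      (Set.insert_subset h subset_closure)
  exact hpre.subset_connectedComponentIn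
    (Set.mem_insert_of_mem _ (mem_connectedComponentIn hx))
    (Set.insert_subset hy (connectedComponentIn_subset _ _)) (Set.mem_insert _ _)

theorem card_cells_le {F : MvPolynomial (Fin 2) ℝ} {d : ℕ} (hd : F.totalDegree ≤ d)
    (T : Finset (Set (Fin 2 → ℝ))) (hT : (T : Set (Set (Fin 2 → ℝ))) ⊆ cells F) :
    T.card ≤ (d + 1) ^ 2 := by
  classical
  have hT' : ∀ U ∈ T, ∃ x ∈ offZeroSet F, U = connectedComponentIn (offZeroSet F) x :=
    fun U hU => hT hU
  choose! x hxS hxU using hT'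
  obtain ⟨R, hR, hxR⟩ : ∃ R : ℝ, 0 < R ∧ ∀ U ∈ T, x U 0 ^ 2 + x U 1 ^ 2 < R ^ 2 := by
    have hnn : ∀ U ∈ T, 0 ≤ x U 0 ^ 2 + x U 1 ^ 2 := fun U _ => by positivity
    refine ⟨1 + ∑ U ∈ T, (x U 0 ^ 2 + x U 1 ^ 2), ?_, fun U hU => ?_⟩
    · linarith [Finset.sum_nonneg hnn]
    · nlinarith [Finset.sum_nonneg hnn, Finset.single_le_sum hnn hU]
  set G := F * (C (R ^ 2) - X 0 ^ 2 - X 1 ^ 2) with hG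
  have hGev (y : Fin 2 → ℝ) : eval y G = eval y F * (R ^ 2 - y 0 ^ 2 - y 1 ^ 2) := by simp [hG]
  have hGdeg : G.totalDegree ≤ d + 2 := by
    refine (totalDegree_mul _ _).trans (add_le_add hd ?_)
    refine (totalDegree_sub _ _).trans (max_le ((totalDegree_sub _ _).trans (max_le ?_ ?_)) ?_)
    · rw [totalDegree_C]; exact Nat.zero_le _
    all_goals exact (totalDegree_pow _ _).trans (by simp)
  obtain ⟨η, hη, hxη⟩ : ∃ η : ℝ, 0 < η ∧ ∀ U ∈ T, η ≤ |eval (x U) G| := by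
    have hpos : ∀ U ∈ T, 0 < |eval (x U) G| := fun U hU => by
      rw [abs_pos, hGev]
      exact mul_ne_zero (hxS U hU) (by linarith [hxR U hU])
    rcases T.eq_empty_or_nonempty with rfl | hne
    · exact ⟨1, one_pos, by simp⟩
    · obtain ⟨U, hU, hmin⟩ := T.exists_min_image (fun U => |eval (x U) G|) hne
      exact ⟨_, hpos U hU, hmin⟩
  set δ := η / (6 * R) with hδdef
  have hδ : 0 < δ := by positivity
  have hinf : (Set.Ioo 0 δ).Infinite := Set.Ioo_infinite hδ
  have hfin (p : MvPolynomial (Fin 2) ℝ) : {a : ℝ | p - C a = 0}.Finite := by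
    refine Set.Subsingleton.finite fun a ha b hb => C_injective (Fin 2) ℝ ?_
    exact (sub_eq_zero.1 ha).symm.trans (sub_eq_zero.1 hb)
  obtain ⟨a, ha, hp⟩ := (hinf.sdiff (hfin (pderiv 0 G))).nonempty
  have hp : pderiv 0 G - C a ≠ 0 := hp
  obtain ⟨b, hb, hq⟩ := (hinf.sdiff ((hfin (pderiv 1 G)).union
    (finite_not_isRelPrime_sub_C hp (pderiv 1 G)))).nonempty
  obtain ⟨hq, hrel⟩ : pderiv 1 G - C b ≠ 0 ∧
      IsRelPrime (pderiv 0 G - C a) (pderiv 1 G - C b) := by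
    constructor
    · exact fun h => hq (Or.inl h)
    · exact not_not.1 fun h => hq (Or.inr h)
  have hcrit : ∀ U ∈ T, ∃ y ∈ U, eval y (pderiv 0 G - C a) = 0 ∧
      eval y (pderiv 1 G - C b) = 0 := by
    intro U hU
    set B : Set (Fin 2 → ℝ) := {y | y 0 ^ 2 + y 1 ^ 2 < R ^ 2} with hB
    have hBopen : IsOpen B := isOpen_lt (by fun_prop) continuous_const
    have hBabs : ∀ y : Fin 2 → ℝ, y 0 ^ 2 + y 1 ^ 2 ≤ R ^ 2 → |y 0| ≤ R ∧ |y 1| ≤ R :=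
      fun y hy => ⟨abs_le_of_sq_le_sq (by nlinarith [sq_nonneg (y 1)]) hR.le,
        abs_le_of_sq_le_sq (by nlinarith [sq_nonneg (y 0)]) hR.le⟩
    have hBb : Bornology.IsBounded B := by
      refine (Metric.isBounded_closedBall (x := (0 : Fin 2 → ℝ)) (r := R)).subset fun y hy => ?_
      obtain ⟨h0, h1⟩ := hBabs y hy.le
      rw [mem_closedBall_zero_iff, pi_norm_le_iff_of_nonneg hR.le, Fin.forall_fin_two]
      exact ⟨h0, h1⟩
    have hBcl : ∀ y ∈ closure B, y 0 ^ 2 + y 1 ^ 2 ≤ R ^ 2 := by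
      have : IsClosed {y : Fin 2 → ℝ | y 0 ^ 2 + y 1 ^ 2 ≤ R ^ 2} :=
        isClosed_le (by fun_prop) continuous_const
      have hsub : B ⊆ {y : Fin 2 → ℝ | y 0 ^ 2 + y 1 ^ 2 ≤ R ^ 2} :=
        fun z (hz : z 0 ^ 2 + z 1 ^ 2 < R ^ 2) => le_of_lt (a := z 0 ^ 2 + z 1 ^ 2) hz
      exact fun y hy => closure_minimal hsub this hy
    have hUopen : IsOpen U := by
      rw [hxU U hU]
      exact (isOpen_offZeroSet F).connectedComponentIn
    have hxW : x U ∈ U ∩ B := by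
      refine ⟨?_, hxR U hU⟩
      have := mem_connectedComponentIn (hxS U hU)
      rwa [← hxU U hU] at this
    have hzero : ∀ y ∈ closure (U ∩ B), y ∉ U ∩ B → eval y G = 0 := by
      intro y hy hyW
      by_contra hne
      rw [hGev, mul_eq_zero, not_or] at hne
      refine hyW ⟨?_, ?_⟩
      · have hcl := closure_mono Set.inter_subset_left hy
        rw [hxU U hU] at hcl ⊢
        exact mem_connectedComponentIn_of_mem_closure (hxS U hU) hne.1 hcl
      · refine lt_of_le_of_ne (hBcl y (closure_mono Set.inter_subset_right hy)) fun h => hne.2 ?_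
        linarith
    have hpert : ∀ y ∈ closure (U ∩ B), |a * y 0 + b * y 1| ≤ η / 3 := by
      intro y hy
      obtain ⟨h0, h1⟩ := hBabs y (hBcl y (closure_mono Set.inter_subset_right hy))
      calc |a * y 0 + b * y 1| ≤ |a * y 0| + |b * y 1| := abs_add_le _ _
        _ = a * |y 0| + b * |y 1| := by
          rw [abs_mul, abs_mul, abs_of_pos ha.1, abs_of_pos hb.1]
        _ ≤ δ * R + δ * R := by
          gcongr
          · exact ha.2.le
          · exact hb.2.le
        _ = η / 3 := by rw [hδdef]; field_simp; ring
    obtain ⟨s, hs, hsx⟩ : ∃ s : ℝ, |s| = 1 ∧ s * eval (x U) G = |eval (x U) G| := by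
      rcases abs_choice (eval (x U) G) with h | h
      · exact ⟨1, by simp, by rw [h, one_mul]⟩
      · exact ⟨-1, by simp, by rw [h, neg_one_mul]⟩
    have hsne : s ≠ 0 := fun h => by simp [h] at hs
    obtain ⟨y, hy, hcy⟩ := exists_critical_point (C s * (G - C a * X 0 - C b * X 1))
      (hUopen.inter hBopen) (hBb.subset Set.inter_subset_right) hxW fun y hy hyW => by
        have e1 := hpert y hy
        have e2 := hpert (x U) (subset_closure hxW)
        have e3 (z : Fin 2 → ℝ) : |s * (a * z 0 + b * z 1)| = |a * z 0 + b * z 1| := by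
          rw [abs_mul, hs, one_mul]
        rw [← e3] at e1 e2
        have e4 := hzero y hy hyW
        have e5 := hxη U hU
        have e6 := (abs_le.1 e1).1
        have e7 := (abs_le.1 e2).2
        simp only [map_mul, map_sub, eval_C, eval_X, e4]
        nlinarith
    refine ⟨y, hy.1, ?_, ?_⟩
    · have := hcy 0
      simp only [pderiv_C_mul, map_sub, pderiv_X_self, map_mul, eval_C] at this
      simpa [hsne, pderiv_X_of_ne] using this
    · have := hcy 1
      simp only [pderiv_C_mul, map_sub, pderiv_X_self, map_mul, eval_C] at this
      simpa [hsne, pderiv_X_of_ne] using this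
  choose! y hyU hy0 hy1 using hcrit
  have hinj : Set.InjOn y T := by
    intro U hU V hV h
    have h1 : y U ∈ connectedComponentIn (offZeroSet F) (x U) := hxU U hU ▸ hyU U hU
    have h2 : y U ∈ connectedComponentIn (offZeroSet F) (x V) := h ▸ hxU V hV ▸ hyU V hV
    exact (hxU U hU).trans
      ((connectedComponentIn_eq h1).trans ((connectedComponentIn_eq h2).symm.trans (hxU V hV).symm))
  rw [← Finset.card_image_of_injOn hinj]
  refine (card_common_zeros_le hp hq hrel _ ?_).trans ?_
  · intro z hz
    obtain ⟨U, hU, rfl⟩ := Finset.mem_image.1 hz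
    exact ⟨hy0 U hU, hy1 U hU⟩
  · have hdeg (i : Fin 2) (c : ℝ) : (pderiv i G - C c).totalDegree ≤ d + 1 :=
      (totalDegree_sub_C_le _ _).trans ((totalDegree_pderiv_le _ _).trans (by omega))
    rw [sq]
    exact Nat.mul_le_mul (hdeg 0 a) (hdeg 1 b)

theorem finite_cells_and_ncard_le {F : MvPolynomial (Fin 2) ℝ} {d : ℕ} (hd : F.totalDegree ≤ d) :
    (cells F).Finite ∧ (cells F).ncard ≤ (d + 1) ^ 2 := by
  have hfin : (cells F).Finite := by
    by_contra h
    obtain ⟨T, hT, hc⟩ := Set.Infinite.exists_subset_card_eq h ((d + 1) ^ 2 + 1)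
    have := card_cells_le hd T hT
    omega
  refine ⟨hfin, ?_⟩
  rw [Set.ncard_eq_toFinset_card _ hfin]
  exact card_cells_le hd _ (by simp)

/-- The polynomial ham sandwich theorem in the plane. -/
theorem exists_bisecting_polynomial {ι : Type*} [Fintype ι] (A : ι → Finset (Fin 2 → ℝ)) {e : ℕ}
    (he : Fintype.card ι < (e + 1) ^ 2) :
    ∃ f : MvPolynomial (Fin 2) ℝ, f ≠ 0 ∧ f.totalDegree ≤ 2 * e ∧
      ∀ i, 2 * ((A i).filter fun p => 0 < eval p f).card ≤ (A i).card ∧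
        2 * ((A i).filter fun p => eval p f < 0).card ≤ (A i).card := by
  classical
  obtain ⟨g⟩ : Nonempty (Fin (Fintype.card ι + 1) ↪ Fin (e + 1) × Fin (e + 1)) :=
    Function.Embedding.nonempty_of_card_le (by simp; nlinarith)
  let m (k : Fin (Fintype.card ι + 1)) : Fin 2 →₀ ℕ :=
    Finsupp.equivFunOnFinite.symm ![(g k).1, (g k).2]
  have hm : Function.Injective m := by
    intro k l h
    have h2 := Finsupp.equivFunOnFinite.symm.injective h
    have h3 := congrFun h2 0
    have h4 := congrFun h2 1
    exact g.injective (Prod.ext (Fin.ext h3) (Fin.ext h4))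
  obtain ⟨x, hx, hbis⟩ := ham_sandwich (fun k p => eval p (monomial (m k) (1 : ℝ)))
    (fun j => A ((Fintype.equivFin ι).symm j))
  have hev (p : Fin 2 → ℝ) : eval p (∑ k, monomial (m k) (x k)) =
      ∑ k, x k * eval p (monomial (m k) (1 : ℝ)) := by
    rw [map_sum]
    exact Finset.sum_congr rfl fun k _ => by simp [eval_monomial]
  refine ⟨∑ k, monomial (m k) (x k), ?_, ?_, fun i => ?_⟩
  · obtain ⟨k, hk⟩ := Function.ne_iff.1 hx
    refine ne_zero_iff.2 ⟨m k, ?_⟩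
    simpa [coeff_sum, coeff_monomial, hm.eq_iff] using hk
  · refine totalDegree_finsetSum_le fun k _ => (totalDegree_monomial_le _ _).trans ?_
    rw [Finsupp.sum_fintype _ _ (fun _ => rfl), Fin.sum_univ_two]
    have h1 := (g k).1.2
    have h2 := (g k).2.2
    simp only [m, Finsupp.equivFunOnFinite_symm_apply_apply, Matrix.cons_val_zero,
      Matrix.cons_val_one, id_eq]
    omega
  · simp only [hev]
    convert hbis (Fintype.equivFin ι i) using 3 <;> simp

theorem exists_refined_partition {ι : Type*} [Fintype ι] {P : Set (Fin 2 → ℝ)}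
    {F : MvPolynomial (Fin 2) ℝ} (hF : F ≠ 0) {A : ι → Finset (Fin 2 → ℝ)}
    (hA : ∀ U, IsPreconnected U → U ⊆ offZeroSet F → ∃ i, P ∩ U ⊆ A i) {e : ℕ}
    (he : Fintype.card ι < (e + 1) ^ 2) :
    ∃ F' : MvPolynomial (Fin 2) ℝ, F' ≠ 0 ∧ F'.totalDegree ≤ F.totalDegree + 2 * e ∧
      ∃ A' : ι × Bool → Finset (Fin 2 → ℝ), (∀ i, 2 * (A' i).card ≤ (A i.1).card) ∧
        ∀ U, IsPreconnected U → U ⊆ offZeroSet F' → ∃ i, P ∩ U ⊆ A' i := by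
  classical
  obtain ⟨f, hf, hdeg, hbis⟩ := exists_bisecting_polynomial A he
  refine ⟨F * f, mul_ne_zero hF hf, (totalDegree_mul _ _).trans (by omega),
    fun i => if i.2 then (A i.1).filter fun p => 0 < eval p f
      else (A i.1).filter fun p => eval p f < 0, ?_, fun U hU hUF => ?_⟩
  · rintro ⟨i, s⟩
    cases s
    · simpa using (hbis i).2
    · simpa using (hbis i).1
  · have hne : ∀ p ∈ U, eval p F ≠ 0 ∧ eval p f ≠ 0 := fun p hp => by
      have : eval p (F * f) ≠ 0 := hUF hp
      rwa [map_mul, mul_ne_zero_iff] at this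
    obtain ⟨i, hi⟩ := hA U hU fun p hp => (hne p hp).1
    have hsign : (∀ p ∈ U, 0 < eval p f) ∨ ∀ p ∈ U, eval p f < 0 := by
      by_contra! h
      obtain ⟨⟨p, hp, hp0⟩, q, hq, hq0⟩ := h
      obtain ⟨z, hz, hz0⟩ := hU.intermediate_value hp hq (continuous_eval f).continuousOn
        ⟨hp0, hq0⟩
      exact (hne z hz).2 hz0
    rcases hsign with h | h
    · exact ⟨(i, true), fun p hp => by simpa using ⟨hi hp, h p hp.2⟩⟩
    · exact ⟨(i, false), fun p hp => by simpa using ⟨hi hp, h p hp.2⟩⟩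

theorem exists_dyadic_partition (P : Finset (Fin 2 → ℝ)) (J : ℕ) :
    ∃ F : MvPolynomial (Fin 2) ℝ, F ≠ 0 ∧ F.totalDegree ≤ 6 * 2 ^ J ∧
      ∃ (ι : Type) (_ : Fintype ι) (A : ι → Finset (Fin 2 → ℝ)), Fintype.card ι = 4 ^ J ∧
        (∀ i, 4 ^ J * (A i).card ≤ P.card) ∧
        ∀ U, IsPreconnected U → U ⊆ offZeroSet F → ∃ i, (P : Set (Fin 2 → ℝ)) ∩ U ⊆ A i := by
  induction J with
  | zero =>
    exact ⟨1, one_ne_zero, by simp, Unit, inferInstance, fun _ => P, by simp, by simp,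
      fun U _ _ => ⟨(), Set.inter_subset_left⟩⟩
  | succ J ih =>
    obtain ⟨F, hF, hdeg, ι, _, A, hcard, hA, hcov⟩ := ih
    have h4 : (4 : ℕ) ^ J = 2 ^ J * 2 ^ J := by rw [← mul_pow]; norm_num
    obtain ⟨F₁, hF₁, hdeg₁, A₁, hA₁, hcov₁⟩ :=
      exists_refined_partition hF hcov (e := 2 ^ J) (by rw [hcard, h4]; nlinarith)
    obtain ⟨F₂, hF₂, hdeg₂, A₂, hA₂, hcov₂⟩ :=
      exists_refined_partition hF₁ hcov₁ (e := 2 * 2 ^ J)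
        (by rw [Fintype.card_prod, hcard, h4, Fintype.card_bool]; nlinarith)
    refine ⟨F₂, hF₂, ?_, (ι × Bool) × Bool, inferInstance, A₂, ?_, fun i => ?_, hcov₂⟩
    · rw [pow_succ]; omega
    · rw [Fintype.card_prod, Fintype.card_prod, hcard, Fintype.card_bool]; ring
    · have h1 := hA₂ i
      have h2 := hA₁ i.1
      calc 4 ^ (J + 1) * (A₂ i).card = 4 ^ J * (2 * (2 * (A₂ i).card)) := by ring
        _ ≤ 4 ^ J * (A i.1.1).card := by gcongr; omega
        _ ≤ P.card := hA _

/-- Guth–Katz polynomial partitioning in the plane: there is an absolute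
constant `C > 0` such that for every finite set `P` of `n` points in `ℝ²` and
every positive integer `D` there is a nonzero polynomial `F` of degree at most
`D` such that `ℝ² ∖ Z(F)` has at most `D²` connected components, each
containing at most `C·n/D²` points of `P`. -/
theorem polynomial_partitioning :
    ∃ C : ℝ, 0 < C ∧
      ∀ (P : Set (Fin 2 → ℝ)), P.Finite → ∀ D : ℕ, 0 < D →
        ∃ F : MvPolynomial (Fin 2) ℝ, F ≠ 0 ∧ F.totalDegree ≤ D ∧
          (cells F).Finite ∧ (cells F).ncard ≤ D ^ 2 ∧
          ∀ U ∈ cells F, ((P ∩ U).ncard : ℝ) ≤ C * (P.ncard : ℝ) / (D : ℝ) ^ 2 := by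
  refine ⟨144, by norm_num, fun P hP D hD => ?_⟩
  have hD' : (0 : ℝ) < D ^ 2 := by positivity
  rcases le_or_gt D 6 with hD6 | hD6
  · have hdeg : (1 : MvPolynomial (Fin 2) ℝ).totalDegree ≤ 0 := by simp
    obtain ⟨hfin, hcells⟩ := finite_cells_and_ncard_le hdeg
    refine ⟨1, one_ne_zero, by simp, hfin, hcells.trans ?_, fun U _ => ?_⟩
    · exact Nat.pow_le_pow_left hD 2
    · have h1 : ((P ∩ U).ncard : ℝ) ≤ P.ncard := by
        exact_mod_cast Set.ncard_le_ncard Set.inter_subset_left hP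
      have h2 : (D : ℝ) ≤ 6 := by exact_mod_cast hD6
      rw [le_div_iff₀ hD']
      have h3 : (D : ℝ) ^ 2 ≤ 144 := by nlinarith [(Nat.cast_nonneg D : (0 : ℝ) ≤ D)]
      nlinarith [mul_le_mul h1 h3 hD'.le (Nat.cast_nonneg _)]
  · lift P to Finset (Fin 2 → ℝ) using hP
    set J := Nat.log 2 ((D - 1) / 6)
    have hJ1 : 2 ^ J ≤ (D - 1) / 6 := Nat.pow_log_le_self 2 (by omega)
    have hJ2 : (D - 1) / 6 < 2 ^ (J + 1) := Nat.lt_pow_succ_log_self one_lt_two _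
    rw [pow_succ] at hJ2
    obtain ⟨F, hF, hdeg, ι, _, A, -, hA, hcov⟩ := exists_dyadic_partition P J
    obtain ⟨hfin, hcells⟩ :=
      finite_cells_and_ncard_le (F := F) (d := D - 1) (by omega)
    refine ⟨F, hF, by omega, hfin, by rwa [Nat.sub_add_cancel hD] at hcells, ?_⟩
    rintro _ ⟨x, -, rfl⟩
    obtain ⟨i, hi⟩ := hcov _ isPreconnected_connectedComponentIn
      (connectedComponentIn_subset (offZeroSet F) x)
    have h1 := Set.ncard_le_ncard hi (Finset.finite_toSet _)
    have h2 := hA i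
    have h3 : D ^ 2 ≤ 144 * 4 ^ J := by
      have h4 : (4 : ℕ) ^ J = 2 ^ J * 2 ^ J := by rw [← mul_pow]; norm_num
      have h5 : D ≤ 12 * 2 ^ J := by omega
      rw [h4]
      nlinarith
    rw [Set.ncard_coe_finset] at h1 ⊢
    rw [le_div_iff₀ hD']
    norm_cast
    calc _ ≤ (A i).card * (144 * 4 ^ J) := Nat.mul_le_mul h1 h3
      _ = 144 * (4 ^ J * (A i).card) := by ring
      _ ≤ 144 * P.card := by gcongr
end

section
/- Let α, β be real constants with 2α + β = 1 and α ≤ 2/3, and let A, B > 0. Then there exist constants c > 0 and C₁ ≥ 1, depending only on α, A and B, with the following property. Let m, n be positive integers with m ≤ n²/C₁ and n ≤ m²/C₁, let P be a finite set of points and L a finite set of lines in ℝ² with |P| ≤ A·m^α n^β and |I(P,L)| ≥ B·m^{α+2/3} n^{β−1/3}. Then |L| ≥ c·m^{α/2+1} n^{β/2−1/2}. -/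
/-- `l ⊆ ℝ²` is a line if it is the solution set of a nontrivial affine equation. -/
def IsLine (l : Set (ℝ × ℝ)) : Prop :=
  ∃ a b c : ℝ, (a, b) ≠ (0, 0) ∧ l = {p : ℝ × ℝ | a * p.1 + b * p.2 = c}

/-- The set of incidences between a set of points `P` and a set of lines `L`. -/
def Incidences (P : Set (ℝ × ℝ)) (L : Set (Set (ℝ × ℝ))) :
    Set ((ℝ × ℝ) × Set (ℝ × ℝ)) :=
  {pl | pl.1 ∈ P ∧ pl.2 ∈ L ∧ pl.1 ∈ pl.2}

namespace SzemerediTrotter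

open Finset

/-- The height over `x` of the line `y = l.1 * x + l.2`. -/
def height (l : ℝ × ℝ) (x : ℝ) : ℝ := l.1 * x + l.2

/-- The slope and intercept of the line through the two endpoints of `e`. -/
noncomputable def lineThrough (e : (ℝ × ℝ) × (ℝ × ℝ)) : ℝ × ℝ :=
  ((e.2.2 - e.1.2) / (e.2.1 - e.1.1),
    e.1.2 - (e.2.2 - e.1.2) / (e.2.1 - e.1.1) * e.1.1)

/-- The abscissa `x` lies strictly between those of the endpoints of `e`. -/
def Over (e : (ℝ × ℝ) × (ℝ × ℝ)) (x : ℝ) : Prop := e.1.1 < x ∧ x < e.2.1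

/-- The interiors of the segments `e` and `f` meet. -/
def Crosses (e f : (ℝ × ℝ) × (ℝ × ℝ)) : Prop :=
  e ≠ f ∧ ∃ x, Over e x ∧ Over f x ∧ height (lineThrough e) x = height (lineThrough f) x

lemma height_lineThrough_left (e : (ℝ × ℝ) × (ℝ × ℝ)) :
    height (lineThrough e) e.1.1 = e.1.2 := by
  simp [height, lineThrough]

lemma height_lineThrough_right {e : (ℝ × ℝ) × (ℝ × ℝ)} (he : e.1.1 < e.2.1) :
    height (lineThrough e) e.2.1 = e.2.2 := by
  have : e.2.1 - e.1.1 ≠ 0 := by linarith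
  simp only [height, lineThrough]
  field_simp
  ring

lemma eq_of_height_eq {l l' : ℝ × ℝ} {x y : ℝ} (hxy : x ≠ y)
    (hx : height l x = height l' x) (hy : height l y = height l' y) : l = l' := by
  simp only [height] at hx hy
  have h1 : (l.1 - l'.1) * (x - y) = 0 := by linear_combination hx - hy
  have h2 : l.1 = l'.1 := by
    rcases mul_eq_zero.1 h1 with h | h
    · linarith
    · exact absurd (by linarith) hxy
  refine Prod.ext h2 ?_
  rw [h2] at hx
  linarith

lemma exists_height_eq {l l' : ℝ × ℝ} {a b : ℝ} (hab : a ≤ b)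
    (ha : height l' a < height l a) (hb : height l b < height l' b) :
    ∃ x, a < x ∧ x < b ∧ height l x = height l' x := by
  simp only [height] at *
  have hlt : a < b := lt_of_le_of_ne hab (by rintro rfl; linarith)
  have hs : 0 < l'.1 - l.1 := by
    by_contra! h
    nlinarith
  refine ⟨(l.2 - l'.2) / (l'.1 - l.1), ?_, ?_, ?_⟩
  · rw [lt_div_iff₀ hs]; linarith
  · rw [div_lt_iff₀ hs]; linarith
  · field_simp; ring

/-- Two edges sharing their left endpoint, compared by slope. -/
lemma height_lt_of_slope_lt {e f : (ℝ × ℝ) × (ℝ × ℝ)} (hef : f.1 = e.1)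
    (hs : (lineThrough e).1 < (lineThrough f).1) {x : ℝ} (hx : e.1.1 < x) :
    height (lineThrough e) x < height (lineThrough f) x := by
  have h1 := height_lineThrough_left e
  have h2 := height_lineThrough_left f
  rw [hef] at h2
  simp only [height] at *
  nlinarith

lemma height_le_of_slope_le {e f : (ℝ × ℝ) × (ℝ × ℝ)} (hef : f.1 = e.1)
    (hs : (lineThrough e).1 ≤ (lineThrough f).1) {x : ℝ} (hx : e.1.1 < x) :
    height (lineThrough e) x ≤ height (lineThrough f) x := by
  have h1 := height_lineThrough_left e
  have h2 := height_lineThrough_left f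
  rw [hef] at h2
  simp only [height] at *
  nlinarith

lemma eq_of_left_eq_of_slope_eq {E : Finset ((ℝ × ℝ) × (ℝ × ℝ))}
    (hE : ∀ e ∈ E, e.1.1 < e.2.1) (hcr : ∀ e ∈ E, ∀ f ∈ E, ¬ Crosses e f)
    {e f : (ℝ × ℝ) × (ℝ × ℝ)} (he : e ∈ E) (hf : f ∈ E) (hef : f.1 = e.1)
    (hs : (lineThrough e).1 = (lineThrough f).1) : e = f := by
  by_contra hne
  have hm : e.1.1 < min e.2.1 f.2.1 := lt_min (hE e he) (by rw [← hef]; exact hE f hf)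
  obtain ⟨x, hx1, hx2⟩ := exists_between hm
  rw [lt_min_iff] at hx2
  exact hcr e he f hf ⟨hne, x, ⟨hx1, hx2.1⟩, ⟨by rwa [hef], hx2.2⟩,
    le_antisymm (height_le_of_slope_le hef hs.le hx1)
      (height_le_of_slope_le hef.symm hs.ge (by rwa [hef]))⟩

/-- An edge `f` starting above the edge `e` stays weakly above it, as long as both last. -/
lemma height_le_of_not_crosses {e f : (ℝ × ℝ) × (ℝ × ℝ)} (hcr : ¬ Crosses e f) {a b : ℝ}
    (hab : a ≤ b) (hea : e.1.1 ≤ a) (hfa : f.1.1 ≤ a) (heb : b ≤ e.2.1) (hfb : b ≤ f.2.1)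
    (h : height (lineThrough e) a < height (lineThrough f) a) :
    height (lineThrough e) b ≤ height (lineThrough f) b := by
  by_contra! hlt
  obtain ⟨x, hax, hxb, hx⟩ := exists_height_eq hab h hlt
  refine hcr ⟨by rintro rfl; exact lt_irrefl _ h, x, ⟨by linarith, by linarith⟩,
    ⟨by linarith, by linarith⟩, hx.symm⟩

/-- `IsWedge V E e h w`: the edge `h` is the next one above `e` at the left endpoint of `e`, and
`w` is the leftmost vertex of the closed wedge between them. -/
structure IsWedge (V : Finset (ℝ × ℝ)) (E : Finset ((ℝ × ℝ) × (ℝ × ℝ)))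
    (e h : (ℝ × ℝ) × (ℝ × ℝ)) (w : ℝ × ℝ) : Prop where
  memBot : e ∈ E
  memTop : h ∈ E
  memApex : w ∈ V
  left_eq : h.1 = e.1
  slope_lt : (lineThrough e).1 < (lineThrough h).1
  slope_min : ∀ f ∈ E, f.1 = e.1 → (lineThrough e).1 < (lineThrough f).1 →
    (lineThrough h).1 ≤ (lineThrough f).1
  left_lt : e.1.1 < w.1
  bot_le : height (lineThrough e) w.1 ≤ w.2
  le_top : w.2 ≤ height (lineThrough h) w.1
  leftmost : ∀ z ∈ V, e.1.1 < z.1 → height (lineThrough e) z.1 ≤ z.2 →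
    z.2 ≤ height (lineThrough h) z.1 → w.1 ≤ z.1

lemma exists_isWedge {V : Finset (ℝ × ℝ)} {E : Finset ((ℝ × ℝ) × (ℝ × ℝ))}
    (hE : ∀ e ∈ E, e.1.1 < e.2.1) (hV : ∀ e ∈ E, e.2 ∈ V)
    {e : (ℝ × ℝ) × (ℝ × ℝ)} (he : e ∈ E)
    (h : ∃ f ∈ E, f.1 = e.1 ∧ (lineThrough e).1 < (lineThrough f).1) :
    ∃ h w, IsWedge V E e h w := by
  classical
  obtain ⟨f, hf, hfe, hlt⟩ := h
  obtain ⟨g, hg, hgmin⟩ := exists_min_image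
    (E.filter fun f => f.1 = e.1 ∧ (lineThrough e).1 < (lineThrough f).1)
    (fun f => (lineThrough f).1) ⟨f, by simp [hf, hfe, hlt]⟩
  simp only [mem_filter] at hg hgmin
  obtain ⟨hgE, hge, hlt'⟩ := hg
  obtain ⟨w, hw, hwmin⟩ := exists_min_image
    (V.filter fun z => e.1.1 < z.1 ∧ height (lineThrough e) z.1 ≤ z.2 ∧
      z.2 ≤ height (lineThrough g) z.1) Prod.fst ⟨e.2, by
        have h1 := height_lineThrough_right (hE e he)
        have h2 := height_lt_of_slope_lt hge hlt' (hE e he)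
        simp only [mem_filter]
        exact ⟨hV e he, hE e he, h1.le, by linarith⟩⟩
  simp only [mem_filter] at hw hwmin
  exact ⟨g, w, he, hgE, hw.1, hge, hlt', fun f hf h1 h2 => hgmin f ⟨hf, h1, h2⟩, hw.2.1, hw.2.2.1,
    hw.2.2.2, fun z hz h1 h2 h3 => hwmin z ⟨hz, h1, h2, h3⟩⟩

namespace IsWedge

variable {V : Finset (ℝ × ℝ)} {E : Finset ((ℝ × ℝ) × (ℝ × ℝ))}
  {e h e' h' : (ℝ × ℝ) × (ℝ × ℝ)} {w : ℝ × ℝ}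

lemma bot_lt_top (H : IsWedge V E e h w) :
    height (lineThrough e) w.1 < height (lineThrough h) w.1 :=
  height_lt_of_slope_lt H.left_eq H.slope_lt H.left_lt

lemma apex_le_bot (hE : ∀ e ∈ E, e.1.1 < e.2.1) (hV : ∀ e ∈ E, e.2 ∈ V)
    (H : IsWedge V E e h w) : w.1 ≤ e.2.1 := by
  have he := hE e H.memBot
  have h1 := height_lineThrough_right he
  have h2 := height_lt_of_slope_lt H.left_eq H.slope_lt he
  exact H.leftmost _ (hV e H.memBot) he h1.le (by linarith)

lemma apex_le_top (hE : ∀ e ∈ E, e.1.1 < e.2.1) (hV : ∀ e ∈ E, e.2 ∈ V)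
    (H : IsWedge V E e h w) : w.1 ≤ h.2.1 := by
  have hh := hE h H.memTop
  have h1 := height_lineThrough_right hh
  have hlt : e.1.1 < h.2.1 := by rwa [← H.left_eq]
  have h2 := height_lt_of_slope_lt H.left_eq H.slope_lt hlt
  exact H.leftmost _ (hV h H.memTop) hlt (by linarith) h1.ge

lemma not_left_lt (hE : ∀ e ∈ E, e.1.1 < e.2.1) (hV₁ : ∀ e ∈ E, e.1 ∈ V)
    (hV : ∀ e ∈ E, e.2 ∈ V) (hcr : ∀ e ∈ E, ∀ f ∈ E, ¬ Crosses e f)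
    (H : IsWedge V E e h w) (H' : IsWedge V E e' h' w)
    (htype : w.2 = height (lineThrough h) w.1 ↔ w.2 = height (lineThrough h') w.1) :
    ¬ e.1.1 < e'.1.1 := by
  intro hlt
  have b1 := H.apex_le_bot hE hV
  have b2 := H.apex_le_top hE hV
  have b3 := H'.apex_le_bot hE hV
  have b4 := H'.apex_le_top hE hV
  have l1 := congrArg Prod.fst H.left_eq
  have l2 := congrArg Prod.fst H'.left_eq
  have t1 := H.bot_lt_top
  have t2 := H'.bot_lt_top
  have a1 := H.bot_le
  have a2 := H.le_top
  have a3 := H'.bot_le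
  have a4 := H'.le_top
  have l3 := H'.left_lt
  have p1 := height_lineThrough_left e'
  have p2 := height_lineThrough_left h'
  rw [H'.left_eq] at p2
  rcases lt_or_ge (height (lineThrough h) e'.1.1) e'.1.2 with hab | hab
  · have key := height_le_of_not_crosses (hcr h H.memTop e' H'.memBot) (a := e'.1.1) (b := w.1)
      l3.le (by linarith) le_rfl b2 b3 (by linarith)
    have e1 : w.2 = height (lineThrough h) w.1 := by linarith
    have e2 := htype.1 e1
    linarith
  rcases lt_or_ge e'.1.2 (height (lineThrough e) e'.1.1) with hbe | hbe
  · have key := height_le_of_not_crosses (hcr h' H'.memTop e H.memBot) (a := e'.1.1) (b := w.1)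
      l3.le (by linarith) (by linarith) b4 b1 (by linarith)
    have e1 : w.2 = height (lineThrough h') w.1 := by linarith
    have e2 := htype.2 e1
    linarith
  · have := H.leftmost _ (hV₁ e' H'.memBot) hlt hbe hab
    linarith

lemma not_slope_lt (hle : e'.1 = e.1)
    (H : IsWedge V E e h w) (H' : IsWedge V E e' h' w)
    (htype : w.2 = height (lineThrough h) w.1 ↔ w.2 = height (lineThrough h') w.1) :
    ¬ (lineThrough e).1 < (lineThrough e').1 := by
  intro hlt
  have h1 := H.slope_min e' H'.memBot hle hlt
  have h2 := height_le_of_slope_le (e := h) (f := e') (hle.trans H.left_eq.symm) h1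
    (x := w.1) (by rw [H.left_eq]; exact H.left_lt)
  have a1 := H.le_top
  have a2 := H'.bot_le
  have t2 := H'.bot_lt_top
  have := htype.1 (by linarith)
  linarith

lemma bot_unique (hx : Set.InjOn Prod.fst (V : Set (ℝ × ℝ)))
    (hE : ∀ e ∈ E, e.1.1 < e.2.1) (hV₁ : ∀ e ∈ E, e.1 ∈ V)
    (hV : ∀ e ∈ E, e.2 ∈ V) (hcr : ∀ e ∈ E, ∀ f ∈ E, ¬ Crosses e f)
    (H : IsWedge V E e h w) (H' : IsWedge V E e' h' w)
    (htype : w.2 = height (lineThrough h) w.1 ↔ w.2 = height (lineThrough h') w.1) :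
    e = e' := by
  have h1 := H.not_left_lt hE hV₁ hV hcr H' htype
  have h2 := H'.not_left_lt hE hV₁ hV hcr H htype.symm
  have hle : e'.1 = e.1 :=
    hx (hV₁ e' H'.memBot) (hV₁ e H.memBot) (le_antisymm (not_lt.1 h1) (not_lt.1 h2))
  exact eq_of_left_eq_of_slope_eq hE hcr H.memBot H'.memBot hle
    (le_antisymm (not_lt.1 (H'.not_slope_lt hle.symm H htype.symm))
      (not_lt.1 (H.not_slope_lt hle H' htype)))

end IsWedge

/-- A plane graph drawn with straight edges has at most three times as many edges as vertices. -/
lemma card_edges_le_of_not_crosses {V : Finset (ℝ × ℝ)} {E : Finset ((ℝ × ℝ) × (ℝ × ℝ))}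
    (hx : Set.InjOn Prod.fst (V : Set (ℝ × ℝ)))
    (hE : ∀ e ∈ E, e.1.1 < e.2.1) (hV₁ : ∀ e ∈ E, e.1 ∈ V)
    (hV : ∀ e ∈ E, e.2 ∈ V) (hcr : ∀ e ∈ E, ∀ f ∈ E, ¬ Crosses e f) :
    #E ≤ 3 * #V := by
  classical
  let Q : (ℝ × ℝ) × (ℝ × ℝ) → Prop :=
    fun e => ∃ f ∈ E, f.1 = e.1 ∧ (lineThrough e).1 < (lineThrough f).1
  have htop : #(E.filter fun e => ¬ Q e) ≤ #V := by
    refine card_le_card_of_injOn Prod.fst (fun e he => hV₁ e (mem_filter.1 he).1) ?_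
    intro e he f hf hef
    simp only [coe_filter, Set.mem_ofPred_eq, Q, not_exists, not_and, not_lt] at he hf
    exact eq_of_left_eq_of_slope_eq hE hcr he.1 hf.1 hef.symm
      (le_antisymm (hf.2 e he.1 hef) (he.2 f hf.1 hef.symm))
  have hbot : #(E.filter Q) ≤ #(V ×ˢ (univ : Finset Bool)) := by
    have hW : ∀ e, ∃ h w, e ∈ E.filter Q → IsWedge V E e h w := by
      intro e
      by_cases he : e ∈ E.filter Q
      · obtain ⟨h, w, H⟩ := exists_isWedge hE hV (mem_filter.1 he).1 (mem_filter.1 he).2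
        exact ⟨h, w, fun _ => H⟩
      · exact ⟨e, e.1, fun h => absurd h he⟩
    choose h w H using hW
    refine card_le_card_of_injOn
      (fun e => (w e, decide ((w e).2 = height (lineThrough (h e)) (w e).1))) ?_ ?_
    · intro e he
      exact mem_product.2 ⟨(H e he).memApex, mem_univ _⟩
    · intro e he f hf hef
      simp only [Prod.mk.injEq, decide_eq_decide] at hef
      have H2 := H f hf
      rw [← hef.1] at H2
      refine (H e he).bot_unique hx hE hV₁ hV hcr H2 ?_
      rw [hef.2, hef.1]
  have := card_filter_add_card_filter_not (s := E) Q
  rw [card_product, card_univ, Fintype.card_bool] at hbot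
  omega

open Classical in
/-- The ordered pairs of crossing edges. -/
noncomputable def crossings (E : Finset ((ℝ × ℝ) × (ℝ × ℝ))) :
    Finset (((ℝ × ℝ) × (ℝ × ℝ)) × ((ℝ × ℝ) × (ℝ × ℝ))) :=
  (E ×ˢ E).filter fun p => Crosses p.1 p.2

lemma mem_crossings {E : Finset ((ℝ × ℝ) × (ℝ × ℝ))} {p} :
    p ∈ crossings E ↔ (p.1 ∈ E ∧ p.2 ∈ E) ∧ Crosses p.1 p.2 := by
  simp [crossings]

lemma card_edges_le {V : Finset (ℝ × ℝ)} (hx : Set.InjOn Prod.fst (V : Set (ℝ × ℝ)))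
    (E : Finset ((ℝ × ℝ) × (ℝ × ℝ)))
    (hE : ∀ e ∈ E, e.1.1 < e.2.1) (hV₁ : ∀ e ∈ E, e.1 ∈ V) (hV : ∀ e ∈ E, e.2 ∈ V) :
    #E ≤ 3 * #V + #(crossings E) := by
  classical
  induction E using Finset.strongInduction with
  | H E ih =>
    by_cases hcr : ∀ e ∈ E, ∀ f ∈ E, ¬ Crosses e f
    · exact (card_edges_le_of_not_crosses hx hE hV₁ hV hcr).trans (Nat.le_add_right _ _)
    · push Not at hcr
      obtain ⟨e, he, f, hf, hef⟩ := hcr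
      have h1 := ih (E.erase e) (erase_ssubset he) (fun g hg => hE g (mem_of_mem_erase hg))
        (fun g hg => hV₁ g (mem_of_mem_erase hg)) (fun g hg => hV g (mem_of_mem_erase hg))
      have h2 : #(crossings (E.erase e)) < #(crossings E) := by
        refine card_lt_card (Finset.ssubset_iff_subset_ne.2 ⟨fun p hp => ?_, fun h => ?_⟩)
        · rw [mem_crossings] at hp ⊢
          exact ⟨⟨mem_of_mem_erase hp.1.1, mem_of_mem_erase hp.1.2⟩, hp.2⟩
        · have : (e, f) ∈ crossings (E.erase e) := by
            rw [h, mem_crossings]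
            exact ⟨⟨he, hf⟩, hef⟩
          rw [mem_crossings] at this
          exact notMem_erase e E this.1.1
      have h3 := card_erase_add_one he
      omega

/-- The probability that a random subset of `V`, each element being taken independently with
probability `p`, contains `T`. -/
lemma sum_powerset_ite_subset {ι : Type*} [DecidableEq ι] {V T : Finset ι} (hT : T ⊆ V) (p : ℝ) :
    ∑ S ∈ V.powerset, p ^ #S * (1 - p) ^ #(V \ S) * (if T ⊆ S then 1 else 0) = p ^ #T := by
  have h := prod_add (fun _ : ι => p) (fun i => if i ∈ T then 0 else 1 - p) V
  have hl : ∏ i ∈ V, (p + if i ∈ T then 0 else 1 - p) = p ^ #T := by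
    have : ∀ i ∈ V, (p + if i ∈ T then 0 else 1 - p) = if i ∈ T then p else 1 := by
      intro i _
      split_ifs <;> ring
    rw [prod_congr rfl this, prod_ite_mem, inter_eq_right.2 hT, prod_const]
  rw [← hl, h]
  refine sum_congr rfl fun S hS => ?_
  rw [mul_assoc, prod_const]
  congr 1
  split_ifs with hTS
  · rw [mul_one, ← prod_const]
    exact prod_congr rfl fun i hi => by rw [if_neg fun hiT => (mem_sdiff.1 hi).2 (hTS hiT)]
  · obtain ⟨i, hiT, hiS⟩ := not_subset.1 hTS
    rw [mul_zero, prod_eq_zero (mem_sdiff.2 ⟨hT hiT, hiS⟩) (by rw [if_pos hiT])]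

lemma sum_powerset_card_filter {ι κ : Type*} [DecidableEq ι] {V : Finset ι} (X : Finset κ)
    (T : κ → Finset ι) {k : ℕ} (hT : ∀ x ∈ X, T x ⊆ V ∧ #(T x) = k) (p : ℝ) :
    ∑ S ∈ V.powerset, p ^ #S * (1 - p) ^ #(V \ S) * (#(X.filter fun x => T x ⊆ S) : ℝ) =
      p ^ k * #X := by
  have h : ∀ S ∈ V.powerset,
      p ^ #S * (1 - p) ^ #(V \ S) * (#(X.filter fun x => T x ⊆ S) : ℝ) =
        ∑ x ∈ X, p ^ #S * (1 - p) ^ #(V \ S) * (if T x ⊆ S then 1 else 0) := by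
    intro S _
    rw [← mul_sum, sum_boole]
  rw [sum_congr rfl h, sum_comm, sum_congr rfl fun x hx => sum_powerset_ite_subset (hT x hx).1 p,
    sum_congr rfl fun x hx => by rw [(hT x hx).2], sum_const, nsmul_eq_mul, mul_comm]

/-- The crossing inequality, before optimising the sampling probability. -/
lemma crossing_inequality {V : Finset (ℝ × ℝ)} (hx : Set.InjOn Prod.fst (V : Set (ℝ × ℝ)))
    (E : Finset ((ℝ × ℝ) × (ℝ × ℝ)))
    (hE : ∀ e ∈ E, e.1.1 < e.2.1) (hV₁ : ∀ e ∈ E, e.1 ∈ V) (hV : ∀ e ∈ E, e.2 ∈ V)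
    (hdisj : ∀ e ∈ E, ∀ f ∈ E, Crosses e f →
      e.1 ≠ f.1 ∧ e.1 ≠ f.2 ∧ e.2 ≠ f.1 ∧ e.2 ≠ f.2)
    {p : ℝ} (hp₀ : 0 ≤ p) (hp₁ : p ≤ 1) :
    p ^ 2 * #E ≤ 3 * (p * #V) + p ^ 4 * #(crossings E) := by
  classical
  have hne : ∀ e ∈ E, e.1 ≠ e.2 := fun e he h => (hE e he).ne (congrArg Prod.fst h)
  have c1 := sum_powerset_card_filter (V := V) (k := 2) E (fun e => {e.1, e.2})
    (fun e he => ⟨by simp [insert_subset_iff, hV₁ e he, hV e he], card_pair (hne e he)⟩) p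
  have c2 := sum_powerset_card_filter (V := V) (k := 1) V (fun v => {v})
    (fun v hv => ⟨by simpa using hv, card_singleton v⟩) p
  have c3 := sum_powerset_card_filter (V := V) (k := 4) (crossings E)
    (fun q => {q.1.1, q.1.2, q.2.1, q.2.2}) (fun q hq => by
      rw [mem_crossings] at hq
      obtain ⟨⟨h1, h2⟩, h3⟩ := hq
      obtain ⟨d1, d2, d3, d4⟩ := hdisj _ h1 _ h2 h3
      refine ⟨by simp [insert_subset_iff, hV₁ _ h1, hV _ h1, hV₁ _ h2, hV _ h2], ?_⟩
      rw [card_insert_of_notMem, card_insert_of_notMem, card_pair (hne _ h2)]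
      · simp [d3, d4]
      · simp [d1, d2, hne _ h1]) p
  rw [pow_one] at c2
  rw [← c1, ← c2, ← c3, mul_sum, ← sum_add_distrib]
  refine sum_le_sum fun S hS => ?_
  rw [mem_powerset] at hS
  have h := card_edges_le (hx.mono (coe_subset.2 hS))
    (E.filter fun e => ({e.1, e.2} : Finset (ℝ × ℝ)) ⊆ S)
    (fun e he => hE e (mem_filter.1 he).1)
    (fun e he => (mem_filter.1 he).2 (by simp)) (fun e he => (mem_filter.1 he).2 (by simp))
  have h1 : #S ≤ #(V.filter fun v => ({v} : Finset (ℝ × ℝ)) ⊆ S) :=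
    card_le_card fun v hv => by simp [hS hv, hv]
  have h2 : #(crossings (E.filter fun e => ({e.1, e.2} : Finset (ℝ × ℝ)) ⊆ S)) ≤
      #((crossings E).filter fun q => ({q.1.1, q.1.2, q.2.1, q.2.2} : Finset (ℝ × ℝ)) ⊆ S) := by
    refine card_le_card fun q hq => ?_
    simp only [mem_crossings, mem_filter, insert_subset_iff, singleton_subset_iff] at hq ⊢
    tauto
  have h3 : #(E.filter fun e => ({e.1, e.2} : Finset (ℝ × ℝ)) ⊆ S) ≤
      3 * #(V.filter fun v => ({v} : Finset (ℝ × ℝ)) ⊆ S) +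
      #((crossings E).filter fun q => ({q.1.1, q.1.2, q.2.1, q.2.2} : Finset (ℝ × ℝ)) ⊆ S) := by
    omega
  have h4 := (Nat.cast_le (α := ℝ)).2 h3
  push_cast at h4
  have hw : 0 ≤ p ^ #S * (1 - p) ^ #(V \ S) :=
    mul_nonneg (pow_nonneg hp₀ _) (pow_nonneg (by linarith) _)
  exact (mul_le_mul_of_nonneg_left h4 hw).trans_eq (by ring)

lemma lineThrough_eq {u v l : ℝ × ℝ} (huv : u.1 < v.1) (hu : u.2 = height l u.1)
    (hv : v.2 = height l v.1) : lineThrough (u, v) = l := by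
  refine eq_of_height_eq huv.ne ?_ ?_
  · rw [← hu]
    exact height_lineThrough_left (u, v)
  · rw [← hv]
    exact height_lineThrough_right (e := (u, v)) huv

open Classical in
/-- The segments joining consecutive points of `P` on the lines of `L`. -/
noncomputable def consecutiveEdges (P L : Finset (ℝ × ℝ)) : Finset ((ℝ × ℝ) × (ℝ × ℝ)) :=
  (P ×ˢ P).filter fun e => e.1.1 < e.2.1 ∧ lineThrough e ∈ L ∧
    ∀ w ∈ P, Over e w.1 → w.2 ≠ height (lineThrough e) w.1

section

variable {P L : Finset (ℝ × ℝ)} {e f : (ℝ × ℝ) × (ℝ × ℝ)}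

lemma mem_consecutiveEdges : e ∈ consecutiveEdges P L ↔ (e.1 ∈ P ∧ e.2 ∈ P) ∧
    e.1.1 < e.2.1 ∧ lineThrough e ∈ L ∧
    ∀ w ∈ P, Over e w.1 → w.2 ≠ height (lineThrough e) w.1 := by
  simp [consecutiveEdges]

lemma left_le_of_lineThrough_eq (he : e ∈ consecutiveEdges P L) (hf : f ∈ consecutiveEdges P L)
    (hl : lineThrough e = lineThrough f) {x : ℝ} (hex : Over e x) (hfx : Over f x) :
    f.1.1 ≤ e.1.1 := by
  rw [mem_consecutiveEdges] at he hf
  by_contra! h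
  refine he.2.2.2 f.1 hf.1.1 ⟨h, hfx.1.trans hex.2⟩ ?_
  rw [hl, height_lineThrough_left]

lemma right_le_of_lineThrough_eq (he : e ∈ consecutiveEdges P L) (hf : f ∈ consecutiveEdges P L)
    (hl : lineThrough e = lineThrough f) {x : ℝ} (hex : Over e x) (hfx : Over f x) :
    e.2.1 ≤ f.2.1 := by
  rw [mem_consecutiveEdges] at he hf
  by_contra! h
  refine he.2.2.2 f.2 hf.1.2 ⟨hex.1.trans hfx.2, h⟩ ?_
  rw [hl, height_lineThrough_right hf.2.1]

lemma eq_of_lineThrough_eq (hx : Set.InjOn Prod.fst (P : Set (ℝ × ℝ)))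
    (he : e ∈ consecutiveEdges P L) (hf : f ∈ consecutiveEdges P L)
    (hl : lineThrough e = lineThrough f) {x : ℝ} (hex : Over e x) (hfx : Over f x) : e = f := by
  have h1 := le_antisymm (left_le_of_lineThrough_eq hf he hl.symm hfx hex)
    (left_le_of_lineThrough_eq he hf hl hex hfx)
  have h2 := le_antisymm (right_le_of_lineThrough_eq he hf hl hex hfx)
    (right_le_of_lineThrough_eq hf he hl.symm hfx hex)
  rw [mem_consecutiveEdges] at he hf
  exact Prod.ext (hx he.1.1 hf.1.1 h1) (hx he.1.2 hf.1.2 h2)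

lemma lineThrough_ne_of_crosses (hx : Set.InjOn Prod.fst (P : Set (ℝ × ℝ)))
    (he : e ∈ consecutiveEdges P L) (hf : f ∈ consecutiveEdges P L) (hef : Crosses e f) :
    lineThrough e ≠ lineThrough f := by
  obtain ⟨hne, x, hex, hfx, -⟩ := hef
  exact fun hl => hne (eq_of_lineThrough_eq hx he hf hl hex hfx)

lemma endpoints_ne_of_crosses (hx : Set.InjOn Prod.fst (P : Set (ℝ × ℝ)))
    (he : e ∈ consecutiveEdges P L) (hf : f ∈ consecutiveEdges P L) (hef : Crosses e f) :
    e.1 ≠ f.1 ∧ e.1 ≠ f.2 ∧ e.2 ≠ f.1 ∧ e.2 ≠ f.2 := by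
  have hl := lineThrough_ne_of_crosses hx he hf hef
  obtain ⟨-, x, hex, hfx, hh⟩ := hef
  rw [mem_consecutiveEdges] at he hf
  have e1 := height_lineThrough_left e
  have e2 := height_lineThrough_right he.2.1
  have f1 := height_lineThrough_left f
  have f2 := height_lineThrough_right hf.2.1
  refine ⟨fun h => hl (eq_of_height_eq hex.1.ne' hh ?_),
    fun h => hl (eq_of_height_eq hex.1.ne' hh ?_),
    fun h => hl (eq_of_height_eq hex.2.ne hh ?_),
    fun h => hl (eq_of_height_eq hex.2.ne hh ?_)⟩
  · rw [e1, h, f1]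
  · rw [e1, h, f2]
  · rw [e2, h, f1]
  · rw [e2, h, f2]

lemma card_crossings_le (hx : Set.InjOn Prod.fst (P : Set (ℝ × ℝ))) :
    #(crossings (consecutiveEdges P L)) ≤ #L ^ 2 := by
  rw [sq, ← card_product]
  refine card_le_card_of_injOn (fun q => (lineThrough q.1, lineThrough q.2)) ?_ ?_
  · intro q hq
    rw [mem_coe, mem_crossings, mem_consecutiveEdges, mem_consecutiveEdges] at hq
    exact mem_product.2 ⟨hq.1.1.2.2.1, hq.1.2.2.2.1⟩
  · rintro ⟨e, f⟩ hq ⟨e', f'⟩ hq' h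
    rw [mem_coe, mem_crossings] at hq hq'
    obtain ⟨⟨he, hf⟩, hc⟩ := hq
    obtain ⟨⟨he', hf'⟩, hc'⟩ := hq'
    obtain ⟨h1, h2⟩ := Prod.mk.inj h
    have hl := lineThrough_ne_of_crosses hx he hf hc
    obtain ⟨-, x, hex, hfx, hh⟩ := hc
    obtain ⟨-, x', hex', hfx', hh'⟩ := hc'
    simp only at *
    rw [← h1, ← h2] at hh'
    have hxx : x = x' := by
      by_contra hne
      exact hl (eq_of_height_eq hne hh hh')
    subst hxx
    rw [eq_of_lineThrough_eq hx he he' h1 hex hex', eq_of_lineThrough_eq hx hf hf' h2 hfx hfx']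

open Classical in
lemma card_incidences_le (hx : Set.InjOn Prod.fst (P : Set (ℝ × ℝ))) :
    #((P ×ˢ L).filter fun q => q.1.2 = height q.2 q.1.1) ≤ #L + #(consecutiveEdges P L) := by
  set I := (P ×ˢ L).filter fun q => q.1.2 = height q.2 q.1.1 with hI
  have memI : ∀ q, q ∈ I ↔ (q.1 ∈ P ∧ q.2 ∈ L) ∧ q.1.2 = height q.2 q.1.1 := by
    intro q
    simp [hI]
  let Q : (ℝ × ℝ) × (ℝ × ℝ) → Prop :=
    fun q => ∃ z ∈ P, q.1.1 < z.1 ∧ z.2 = height q.2 z.1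
  have hlast : #(I.filter fun q => ¬ Q q) ≤ #L := by
    refine card_le_card_of_injOn Prod.snd (fun q hq => ((memI q).1 (mem_filter.1 hq).1).1.2) ?_
    rintro ⟨p, l⟩ hq ⟨p', l'⟩ hq' rfl
    simp only [coe_filter, Set.mem_ofPred_eq, Q, not_exists, not_and, memI] at hq hq'
    have h1 : ¬ p.1 < p'.1 := fun h => hq.2 p' hq'.1.1.1 h hq'.1.2
    have h2 : ¬ p'.1 < p.1 := fun h => hq'.2 p hq.1.1.1 h hq.1.2
    rw [hx hq.1.1.1 hq'.1.1.1 (le_antisymm (not_lt.1 h2) (not_lt.1 h1))]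
  have hnext : #(I.filter Q) ≤ #(consecutiveEdges P L) := by
    have hN : ∀ q, ∃ z, q ∈ I.filter Q →
        lineThrough (q.1, z) = q.2 ∧ (q.1, z) ∈ consecutiveEdges P L := by
      intro q
      by_cases hq : q ∈ I.filter Q
      · obtain ⟨hqI, z₀, hz₀, hlt, hz₀l⟩ := mem_filter.1 hq
        rw [memI] at hqI
        obtain ⟨z, hz, hmin⟩ := exists_min_image
          (P.filter fun z => q.1.1 < z.1 ∧ z.2 = height q.2 z.1) Prod.fst
          ⟨z₀, by simp only [mem_filter]; exact ⟨hz₀, hlt, hz₀l⟩⟩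
        simp only [mem_filter] at hz hmin
        have hl := lineThrough_eq hz.2.1 hqI.2 hz.2.2
        refine ⟨z, fun _ => ⟨hl, mem_consecutiveEdges.2 ⟨⟨hqI.1.1, hz.1⟩, hz.2.1, ?_, ?_⟩⟩⟩
        · rw [hl]
          exact hqI.1.2
        · intro w hw hov hwl
          rw [hl] at hwl
          exact absurd hov.2 (not_lt.2 (hmin w ⟨hw, hov.1, hwl⟩))
      · exact ⟨0, fun h => absurd h hq⟩
    choose z hz using hN
    refine card_le_card_of_injOn (fun q => (q.1, z q)) (fun q hq => (hz q hq).2) ?_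
    intro q hq q' hq' h
    have h1 := (hz q hq).1
    have h2 := (hz q' hq').1
    simp only at h
    rw [h] at h1
    exact Prod.ext (Prod.mk.inj h).1 (h1.symm.trans h2)
  have := card_filter_add_card_filter_not (s := I) Q
  omega

lemma card_consecutiveEdges_le (hx : Set.InjOn Prod.fst (P : Set (ℝ × ℝ))) :
    (#(consecutiveEdges P L) : ℝ) ≤ 6 * #P ∨
      (#(consecutiveEdges P L) : ℝ) ^ 3 ≤ 72 * (#P : ℝ) ^ 2 * (#L : ℝ) ^ 2 := by
  rw [or_iff_not_imp_left, not_le]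
  intro h
  have hmem := fun e (he : e ∈ consecutiveEdges P L) => mem_consecutiveEdges.1 he
  have hE : (0 : ℝ) < #(consecutiveEdges P L) := lt_of_le_of_lt (by positivity) h
  obtain ⟨e, he⟩ := card_pos.1 (Nat.cast_pos.1 hE)
  have hP : (0 : ℝ) < #P := Nat.cast_pos.2 (card_pos.2 ⟨_, (hmem e he).1.1⟩)
  have hX : (#(crossings (consecutiveEdges P L)) : ℝ) ≤ (#L : ℝ) ^ 2 := by
    exact_mod_cast card_crossings_le hx
  have hcr := crossing_inequality hx (consecutiveEdges P L) (fun e he => (hmem e he).2.1)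
    (fun e he => (hmem e he).1.1) (fun e he => (hmem e he).1.2)
    (fun e he f hf => endpoints_ne_of_crosses hx he hf)
    (p := 6 * #P / #(consecutiveEdges P L)) (by positivity) ((div_le_one hE).2 h.le)
  set E : ℝ := (#(consecutiveEdges P L) : ℝ)
  set V : ℝ := (#P : ℝ)
  have h1 : (6 * V / E) ^ 2 * E ≤ 3 * (6 * V / E * V) + (6 * V / E) ^ 4 * (#L : ℝ) ^ 2 :=
    hcr.trans (by gcongr)
  have h2 : 0 ≤ (72 * V ^ 2 * (#L : ℝ) ^ 2 - E ^ 3) * (18 * V ^ 2 / E ^ 4) := by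
    have h3 : (72 * V ^ 2 * (#L : ℝ) ^ 2 - E ^ 3) * (18 * V ^ 2 / E ^ 4) =
        3 * (6 * V / E * V) + (6 * V / E) ^ 4 * (#L : ℝ) ^ 2 - (6 * V / E) ^ 2 * E := by
      field_simp
      ring
    rw [h3]
    linarith
  have h4 := nonneg_of_mul_nonneg_left h2 (by positivity)
  linarith

open Classical in
/-- The Szemerédi–Trotter bound for non-vertical lines and points with distinct abscissas. -/
lemma card_incidences_bound (hx : Set.InjOn Prod.fst (P : Set (ℝ × ℝ))) {N : ℝ}
    (hN : N ≤ #((P ×ˢ L).filter fun q => q.1.2 = height q.2 q.1.1)) (hN₀ : 0 ≤ N) :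
    N ≤ 2 * #L ∨ N ≤ 12 * #P ∨ N ^ 3 ≤ 576 * (#P : ℝ) ^ 2 * (#L : ℝ) ^ 2 := by
  have h1 : N ≤ #L + #(consecutiveEdges P L) :=
    hN.trans (by exact_mod_cast card_incidences_le hx)
  rcases le_or_gt N (2 * #L) with h | h
  · exact Or.inl h
  have h2 : N / 2 ≤ #(consecutiveEdges P L) := by linarith
  rcases card_consecutiveEdges_le (L := L) hx with h3 | h3
  · exact Or.inr (Or.inl (by linarith))
  · have h4 := pow_le_pow_left₀ (by positivity) h2 3
    exact Or.inr (Or.inr (by linarith [show (N / 2) ^ 3 = N ^ 3 / 8 by ring]))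

end

/-- The Szemerédi–Trotter theorem. -/
theorem ncard_incidences_bound {P : Set (ℝ × ℝ)} {L : Set (Set (ℝ × ℝ))} (hP : P.Finite)
    (hL : L.Finite) (hline : ∀ l ∈ L, IsLine l) :
    ((Incidences P L).ncard : ℝ) ≤ 2 * L.ncard ∨ ((Incidences P L).ncard : ℝ) ≤ 12 * P.ncard ∨
      ((Incidences P L).ncard : ℝ) ^ 3 ≤ 576 * (P.ncard : ℝ) ^ 2 * (L.ncard : ℝ) ^ 2 := by
  classical
  have hline' : ∀ l, ∃ a b c : ℝ, l ∈ L →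
      (a, b) ≠ (0, 0) ∧ l = {p : ℝ × ℝ | a * p.1 + b * p.2 = c} := by
    intro l
    by_cases hl : l ∈ L
    · obtain ⟨a, b, c, h⟩ := hline l hl
      exact ⟨a, b, c, fun _ => h⟩
    · exact ⟨0, 0, 0, fun h => absurd h hl⟩
  choose a b c habc using hline'
  lift P to Finset (ℝ × ℝ) using hP
  lift L to Finset (Set (ℝ × ℝ)) using hL
  obtain ⟨t, ht⟩ := Infinite.exists_notMem_finset
    ((P ×ˢ P).image (fun q => (q.2.1 - q.1.1) / (q.1.2 - q.2.2)) ∪ L.image fun l => b l / a l)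
  simp only [mem_union, mem_image, not_or, not_exists, not_and, mem_product] at ht
  let φ : ℝ × ℝ → ℝ × ℝ := fun p => (p.1 + t * p.2, p.2)
  let ψ : Set (ℝ × ℝ) → ℝ × ℝ := fun l => (-a l / (b l - a l * t), c l / (b l - a l * t))
  have hφ : Function.Injective φ := by
    rintro ⟨x, y⟩ ⟨x', y'⟩ h
    simp only [φ, Prod.mk.injEq] at h
    obtain ⟨h1, rfl⟩ := h
    simpa using h1
  have hden : ∀ l ∈ L, b l - a l * t ≠ 0 := by
    intro l hl h
    by_cases ha : a l = 0
    · exact (habc l hl).1 (by rw [ha] at h ⊢; simpa using h)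
    · refine ht.2 l hl ?_
      field_simp
      linarith
  have hinc : ∀ l ∈ L, ∀ p, p ∈ l ↔ (φ p).2 = height (ψ l) (φ p).1 := by
    intro l hl p
    have hd := hden l hl
    nth_rewrite 1 [(habc l hl).2]
    simp only [φ, ψ, height, Set.mem_ofPred_eq]
    constructor
    · intro h
      rw [← h]
      field_simp
      ring
    · intro h
      field_simp at h
      linarith
  have hψ : Set.InjOn ψ (L : Set (Set (ℝ × ℝ))) := by
    intro l hl l' hl' h
    ext p
    rw [hinc l hl, hinc l' hl', h]
  have hx : Set.InjOn Prod.fst ((P.image φ : Finset (ℝ × ℝ)) : Set (ℝ × ℝ)) := by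
    intro u hu v hv huv
    rw [mem_coe, mem_image] at hu hv
    obtain ⟨p, hp, rfl⟩ := hu
    obtain ⟨q, hq, rfl⟩ := hv
    simp only [φ] at huv ⊢
    by_cases h : p.2 = q.2
    · rw [huv, h]
    · have hne : p.2 - q.2 ≠ 0 := sub_ne_zero.2 h
      refine absurd ?_ (ht.1 (p, q) ⟨hp, hq⟩)
      rw [div_eq_iff hne]
      linarith
  have hfin : (Incidences (P : Set (ℝ × ℝ)) (L : Set (Set (ℝ × ℝ)))).ncard ≤
      #((P.image φ ×ˢ L.image ψ).filter fun q => q.1.2 = height q.2 q.1.1) := by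
    rw [← Set.ncard_coe_finset]
    refine Set.ncard_le_ncard_of_injOn (Prod.map φ ψ) ?_ ?_ (finite_toSet _)
    · rintro ⟨p, l⟩ ⟨hp, hl, hpl⟩
      simp only [coe_filter, Set.mem_ofPred_eq, mem_product, Prod.map]
      exact ⟨⟨mem_image_of_mem φ hp, mem_image_of_mem ψ hl⟩, (hinc l hl p).1 hpl⟩
    · rintro ⟨p, l⟩ ⟨hp, hl, hpl⟩ ⟨p', l'⟩ ⟨hp', hl', hpl'⟩ h
      obtain ⟨h1, h2⟩ := Prod.mk.inj h
      exact Prod.ext (hφ h1) (hψ hl hl' h2)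
  have := card_incidences_bound hx (by exact_mod_cast hfin) (Nat.cast_nonneg _)
  rw [card_image_of_injective P hφ, card_image_of_injOn hψ] at this
  rwa [Set.ncard_coe_finset P, Set.ncard_coe_finset L]

end SzemerediTrotter

/-- Cleaning step (lower bound on the number of lines): for constants `α, β`
with `2α + β = 1`, `α ≤ 2/3` and `A, B > 0`, there are `c > 0` and `C₁ ≥ 1`
such that whenever `m ≤ n²/C₁`, `n ≤ m²/C₁`, `|P| ≤ A m^α n^β` and
`|I(P,L)| ≥ B m^{α+2/3} n^{β-1/3}`, we get `|L| ≥ c m^{α/2+1} n^{β/2-1/2}`. -/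
theorem cleaning_lines (α β A B : ℝ) (hαβ : 2 * α + β = 1) (hα : α ≤ 2 / 3)
    (hA : 0 < A) (hB : 0 < B) :
    ∃ c C₁ : ℝ, 0 < c ∧ 1 ≤ C₁ ∧
      ∀ m n : ℕ, 0 < m → 0 < n →
        (m : ℝ) ≤ (n : ℝ) ^ 2 / C₁ → (n : ℝ) ≤ (m : ℝ) ^ 2 / C₁ →
        ∀ (P : Set (ℝ × ℝ)) (L : Set (Set (ℝ × ℝ))),
          P.Finite → L.Finite → (∀ l ∈ L, IsLine l) →
          (P.ncard : ℝ) ≤ A * (m : ℝ) ^ α * (n : ℝ) ^ β →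
          B * (m : ℝ) ^ (α + 2 / 3) * (n : ℝ) ^ (β - 1 / 3) ≤
            ((Incidences P L).ncard : ℝ) →
          c * (m : ℝ) ^ (α / 2 + 1) * (n : ℝ) ^ (β / 2 - 1 / 2) ≤
            (L.ncard : ℝ) := by
  refine ⟨min (B / 2) (√(B ^ 3 / (576 * A ^ 2))), 1728 * A ^ 3 / B ^ 3 + 1, by positivity,
    le_add_of_nonneg_left (by positivity), ?_⟩
  intro m n hm₀ hn₀ hmn hnm P L hP hL hline hPcard hI
  set C₁ := 1728 * A ^ 3 / B ^ 3 + 1 with hC₁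
  set c := min (B / 2) (√(B ^ 3 / (576 * A ^ 2))) with hc
  have hC₁_one : 1 ≤ C₁ := le_add_of_nonneg_left (by positivity)
  have hc₀ : 0 < c := by positivity
  have hm : (0 : ℝ) < m := Nat.cast_pos.2 hm₀
  have hn : (0 : ℝ) < n := Nat.cast_pos.2 hn₀
  have hIP := SzemerediTrotter.ncard_incidences_bound hP hL hline
  set N : ℝ := ((Incidences P L).ncard : ℝ)
  set l : ℝ := (L.ncard : ℝ)
  generalize hx : (m : ℝ) = x at *
  generalize hy : (n : ℝ) = y at *
  have hmain : x ^ (α / 2 + 1) * y ^ (β / 2 - 1 / 2) ≤ x ^ (α + 2 / 3) * y ^ (β - 1 / 3) := by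
    have hδ : 0 ≤ 1 / 3 - α / 2 := by linarith
    have h1 : x ≤ y ^ 2 := hmn.trans (div_le_self (by positivity) hC₁_one)
    have h2 : x ^ (1 / 3 - α / 2) ≤ y ^ (2 * (1 / 3 - α / 2)) := by
      rw [Real.rpow_mul hn.le, Real.rpow_two]
      exact Real.rpow_le_rpow hm.le h1 hδ
    have h3 : x ^ (α / 2 + 1) = x ^ (α + 2 / 3) * x ^ (1 / 3 - α / 2) := by
      rw [← Real.rpow_add hm]
      ring_nf
    have h4 : y ^ (β - 1 / 3) = y ^ (2 * (1 / 3 - α / 2)) * y ^ (β / 2 - 1 / 2) := by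
      rw [← Real.rpow_add hn]
      congr 1
      linarith
    rw [h3, h4, mul_assoc]
    gcongr
  rcases hIP with h | h | h
  · calc c * x ^ (α / 2 + 1) * y ^ (β / 2 - 1 / 2)
        = c * (x ^ (α / 2 + 1) * y ^ (β / 2 - 1 / 2)) := by ring
      _ ≤ B / 2 * (x ^ (α + 2 / 3) * y ^ (β - 1 / 3)) := by
        gcongr
        exact min_le_left _ _
      _ ≤ l := by linarith
  · exfalso
    have h1 : x ^ (α + 2 / 3) = x ^ α * x ^ (2 / 3 : ℝ) := Real.rpow_add hm _ _
    have h2 : y ^ (β - 1 / 3) * y ^ (1 / 3 : ℝ) = y ^ β := by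
      rw [← Real.rpow_add hn, sub_add_cancel]
    have h3 : (x ^ α * y ^ (β - 1 / 3)) * (B * x ^ (2 / 3 : ℝ)) ≤
        (x ^ α * y ^ (β - 1 / 3)) * (12 * A * y ^ (1 / 3 : ℝ)) := by
      calc _ = B * x ^ (α + 2 / 3) * y ^ (β - 1 / 3) := by rw [h1]; ring
        _ ≤ 12 * (A * x ^ α * y ^ β) := by linarith
        _ = _ := by rw [← h2]; ring
    have h4 := le_of_mul_le_mul_left h3 (by positivity)
    have h5 := pow_le_pow_left₀ (by positivity) h4 3
    have h6 : (x ^ (2 / 3 : ℝ)) ^ 3 = x ^ 2 := by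
      rw [← Real.rpow_mul_natCast hm.le, ← Real.rpow_two]
      norm_num
    have h7 : (y ^ (1 / 3 : ℝ)) ^ 3 = y := by
      rw [← Real.rpow_mul_natCast hn.le]
      norm_num
    rw [mul_pow, mul_pow, mul_pow, h6, h7] at h5
    rw [le_div_iff₀ (by linarith)] at hnm
    have h8 : y * (C₁ * B ^ 3) ≤ y * (1728 * A ^ 3) := by nlinarith [pow_pos hB 3]
    have h9 := le_of_mul_le_mul_left h8 hn
    have h10 : C₁ * B ^ 3 = 1728 * A ^ 3 + B ^ 3 := by
      rw [hC₁]
      field_simp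
    linarith [pow_pos hB 3]
  · have hx3 : (x ^ (α + 2 / 3)) ^ 3 = (x ^ α) ^ 2 * (x ^ (α / 2 + 1)) ^ 2 := by
      simp only [← Real.rpow_mul_natCast hm.le]
      rw [← Real.rpow_add hm]
      congr 1
      push_cast
      ring
    have hy3 : (y ^ (β - 1 / 3)) ^ 3 = (y ^ β) ^ 2 * (y ^ (β / 2 - 1 / 2)) ^ 2 := by
      simp only [← Real.rpow_mul_natCast hn.le]
      rw [← Real.rpow_add hn]
      congr 1
      push_cast
      ring
    have h1 : (B * x ^ (α + 2 / 3) * y ^ (β - 1 / 3)) ^ 3 ≤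
        576 * (A * x ^ α * y ^ β) ^ 2 * l ^ 2 :=
      (pow_le_pow_left₀ (by positivity) hI 3).trans (h.trans (by gcongr))
    rw [mul_pow, mul_pow, hx3, hy3] at h1
    have h2 : ((x ^ α) ^ 2 * (y ^ β) ^ 2) *
          (B ^ 3 * (x ^ (α / 2 + 1) * y ^ (β / 2 - 1 / 2)) ^ 2) ≤
        ((x ^ α) ^ 2 * (y ^ β) ^ 2) * (576 * A ^ 2 * l ^ 2) := by
      calc _ = _ := by ring
        _ ≤ _ := h1
        _ = _ := by ring
    have h3 := le_of_mul_le_mul_left h2 (by positivity)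
    have h4 : c ^ 2 ≤ B ^ 3 / (576 * A ^ 2) := by
      rw [← Real.sq_sqrt (show 0 ≤ B ^ 3 / (576 * A ^ 2) by positivity)]
      exact pow_le_pow_left₀ hc₀.le (min_le_right _ _) 2
    refine pow_le_pow_iff_left₀ (by positivity) (Nat.cast_nonneg _) two_ne_zero |>.1 ?_
    calc (c * x ^ (α / 2 + 1) * y ^ (β / 2 - 1 / 2)) ^ 2
        = c ^ 2 * (x ^ (α / 2 + 1) * y ^ (β / 2 - 1 / 2)) ^ 2 := by ring
      _ ≤ B ^ 3 / (576 * A ^ 2) * (x ^ (α / 2 + 1) * y ^ (β / 2 - 1 / 2)) ^ 2 := by gcongr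
      _ = B ^ 3 * (x ^ (α / 2 + 1) * y ^ (β / 2 - 1 / 2)) ^ 2 / (576 * A ^ 2) := by ring
      _ ≤ l ^ 2 := by
        rw [div_le_iff₀ (by positivity)]
        linarith
end

section
/- Let α, β be real constants with α + 2β = 1 and β ≤ 2/3, and let A, B > 0. Then there exist constants c > 0 and C₁ ≥ 1, depending only on β, A and B, with the following property. Let m, n be positive integers with m ≤ n²/C₁ and n ≤ m²/C₁, let P be a finite set of points and L a finite set of lines in ℝ² with |L| ≤ A·m^α n^β and |I(P,L)| ≥ B·m^{α−1/3} n^{β+2/3}. Then |P| ≥ c·m^{α/2−1/2} n^{β/2+1}. -/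
/-- The slope of the segment from `e.1` to `e.2`. -/
noncomputable def segSlope (e : (ℝ × ℝ) × (ℝ × ℝ)) : ℝ :=
  (e.2.2 - e.1.2) / (e.2.1 - e.1.1)

/-- The height at abscissa `t` of the line through `e.1` and `e.2`. -/
noncomputable def segHeight (e : (ℝ × ℝ) × (ℝ × ℝ)) (t : ℝ) : ℝ :=
  e.1.2 + segSlope e * (t - e.1.1)

lemma segHeight_fst (e : (ℝ × ℝ) × (ℝ × ℝ)) : segHeight e e.1.1 = e.1.2 := by
  simp [segHeight]

lemma segHeight_snd {e : (ℝ × ℝ) × (ℝ × ℝ)} (h : e.1.1 < e.2.1) :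
    segHeight e e.2.1 = e.2.2 := by
  have : e.2.1 - e.1.1 ≠ 0 := (sub_pos.2 h).ne'
  simp only [segHeight, segSlope]
  field_simp
  ring

lemma segHeight_eq_snd {e : (ℝ × ℝ) × (ℝ × ℝ)} (h : e.1.1 < e.2.1) (t : ℝ) :
    segHeight e t = e.2.2 + segSlope e * (t - e.2.1) := by
  rw [← segHeight_snd h]
  simp only [segHeight]
  ring

/-- Two segments cross if their relative interiors share a point. -/
def SegCross (e f : (ℝ × ℝ) × (ℝ × ℝ)) : Prop :=
  ∃ t, e.1.1 < t ∧ t < e.2.1 ∧ f.1.1 < t ∧ t < f.2.1 ∧ segHeight e t = segHeight f t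

lemma segCross_of_lt_of_lt {e f : (ℝ × ℝ) × (ℝ × ℝ)} {a b : ℝ} (hab : a < b)
    (hea : e.1.1 ≤ a) (hfa : f.1.1 ≤ a) (heb : b ≤ e.2.1) (hfb : b ≤ f.2.1)
    (ha : segHeight f a < segHeight e a) (hb : segHeight e b < segHeight f b) :
    SegCross e f := by
  have hs : 0 < segSlope f - segSlope e := by
    simp only [segHeight] at ha hb
    by_contra! h
    nlinarith
  set d := (segHeight e a - segHeight f a) / (segSlope f - segSlope e) with hd
  have hd0 : 0 < d := div_pos (sub_pos.2 ha) hs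
  have hdm : d * (segSlope f - segSlope e) = segHeight e a - segHeight f a :=
    div_mul_cancel₀ _ hs.ne'
  have hd1 : a + d < b := by
    simp only [segHeight] at hdm hb
    by_contra! h
    nlinarith
  refine ⟨a + d, by linarith, by linarith, by linarith, by linarith, ?_⟩
  simp only [segHeight] at hdm ⊢
  linarith

lemma false_of_fst_eq_of_segSlope_eq {e f : (ℝ × ℝ) × (ℝ × ℝ)} (he : e.1.1 < e.2.1)
    (hf : f.1.1 < f.2.1) (hef : ¬ SegCross e f) (h : e.1 = f.1)
    (hs : segSlope e = segSlope f) : False := by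
  obtain ⟨t, h1, h2⟩ := exists_between (lt_min he (h ▸ hf : e.1.1 < f.2.1))
  refine hef ⟨t, h1, h2.trans_le (min_le_left _ _), h ▸ h1, h2.trans_le (min_le_right _ _), ?_⟩
  simp [segHeight, h, hs]

lemma false_of_snd_eq_of_segSlope_eq {e f : (ℝ × ℝ) × (ℝ × ℝ)} (he : e.1.1 < e.2.1)
    (hf : f.1.1 < f.2.1) (hef : ¬ SegCross e f) (h : e.2 = f.2)
    (hs : segSlope e = segSlope f) : False := by
  obtain ⟨t, h1, h2⟩ := exists_between (max_lt he (h ▸ hf : f.1.1 < e.2.1))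
  refine hef ⟨t, (le_max_left _ _).trans_lt h1, h2, (le_max_right _ _).trans_lt h1, h ▸ h2, ?_⟩
  rw [segHeight_eq_snd he, segHeight_eq_snd hf, h, hs]

/-- `e'` is the segment following `e` in the order of slopes around their common left end. -/
def IsNextSeg (E : Finset ((ℝ × ℝ) × (ℝ × ℝ))) (e e' : (ℝ × ℝ) × (ℝ × ℝ)) : Prop :=
  e' ∈ E ∧ e'.1 = e.1 ∧ segSlope e < segSlope e' ∧
    ∀ f ∈ E, f.1 = e.1 → segSlope e < segSlope f → segSlope e' ≤ segSlope f

lemma exists_isNextSeg {E : Finset ((ℝ × ℝ) × (ℝ × ℝ))} {e : (ℝ × ℝ) × (ℝ × ℝ)}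
    (h : ¬ ∀ f ∈ E, f.1 = e.1 → segSlope f ≤ segSlope e) : ∃ e', IsNextSeg E e e' := by
  classical
  push Not at h
  obtain ⟨f, hf, hf1, hf2⟩ := h
  obtain ⟨e', he', hmin⟩ := Finset.exists_min_image
    (E.filter fun f => f.1 = e.1 ∧ segSlope e < segSlope f) segSlope
    ⟨f, by simp only [Finset.mem_filter]; exact ⟨hf, hf1, hf2⟩⟩
  simp only [Finset.mem_filter] at he' hmin
  exact ⟨e', he'.1, he'.2.1, he'.2.2, fun g hg h1 h2 => hmin g ⟨hg, h1, h2⟩⟩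

/-- The vertex `w` is the first one in the wedge bounded by `e` and `e'`, and it lies strictly
inside. -/
def IsWedgeVertex (V : Finset (ℝ × ℝ)) (e e' : (ℝ × ℝ) × (ℝ × ℝ)) (w : ℝ × ℝ) : Prop :=
  w ∈ V ∧ e.1.1 < w.1 ∧ w.1 ≤ e.2.1 ∧ w.1 ≤ e'.2.1 ∧
    segHeight e w.1 < w.2 ∧ w.2 < segHeight e' w.1 ∧
    ∀ v ∈ V, e.1.1 < v.1 → v.1 < w.1 → v.2 < segHeight e v.1 ∨ segHeight e' v.1 < v.2

/-- A plane straight-line drawing: distinct edges do not cross, and no vertex lies inside an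
edge. -/
structure IsPlaneDrawing (V : Finset (ℝ × ℝ)) (E : Finset ((ℝ × ℝ) × (ℝ × ℝ))) : Prop where
  injOn : Set.InjOn Prod.fst (V : Set (ℝ × ℝ))
  fst_mem : ∀ e ∈ E, e.1 ∈ V
  snd_mem : ∀ e ∈ E, e.2 ∈ V
  lt : ∀ e ∈ E, e.1.1 < e.2.1
  not_cross : ∀ e ∈ E, ∀ f ∈ E, e ≠ f → ¬ SegCross e f
  notMem : ∀ e ∈ E, ∀ v ∈ V, e.1.1 < v.1 → v.1 < e.2.1 → v.2 ≠ segHeight e v.1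

namespace IsPlaneDrawing

variable {V : Finset (ℝ × ℝ)} {E : Finset ((ℝ × ℝ) × (ℝ × ℝ))}
  {e f e' f' : (ℝ × ℝ) × (ℝ × ℝ)} {w : ℝ × ℝ}

lemma eq_of_fst (h : IsPlaneDrawing V E) (he : e ∈ E) (hf : f ∈ E) (h1 : e.1 = f.1)
    (hs : segSlope e = segSlope f) : e = f := by
  by_contra hne
  exact false_of_fst_eq_of_segSlope_eq (h.lt e he) (h.lt f hf) (h.not_cross e he f hf hne) h1 hs

lemma eq_of_snd (h : IsPlaneDrawing V E) (he : e ∈ E) (hf : f ∈ E) (h1 : e.2 = f.2)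
    (hs : segSlope e = segSlope f) : e = f := by
  by_contra hne
  exact false_of_snd_eq_of_segSlope_eq (h.lt e he) (h.lt f hf) (h.not_cross e he f hf hne) h1 hs

lemma isNextSeg_injective (h : IsPlaneDrawing V E) (he : e ∈ E) (hf : f ∈ E)
    (h1 : IsNextSeg E e e') (h2 : IsNextSeg E f e') : e = f := by
  have h3 : e.1 = f.1 := h1.2.1.symm.trans h2.2.1
  refine h.eq_of_fst he hf h3 (le_antisymm ?_ ?_) <;> by_contra! hlt
  · exact (h2.2.2.2 e he h3 hlt).not_gt h1.2.2.1
  · exact (h1.2.2.2 f hf h3.symm hlt).not_gt h2.2.2.1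

lemma height_lt_of_isNextSeg (hn : IsNextSeg E e e') {t : ℝ} (ht : e.1.1 < t) :
    segHeight e t < segHeight e' t := by
  simp only [segHeight, hn.2.1]
  have := hn.2.2.1
  have := mul_lt_mul_of_pos_right this (sub_pos.2 ht)
  linarith

/-- If neither side of the wedge is extremal on the inner side at its right end, then the first
vertex in the wedge lies strictly inside. -/
lemma exists_isWedgeVertex (h : IsPlaneDrawing V E) (he : e ∈ E) (hn : IsNextSeg E e e')
    (hlow : ¬ ∀ f ∈ E, f.2 = e.2 → segSlope e ≤ segSlope f)
    (hup : ¬ ∀ f ∈ E, f.2 = e'.2 → segSlope f ≤ segSlope e') :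
    ∃ w, IsWedgeVertex V e e' w := by
  classical
  have he' := hn.1
  have h1 := hn.2.1
  have hlt := h.lt e he
  have hlt' := h.lt e' he'
  have hlt'' : e.1.1 < e'.2.1 := h1 ▸ hlt'
  set W := V.filter fun w => e.1.1 < w.1 ∧ segHeight e w.1 ≤ w.2 ∧ w.2 ≤ segHeight e' w.1
    with hW
  have hmem : e.2 ∈ W := by
    simp only [hW, Finset.mem_filter]
    have := height_lt_of_isNextSeg hn hlt
    rw [segHeight_snd hlt] at this
    exact ⟨h.snd_mem e he, hlt, (segHeight_snd hlt).le, this.le⟩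
  have hmem' : e'.2 ∈ W := by
    simp only [hW, Finset.mem_filter]
    have := height_lt_of_isNextSeg hn hlt''
    rw [segHeight_snd hlt'] at this
    exact ⟨h.snd_mem e' he', hlt'', this.le, (segHeight_snd hlt').ge⟩
  obtain ⟨w, hw, hmin⟩ := Finset.exists_min_image W Prod.fst ⟨_, hmem⟩
  have hwe := hmin _ hmem
  have hwe' := hmin _ hmem'
  have hout : ∀ v ∈ V, e.1.1 < v.1 → v.1 < w.1 →
      v.2 < segHeight e v.1 ∨ segHeight e' v.1 < v.2 := by
    intro v hv hv1 hv2
    by_contra! hc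
    exact (hmin v (by simp only [hW, Finset.mem_filter]; exact ⟨hv, hv1, hc.1, hc.2⟩)).not_gt hv2
  simp only [hW, Finset.mem_filter] at hw
  obtain ⟨hwV, hw1, hw2, hw3⟩ := hw
  refine ⟨w, hwV, hw1, hwe, hwe', lt_of_le_of_ne hw2 fun heq => ?_,
    lt_of_le_of_ne hw3 fun heq => ?_, hout⟩
  · have hwe2 : w = e.2 := by
      refine h.injOn hwV (h.snd_mem e he) (le_antisymm hwe ?_)
      by_contra! hlt2
      exact h.notMem e he w hwV hw1 hlt2 heq.symm
    subst hwe2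
    push Not at hlow
    obtain ⟨g, hg, hg2, hgs⟩ := hlow
    have hglt := h.lt g hg
    have hgx : g.1.1 < e.2.1 := hg2 ▸ hglt
    have habove : ∀ t, t < e.2.1 → segHeight e t < segHeight g t := by
      intro t ht
      rw [segHeight_eq_snd hlt, segHeight_eq_snd hglt, hg2]
      nlinarith
    have hb : segHeight g e.2.1 < segHeight e' e.2.1 := by
      have := height_lt_of_isNextSeg hn hlt
      rwa [segHeight_snd hlt, ← hg2, ← segHeight_snd hglt, hg2] at this
    have hge' : g ≠ e' := fun hh => by subst hh; exact (lt_asymm hgs hn.2.2.1)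
    refine h.not_cross g hg e' he' hge' ?_
    rcases lt_trichotomy g.1.1 e.1.1 with hlt3 | heq3 | hlt3
    · refine segCross_of_lt_of_lt hlt hlt3.le (by rw [h1]) (by rw [hg2]) hwe' ?_ hb
      have := habove _ hlt
      rwa [segHeight_fst, ← h1, ← segHeight_fst e', h1] at this
    · have := h.injOn (h.fst_mem g hg) (h.fst_mem e he) heq3
      have : g = e := Prod.ext this hg2
      exact absurd hgs (by rw [this]; exact lt_irrefl _)
    · refine segCross_of_lt_of_lt hgx le_rfl (by rw [h1]; exact hlt3.le) (by rw [hg2]) hwe' ?_ hb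
      have h4 := habove _ hgx
      rw [segHeight_fst] at h4 ⊢
      exact (hout _ (h.fst_mem g hg) hlt3 hgx).resolve_left h4.not_gt
  · have hwe2 : w = e'.2 := by
      refine h.injOn hwV (h.snd_mem e' he') (le_antisymm hwe' ?_)
      by_contra! hlt2
      exact h.notMem e' he' w hwV (by rw [h1]; exact hw1) hlt2 heq
    subst hwe2
    push Not at hup
    obtain ⟨g, hg, hg2, hgs⟩ := hup
    have hglt := h.lt g hg
    have hgx : g.1.1 < e'.2.1 := hg2 ▸ hglt
    have hbelow : ∀ t, t < e'.2.1 → segHeight g t < segHeight e' t := by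
      intro t ht
      rw [segHeight_eq_snd hlt', segHeight_eq_snd hglt, hg2]
      nlinarith
    have hb : segHeight e e'.2.1 < segHeight g e'.2.1 := by
      have := height_lt_of_isNextSeg hn hlt''
      rwa [segHeight_snd hlt', ← hg2, ← segHeight_snd hglt, hg2] at this
    have hge : e ≠ g := fun hh => by subst hh; exact (lt_asymm hgs hn.2.2.1)
    refine h.not_cross e he g hg hge ?_
    rcases lt_trichotomy g.1.1 e.1.1 with hlt3 | heq3 | hlt3
    · refine segCross_of_lt_of_lt hlt'' le_rfl hlt3.le hwe (by rw [hg2]) ?_ hb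
      have := hbelow _ hlt''
      rwa [← h1, segHeight_fst, h1, ← segHeight_fst e] at this
    · have := h.injOn (h.fst_mem g hg) (h.fst_mem e he) heq3
      have : g = e' := Prod.ext (this.trans h1.symm) hg2
      exact absurd hgs (by rw [this]; exact lt_irrefl _)
    · refine segCross_of_lt_of_lt hgx hlt3.le le_rfl hwe (by rw [hg2]) ?_ hb
      have h4 := hbelow _ hgx
      rw [segHeight_fst] at h4 ⊢
      exact (hout _ (h.fst_mem g hg) hlt3 hgx).resolve_right h4.not_gt

lemma not_isWedgeVertex_of_lt (h : IsPlaneDrawing V E) (he : e ∈ E) (hf : f ∈ E)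
    (hn : IsNextSeg E e e') (hn' : IsNextSeg E f f') (hw : IsWedgeVertex V e e' w)
    (hw' : IsWedgeVertex V f f' w) : ¬ e.1.1 < f.1.1 := by
  intro hlt
  obtain ⟨-, hw1, hw2, hw3, hw4, hw5, hout⟩ := hw
  obtain ⟨-, hw1', hw2', hw3', hw4', hw5', -⟩ := hw'
  rcases hout _ (h.fst_mem f hf) hlt hw1' with hc | hc
  · have hne : e ≠ f' := fun hh => by
      rw [hh, hn'.2.1] at hlt
      exact lt_irrefl _ hlt
    refine h.not_cross e he f' hn'.1 hne
      (segCross_of_lt_of_lt hw1' hlt.le (by rw [hn'.2.1]) hw2 hw3' ?_ (hw4.trans hw5'))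
    rw [← hn'.2.1] at hc ⊢
    rwa [segHeight_fst]
  · have hne : f ≠ e' := fun hh => by
      rw [hh, hn.2.1] at hlt
      exact lt_irrefl _ hlt
    refine h.not_cross f hf e' hn.1 hne
      (segCross_of_lt_of_lt hw1' le_rfl (by rw [hn.2.1]; exact hlt.le) hw2' hw3 ?_
        (hw4'.trans hw5))
    rwa [segHeight_fst]

lemma not_isWedgeVertex_of_slope_lt (hf : f ∈ E) (hfe : f.1 = e.1)
    (hn : IsNextSeg E e e') (hw : IsWedgeVertex V e e' w)
    (hw' : IsWedgeVertex V f f' w) : ¬ segSlope e < segSlope f := by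
  intro hlt
  have h1 := hn.2.2.2 f hf hfe hlt
  have h2 : segHeight f w.1 < segHeight e' w.1 := hw'.2.2.2.2.1.trans hw.2.2.2.2.2.1
  have h3 := hw.2.1
  simp only [segHeight, hfe, hn.2.1] at h2
  nlinarith

lemma isWedgeVertex_injective (h : IsPlaneDrawing V E) (he : e ∈ E) (hf : f ∈ E)
    (hn : IsNextSeg E e e') (hn' : IsNextSeg E f f') (hw : IsWedgeVertex V e e' w)
    (hw' : IsWedgeVertex V f f' w) : e = f := by
  have h1 : e.1 = f.1 := h.injOn (h.fst_mem e he) (h.fst_mem f hf) <| le_antisymm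
    (not_lt.1 (h.not_isWedgeVertex_of_lt hf he hn' hn hw' hw))
    (not_lt.1 (h.not_isWedgeVertex_of_lt he hf hn hn' hw hw'))
  exact h.eq_of_fst he hf h1 <| le_antisymm
    (not_lt.1 (not_isWedgeVertex_of_slope_lt he h1 hn' hw' hw))
    (not_lt.1 (not_isWedgeVertex_of_slope_lt hf h1.symm hn hw hw'))

/-- A plane straight-line drawing has linearly many edges. -/
theorem card_edges_le (h : IsPlaneDrawing V E) : E.card ≤ 4 * V.card := by
  classical
  set next : (ℝ × ℝ) × (ℝ × ℝ) → (ℝ × ℝ) × (ℝ × ℝ) :=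
    fun e => if hh : ∃ e', IsNextSeg E e e' then hh.choose else e with hnext
  have next_spec : ∀ e, (¬ ∀ f ∈ E, f.1 = e.1 → segSlope f ≤ segSlope e) →
      IsNextSeg E e (next e) := by
    intro e he
    have := exists_isNextSeg he
    simp only [hnext, dif_pos this]
    exact this.choose_spec
  set apex : (ℝ × ℝ) × (ℝ × ℝ) → ℝ × ℝ :=
    fun e => if hh : ∃ w, IsWedgeVertex V e (next e) w then hh.choose else 0 with hapex
  set top : (ℝ × ℝ) × (ℝ × ℝ) → Prop :=
    fun e => ∀ f ∈ E, f.1 = e.1 → segSlope f ≤ segSlope e with htop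
  set low : (ℝ × ℝ) × (ℝ × ℝ) → Prop :=
    fun e => ∀ f ∈ E, f.2 = e.2 → segSlope e ≤ segSlope f with hlow
  set up : (ℝ × ℝ) × (ℝ × ℝ) → Prop :=
    fun e => ∀ f ∈ E, f.2 = e.2 → segSlope f ≤ segSlope e with hup
  have c1 : (E.filter top).card ≤ V.card := by
    refine Finset.card_le_card_of_injOn Prod.fst (fun e he => ?_) fun e he f hf hef => ?_
    · exact h.fst_mem e (Finset.mem_filter.1 he).1
    · obtain ⟨he, he1⟩ := Finset.mem_filter.1 he
      obtain ⟨hf, hf1⟩ := Finset.mem_filter.1 hf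
      exact h.eq_of_fst he hf hef (le_antisymm (hf1 e he hef) (he1 f hf hef.symm))
  have c2 : (E.filter low).card ≤ V.card := by
    refine Finset.card_le_card_of_injOn Prod.snd (fun e he => ?_) fun e he f hf hef => ?_
    · exact h.snd_mem e (Finset.mem_filter.1 he).1
    · obtain ⟨he, he1⟩ := Finset.mem_filter.1 he
      obtain ⟨hf, hf1⟩ := Finset.mem_filter.1 hf
      exact h.eq_of_snd he hf hef (le_antisymm (he1 f hf hef.symm) (hf1 e he hef))
  have c3 : (E.filter fun e => ¬ top e ∧ up (next e)).card ≤ V.card := by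
    refine Finset.card_le_card_of_injOn (fun e => (next e).2) (fun e he => ?_)
      fun e he f hf hef => ?_
    · exact h.snd_mem _ (next_spec e (Finset.mem_filter.1 he).2.1).1
    · obtain ⟨he, he1, he2⟩ := Finset.mem_filter.1 he
      obtain ⟨hf, hf1, hf2⟩ := Finset.mem_filter.1 hf
      have ne := next_spec e he1
      have nf := next_spec f hf1
      have : next e = next f :=
        h.eq_of_snd ne.1 nf.1 hef (le_antisymm (hf2 _ ne.1 hef) (he2 _ nf.1 hef.symm))
      exact h.isNextSeg_injective he hf ne (this ▸ nf)
  have c4 : (E.filter fun e => ¬ top e ∧ ¬ low e ∧ ¬ up (next e)).card ≤ V.card := by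
    have apex_spec : ∀ e ∈ E.filter fun e => ¬ top e ∧ ¬ low e ∧ ¬ up (next e),
        IsWedgeVertex V e (next e) (apex e) := by
      intro e he
      obtain ⟨he, he1, he2, he3⟩ := Finset.mem_filter.1 he
      have := h.exists_isWedgeVertex he (next_spec e he1) he2 he3
      simp only [hapex, dif_pos this]
      exact this.choose_spec
    refine Finset.card_le_card_of_injOn apex (fun e he => (apex_spec e he).1)
      fun e he f hf hef => ?_
    have ae := apex_spec e he
    have af := apex_spec f hf
    obtain ⟨he, he1, -⟩ := Finset.mem_filter.1 he
    obtain ⟨hf, hf1, -⟩ := Finset.mem_filter.1 hf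
    exact h.isWedgeVertex_injective he hf (next_spec e he1) (next_spec f hf1) ae (hef ▸ af)
  have hsub : E ⊆ E.filter top ∪ E.filter low ∪ (E.filter fun e => ¬ top e ∧ up (next e)) ∪
      E.filter fun e => ¬ top e ∧ ¬ low e ∧ ¬ up (next e) := by
    intro e he
    simp only [Finset.mem_union, Finset.mem_filter]
    tauto
  have u1 := Finset.card_le_card hsub
  have u2 := Finset.card_union_le (E.filter top ∪ E.filter low ∪
    (E.filter fun e => ¬ top e ∧ up (next e))) (E.filter fun e => ¬ top e ∧ ¬ low e ∧ ¬ up (next e))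
  have u3 := Finset.card_union_le (E.filter top ∪ E.filter low)
    (E.filter fun e => ¬ top e ∧ up (next e))
  have u4 := Finset.card_union_le (E.filter top) (E.filter low)
  omega

end IsPlaneDrawing

/-- A random subset of `V`, with each element kept independently with probability `p`, contains
`T` with probability `p ^ #T`. -/
lemma sum_powerset_filter_superset {α : Type*} [DecidableEq α] {V T : Finset α} (hT : T ⊆ V)
    (p : ℝ) :
    ∑ S ∈ V.powerset with T ⊆ S, p ^ S.card * (1 - p) ^ (V \ S).card = p ^ T.card := by
  have h := Finset.prod_add (fun _ => p) (fun i => if i ∈ T then 0 else 1 - p) V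
  have hl : ∏ i ∈ V, (p + if i ∈ T then 0 else 1 - p) = p ^ T.card := by
    have : ∀ i ∈ V, (p + if i ∈ T then 0 else 1 - p) = if i ∈ T then p else 1 := by
      intro i _
      split_ifs <;> ring
    rw [Finset.prod_congr rfl this, Finset.prod_ite, Finset.filter_mem_eq_inter,
      Finset.inter_eq_right.2 hT]
    simp
  rw [← hl, h, Finset.sum_filter]
  refine Finset.sum_congr rfl fun S hS => ?_
  rw [Finset.prod_const]
  split_ifs with hTS
  · congr 1
    rw [← Finset.prod_const]
    refine Finset.prod_congr rfl fun i hi => ?_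
    rw [if_neg fun hiT => (Finset.mem_sdiff.1 hi).2 (hTS hiT)]
  · obtain ⟨i, hiT, hiS⟩ := Finset.not_subset.1 hTS
    rw [Finset.prod_eq_zero (i := i) (Finset.mem_sdiff.2 ⟨hT hiT, hiS⟩) (by simp [hiT]), mul_zero]

/-- The expected number of members of a family of `k`-subsets that survive random sampling. -/
lemma sum_powerset_card_filter {α β : Type*} [DecidableEq α] {V : Finset α} {E : Finset β}
    {v : β → Finset α} {k : ℕ} (hv : ∀ e ∈ E, v e ⊆ V) (hk : ∀ e ∈ E, (v e).card = k) (p : ℝ) :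
    ∑ S ∈ V.powerset, p ^ S.card * (1 - p) ^ (V \ S).card * (E.filter fun e => v e ⊆ S).card
      = p ^ k * E.card := by
  have : ∀ S ∈ V.powerset,
      p ^ S.card * (1 - p) ^ (V \ S).card * ((E.filter fun e => v e ⊆ S).card : ℝ)
      = ∑ e ∈ E, if v e ⊆ S then p ^ S.card * (1 - p) ^ (V \ S).card else 0 := by
    intro S _
    rw [← Finset.sum_filter, Finset.sum_const, nsmul_eq_mul, mul_comm]
  rw [Finset.sum_congr rfl this, Finset.sum_comm]
  have h2 : ∀ e ∈ E, (∑ S ∈ V.powerset,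
      if v e ⊆ S then p ^ S.card * (1 - p) ^ (V \ S).card else 0) = p ^ k := by
    intro e he
    rw [← Finset.sum_filter, sum_powerset_filter_superset (hv e he), hk e he]
  rw [Finset.sum_congr rfl h2, Finset.sum_const, nsmul_eq_mul, mul_comm]

/-- The amplification step of the crossing lemma. -/
theorem crossing_inequality {α β γ : Type*} [DecidableEq α] {V : Finset α} {E : Finset β}
    {X : Finset γ} {vE : β → Finset α} {vX : γ → Finset α}
    (hE : ∀ e ∈ E, vE e ⊆ V) (hE2 : ∀ e ∈ E, (vE e).card = 2)
    (hX : ∀ x ∈ X, vX x ⊆ V) (hX4 : ∀ x ∈ X, (vX x).card = 4)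
    (h : ∀ S ⊆ V, (E.filter fun e => vE e ⊆ S).card ≤
      4 * S.card + (X.filter fun x => vX x ⊆ S).card) :
    E.card ≤ 8 * V.card ∨ E.card ^ 3 ≤ 128 * V.card ^ 2 * X.card := by
  rw [or_iff_not_imp_left, not_le]
  intro hlt
  have hp : ∀ p : ℝ, 0 ≤ p → p ≤ 1 →
      p ^ 2 * E.card ≤ 4 * (p * V.card) + p ^ 4 * X.card := by
    intro p hp0 hp1
    have hV := sum_powerset_card_filter (V := V) (E := V) (v := fun a => {a}) (k := 1)
      (by simp) (by simp) p
    rw [← sum_powerset_card_filter hE hE2 p, ← sum_powerset_card_filter hX hX4 p,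
      ← pow_one p, ← hV, Finset.mul_sum, ← Finset.sum_add_distrib, pow_one]
    refine Finset.sum_le_sum fun S hS => ?_
    have hS' := Finset.mem_powerset.1 hS
    have hw : 0 ≤ p ^ S.card * (1 - p) ^ (V \ S).card :=
      mul_nonneg (pow_nonneg hp0 _) (pow_nonneg (sub_nonneg.2 hp1) _)
    have hSV : (V.filter fun a => ({a} : Finset α) ⊆ S) = S := by
      simpa [Finset.filter_mem_eq_inter] using hS'
    rw [hSV]
    have h4 : ((E.filter fun e => vE e ⊆ S).card : ℝ) ≤
        4 * S.card + (X.filter fun x => vX x ⊆ S).card := by exact_mod_cast h S hS'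
    calc _ ≤ _ := mul_le_mul_of_nonneg_left h4 hw
      _ = _ := by ring
  have hlt' : 8 * (V.card : ℝ) < E.card := by exact_mod_cast hlt
  have hE0 : (0 : ℝ) < E.card := lt_of_le_of_lt (by positivity) hlt'
  rcases Nat.eq_zero_or_pos V.card with hV0 | hV0
  · rw [Finset.card_eq_zero] at hV0
    subst hV0
    obtain ⟨e, he⟩ : E.Nonempty := Finset.card_pos.1 (by exact_mod_cast hE0)
    have h1 := hE2 e he
    rw [Finset.subset_empty.1 (hE e he)] at h1
    simp at h1
  have hV0' : (0 : ℝ) < V.card := by exact_mod_cast hV0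
  have := hp (8 * V.card / E.card) (by positivity) ((div_le_one hE0).2 hlt'.le)
  have key : (E.card : ℝ) ^ 3 ≤ 128 * V.card ^ 2 * X.card := by
    have h5 : 32 * (V.card : ℝ) ^ 2 / E.card ≤ 4096 * V.card ^ 4 * X.card / E.card ^ 4 := by
      have e1 : (8 * (V.card : ℝ) / E.card) ^ 2 * E.card - 4 * (8 * V.card / E.card * V.card)
          = 32 * (V.card : ℝ) ^ 2 / E.card := by field_simp; ring
      have e2 : (8 * (V.card : ℝ) / E.card) ^ 4 * X.card
          = 4096 * V.card ^ 4 * X.card / E.card ^ 4 := by field_simp; ring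
      linarith
    rw [div_le_div_iff₀ hE0 (by positivity)] at h5
    have h6 : (32 * (V.card : ℝ) ^ 2 * E.card) * E.card ^ 3 ≤
        (32 * (V.card : ℝ) ^ 2 * E.card) * (128 * V.card ^ 2 * X.card) := by linarith
    exact le_of_mul_le_mul_left h6 (by positivity)
  exact_mod_cast key

lemma segHeight_eq_of_eq_of_eq {e f : (ℝ × ℝ) × (ℝ × ℝ)} {a b : ℝ} (hab : a ≠ b)
    (ha : segHeight e a = segHeight f a) (hb : segHeight e b = segHeight f b) :
    segHeight e = segHeight f := by
  simp only [segHeight] at ha hb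
  have hs : segSlope e = segSlope f := by
    have : (segSlope e - segSlope f) * (a - b) = 0 := by linarith
    exact sub_eq_zero.1 ((mul_eq_zero.1 this).resolve_right (sub_ne_zero.2 hab))
  funext t
  simp only [segHeight]
  rw [hs] at ha ⊢
  linarith

/-- The line through `e.1` and `e.2`. -/
def segLine (e : (ℝ × ℝ) × (ℝ × ℝ)) : Set (ℝ × ℝ) :=
  {w | w.2 = segHeight e w.1}

lemma segHeight_eq_of_segLine_eq {e f : (ℝ × ℝ) × (ℝ × ℝ)} (h : segLine e = segLine f) :
    segHeight e = segHeight f := by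
  funext t
  have : (t, segHeight e t) ∈ segLine f := h ▸ (rfl : (t, segHeight e t).2 = _)
  exact this

lemma IsLine.eq_segLine {l : Set (ℝ × ℝ)} (hl : IsLine l) {e : (ℝ × ℝ) × (ℝ × ℝ)}
    (h1 : e.1 ∈ l) (h2 : e.2 ∈ l) (he : e.1.1 < e.2.1) : l = segLine e := by
  obtain ⟨a, b, c, hab, rfl⟩ := hl
  simp only [Set.mem_ofPred_eq] at h1 h2
  have hd : e.2.1 - e.1.1 ≠ 0 := (sub_pos.2 he).ne'
  have hs : segSlope e * (e.2.1 - e.1.1) = e.2.2 - e.1.2 := div_mul_cancel₀ _ hd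
  have hbs : a + b * segSlope e = 0 := by
    refine (mul_eq_zero.1 (?_ : (a + b * segSlope e) * (e.2.1 - e.1.1) = 0)).resolve_right hd
    linear_combination b * hs + h2 - h1
  have hb : b ≠ 0 := by
    rintro rfl
    exact hab (by simpa using hbs)
  ext w
  simp only [segLine, segHeight, Set.mem_ofPred_eq]
  constructor
  · intro hw
    refine mul_left_cancel₀ hb ?_
    linear_combination hw - h1 - (w.1 - e.1.1) * hbs
  · intro hw
    rw [hw]
    linear_combination h1 + (w.1 - e.1.1) * hbs

/-- The segments between consecutive points of `P` on the lines of `L`. -/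
noncomputable def consecutiveSegs (P : Finset (ℝ × ℝ)) (L : Finset (Set (ℝ × ℝ))) :
    Finset ((ℝ × ℝ) × (ℝ × ℝ)) := by
  classical
  exact (P ×ˢ P).filter fun e => e.1.1 < e.2.1 ∧ segLine e ∈ L ∧
    ∀ w ∈ P, e.1.1 < w.1 → w.1 < e.2.1 → w.2 ≠ segHeight e w.1

lemma mem_consecutiveSegs {P : Finset (ℝ × ℝ)} {L : Finset (Set (ℝ × ℝ))}
    {e : (ℝ × ℝ) × (ℝ × ℝ)} : e ∈ consecutiveSegs P L ↔
      (e.1 ∈ P ∧ e.2 ∈ P) ∧ e.1.1 < e.2.1 ∧ segLine e ∈ L ∧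
        ∀ w ∈ P, e.1.1 < w.1 → w.1 < e.2.1 → w.2 ≠ segHeight e w.1 := by
  simp [consecutiveSegs]

section consecutiveSegs

variable {P : Finset (ℝ × ℝ)} {L : Finset (Set (ℝ × ℝ))} {e f : (ℝ × ℝ) × (ℝ × ℝ)}

lemma eq_of_segHeight_eq (hP : Set.InjOn Prod.fst (P : Set (ℝ × ℝ)))
    (he : e ∈ consecutiveSegs P L) (hf : f ∈ consecutiveSegs P L)
    (h : segHeight e = segHeight f) {t : ℝ} (he1 : e.1.1 < t) (he2 : t < e.2.1)
    (hf1 : f.1.1 < t) (hf2 : t < f.2.1) : e = f := by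
  obtain ⟨⟨e1, e2⟩, e3, -, e4⟩ := mem_consecutiveSegs.1 he
  obtain ⟨⟨f1, f2⟩, f3, -, f4⟩ := mem_consecutiveSegs.1 hf
  refine Prod.ext (hP e1 f1 (le_antisymm ?_ ?_)) (hP e2 f2 (le_antisymm ?_ ?_)) <;>
    by_contra! hc
  · exact f4 _ e1 hc (he1.trans hf2) (by rw [← h, segHeight_fst])
  · exact e4 _ f1 hc (hf1.trans he2) (by rw [h, segHeight_fst])
  · exact e4 _ f2 (he1.trans hf2) hc (by rw [h, segHeight_snd f3])
  · exact f4 _ e2 (hf1.trans he2) hc (by rw [← h, segHeight_snd e3])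

/-- The pairs of distinct crossing segments. -/
noncomputable def crossingPairs (P : Finset (ℝ × ℝ)) (L : Finset (Set (ℝ × ℝ))) :
    Finset (((ℝ × ℝ) × (ℝ × ℝ)) × ((ℝ × ℝ) × (ℝ × ℝ))) := by
  classical
  exact (consecutiveSegs P L ×ˢ consecutiveSegs P L).filter fun x =>
    x.1 ≠ x.2 ∧ SegCross x.1 x.2

lemma mem_crossingPairs {x : ((ℝ × ℝ) × (ℝ × ℝ)) × ((ℝ × ℝ) × (ℝ × ℝ))} :
    x ∈ crossingPairs P L ↔ (x.1 ∈ consecutiveSegs P L ∧ x.2 ∈ consecutiveSegs P L) ∧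
      x.1 ≠ x.2 ∧ SegCross x.1 x.2 := by
  simp [crossingPairs]

lemma card_crossingPairs_le (hP : Set.InjOn Prod.fst (P : Set (ℝ × ℝ))) :
    (crossingPairs P L).card ≤ L.card ^ 2 := by
  classical
  rw [sq, ← Finset.card_product]
  refine Finset.card_le_card_of_injOn (fun x => (segLine x.1, segLine x.2)) (fun x hx => ?_)
    fun x hx y hy hxy => ?_
  · obtain ⟨⟨h1, h2⟩, -⟩ := mem_crossingPairs.1 hx
    exact Finset.mem_product.2
      ⟨(mem_consecutiveSegs.1 h1).2.2.1, (mem_consecutiveSegs.1 h2).2.2.1⟩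
  · obtain ⟨⟨x1, x2⟩, xne, t, a1, a2, a3, a4, a5⟩ := mem_crossingPairs.1 hx
    obtain ⟨⟨y1, y2⟩, -, s, b1, b2, b3, b4, b5⟩ := mem_crossingPairs.1 hy
    simp only [Prod.mk.injEq] at hxy
    have h1 := segHeight_eq_of_segLine_eq hxy.1
    have h2 := segHeight_eq_of_segLine_eq hxy.2
    have hts : t = s := by
      by_contra hne
      refine xne (eq_of_segHeight_eq hP x1 x2
        (segHeight_eq_of_eq_of_eq hne a5 ?_) a1 a2 a3 a4)
      rw [h1, h2, b5]
    subst hts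
    exact Prod.ext (eq_of_segHeight_eq hP x1 y1 h1 a1 a2 b1 b2)
      (eq_of_segHeight_eq hP x2 y2 h2 a3 a4 b3 b4)

lemma card_ends_of_mem_crossingPairs (hP : Set.InjOn Prod.fst (P : Set (ℝ × ℝ)))
    {x : ((ℝ × ℝ) × (ℝ × ℝ)) × ((ℝ × ℝ) × (ℝ × ℝ))} (hx : x ∈ crossingPairs P L) :
    ({x.1.1, x.1.2, x.2.1, x.2.2} : Finset (ℝ × ℝ)).card = 4 := by
  obtain ⟨⟨x1, x2⟩, xne, t, a1, a2, a3, a4, a5⟩ := mem_crossingPairs.1 hx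
  have l1 := (mem_consecutiveSegs.1 x1).2.1
  have l2 := (mem_consecutiveSegs.1 x2).2.1
  have key : ∀ u : ℝ × ℝ, u.1 ≠ t → u.2 = segHeight x.1 u.1 → u.2 = segHeight x.2 u.1 →
      False := fun u h0 h1 h2 => xne <| eq_of_segHeight_eq hP x1 x2
    (segHeight_eq_of_eq_of_eq h0 (h1.symm.trans h2) a5) a1 a2 a3 a4
  have n1 : x.1.1 ≠ x.1.2 := fun h => by rw [h] at l1; exact lt_irrefl _ l1
  have n2 : x.2.1 ≠ x.2.2 := fun h => by rw [h] at l2; exact lt_irrefl _ l2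
  have n3 : x.1.1 ≠ x.2.1 := fun h =>
    key x.1.1 a1.ne (segHeight_fst _).symm (by rw [h, segHeight_fst])
  have n4 : x.1.1 ≠ x.2.2 := fun h =>
    key x.1.1 a1.ne (segHeight_fst _).symm (by rw [h, segHeight_snd l2])
  have n5 : x.1.2 ≠ x.2.1 := fun h =>
    key x.1.2 a2.ne' (segHeight_snd l1).symm (by rw [h, segHeight_fst])
  have n6 : x.1.2 ≠ x.2.2 := fun h =>
    key x.1.2 a2.ne' (segHeight_snd l1).symm (by rw [h, segHeight_snd l2])
  rw [Finset.card_insert_of_notMem, Finset.card_insert_of_notMem, Finset.card_pair n2] <;>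
    simp [*]

/-- Deleting one segment from each crossing leaves a plane drawing. -/
lemma card_consecutiveSegs_filter_le (hP : Set.InjOn Prod.fst (P : Set (ℝ × ℝ)))
    {S : Finset (ℝ × ℝ)} (hS : S ⊆ P) :
    ((consecutiveSegs P L).filter fun e => ({e.1, e.2} : Finset (ℝ × ℝ)) ⊆ S).card ≤
      4 * S.card + ((crossingPairs P L).filter fun x =>
        ({x.1.1, x.1.2, x.2.1, x.2.2} : Finset (ℝ × ℝ)) ⊆ S).card := by
  classical
  set ES := (consecutiveSegs P L).filter fun e => ({e.1, e.2} : Finset (ℝ × ℝ)) ⊆ S with hES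
  set XS := (crossingPairs P L).filter fun x =>
    ({x.1.1, x.1.2, x.2.1, x.2.2} : Finset (ℝ × ℝ)) ⊆ S with hXS
  have hmem : ∀ e ∈ ES, e ∈ consecutiveSegs P L ∧ e.1 ∈ S ∧ e.2 ∈ S := by
    intro e he
    simpa [hES, Finset.insert_subset_iff] using he
  have hplane : IsPlaneDrawing S (ES \ XS.image Prod.fst) := by
    refine ⟨hP.mono (by exact_mod_cast hS), fun e he => ?_, fun e he => ?_, fun e he => ?_,
      fun e he f hf hne hc => ?_, fun e he v hv => ?_⟩
    · exact (hmem e (Finset.mem_sdiff.1 he).1).2.1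
    · exact (hmem e (Finset.mem_sdiff.1 he).1).2.2
    · exact (mem_consecutiveSegs.1 (hmem e (Finset.mem_sdiff.1 he).1).1).2.1
    · obtain ⟨he1, he2⟩ := Finset.mem_sdiff.1 he
      obtain ⟨e1, e2, e3⟩ := hmem e he1
      obtain ⟨f1, f2, f3⟩ := hmem f (Finset.mem_sdiff.1 hf).1
      refine he2 (Finset.mem_image.2 ⟨(e, f), Finset.mem_filter.2
        ⟨mem_crossingPairs.2 ⟨⟨e1, f1⟩, hne, hc⟩, ?_⟩, rfl⟩)
      simp [Finset.insert_subset_iff, *]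
    · exact (mem_consecutiveSegs.1 (hmem e (Finset.mem_sdiff.1 he).1).1).2.2.2 v (hS hv)
  calc ES.card ≤ (ES \ XS.image Prod.fst).card + (XS.image Prod.fst).card := by
        have := Finset.le_card_sdiff (XS.image Prod.fst) ES
        omega
    _ ≤ 4 * S.card + XS.card := add_le_add hplane.card_edges_le Finset.card_image_le

lemma card_consecutiveSegs_le (hP : Set.InjOn Prod.fst (P : Set (ℝ × ℝ))) :
    (consecutiveSegs P L).card ≤ 8 * P.card ∨
      (consecutiveSegs P L).card ^ 3 ≤ 128 * P.card ^ 2 * L.card ^ 2 := by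
  classical
  refine (crossing_inequality (E := consecutiveSegs P L) (X := crossingPairs P L)
    (vE := fun e => {e.1, e.2}) (vX := fun x => {x.1.1, x.1.2, x.2.1, x.2.2})
    (fun e he => ?_) (fun e he => ?_) (fun x hx => ?_)
    (fun x hx => card_ends_of_mem_crossingPairs hP hx)
    (fun S hS => by convert card_consecutiveSegs_filter_le hP hS)).imp_right fun h =>
      h.trans (Nat.mul_le_mul_left _ (card_crossingPairs_le hP))
  · have := (mem_consecutiveSegs.1 he).1
    simp [Finset.insert_subset_iff, this]
  · have := (mem_consecutiveSegs.1 he).2.1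
    exact Finset.card_pair fun h => by rw [h] at this; exact lt_irrefl _ this
  · have h1 := (mem_consecutiveSegs.1 (mem_crossingPairs.1 hx).1.1).1
    have h2 := (mem_consecutiveSegs.1 (mem_crossingPairs.1 hx).1.2).1
    simp [Finset.insert_subset_iff, h1, h2]

open Classical in
lemma card_incidences_le (hP : Set.InjOn Prod.fst (P : Set (ℝ × ℝ)))
    (hL : ∀ l ∈ L, IsLine l) :
    ((P ×ˢ L).filter fun x => x.1 ∈ x.2).card ≤ (consecutiveSegs P L).card + L.card := by
  set I := (P ×ˢ L).filter fun x => x.1 ∈ x.2 with hI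
  set hasNext : (ℝ × ℝ) × Set (ℝ × ℝ) → Prop := fun x => ∃ q ∈ P, q ∈ x.2 ∧ x.1.1 < q.1
  have hmem : ∀ x ∈ I, (x.1 ∈ P ∧ x.2 ∈ L) ∧ x.1 ∈ x.2 := by
    intro x hx
    simpa [hI] using hx
  rw [← Finset.card_filter_add_card_filter_not (s := I) hasNext]
  refine add_le_add ?_ ?_
  · have hex : ∀ x ∈ I.filter hasNext, ∃ q ∈ P, q ∈ x.2 ∧ x.1.1 < q.1 ∧
        ∀ w ∈ P, w ∈ x.2 → x.1.1 < w.1 → q.1 ≤ w.1 := by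
      intro x hx
      obtain ⟨q, hq, hq1, hq2⟩ := (Finset.mem_filter.1 hx).2
      obtain ⟨r, hr, hmin⟩ := Finset.exists_min_image
        (P.filter fun q => q ∈ x.2 ∧ x.1.1 < q.1) Prod.fst
        ⟨q, Finset.mem_filter.2 ⟨hq, hq1, hq2⟩⟩
      obtain ⟨hr, hr1, hr2⟩ := Finset.mem_filter.1 hr
      exact ⟨r, hr, hr1, hr2, fun w hw h1 h2 => hmin w (Finset.mem_filter.2 ⟨hw, h1, h2⟩)⟩
    choose! succ s1 s2 s3 s4 using hex
    have hline : ∀ x ∈ I.filter hasNext, x.2 = segLine (x.1, succ x) := fun x hx =>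
      have h := hmem x (Finset.mem_filter.1 hx).1
      (hL _ h.1.2).eq_segLine h.2 (s2 x hx) (s3 x hx)
    refine Finset.card_le_card_of_injOn (fun x => (x.1, succ x)) (fun x hx => ?_)
      fun x hx y hy hxy => ?_
    · have h := hmem x (Finset.mem_filter.1 hx).1
      have hl := hline x hx
      refine mem_consecutiveSegs.2 ⟨⟨h.1.1, s1 x hx⟩, s3 x hx, hl ▸ h.1.2, fun w hw h1 h2 h3 => ?_⟩
      exact (s4 x hx w hw (hl ▸ h3 : w ∈ x.2) h1).not_gt h2
    · refine Prod.ext (Prod.mk.inj hxy).1 ?_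
      rw [hline x hx, hline y hy]
      exact congrArg segLine hxy
  · refine Finset.card_le_card_of_injOn Prod.snd
      (fun x hx => (hmem x (Finset.mem_filter.1 hx).1).1.2) fun x hx y hy hxy => ?_
    obtain ⟨hx, hx'⟩ := Finset.mem_filter.1 hx
    obtain ⟨hy, hy'⟩ := Finset.mem_filter.1 hy
    obtain ⟨⟨x1, -⟩, x2⟩ := hmem x hx
    obtain ⟨⟨y1, -⟩, y2⟩ := hmem y hy
    refine Prod.ext (hP x1 y1 (le_antisymm ?_ ?_)) hxy <;> by_contra! hc
    · exact hy' ⟨x.1, x1, hxy ▸ x2, hc⟩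
    · exact hx' ⟨y.1, y1, hxy ▸ y2, hc⟩

end consecutiveSegs

lemma szemeredi_trotter_of_injOn {P : Set (ℝ × ℝ)} {L : Set (Set (ℝ × ℝ))} (hP : P.Finite)
    (hL : L.Finite) (hl : ∀ l ∈ L, IsLine l) (hinj : Set.InjOn Prod.fst P) :
    ∃ N : ℕ, (Incidences P L).ncard ≤ N + L.ncard ∧
      (N ≤ 8 * P.ncard ∨ N ^ 3 ≤ 128 * P.ncard ^ 2 * L.ncard ^ 2) := by
  classical
  lift P to Finset (ℝ × ℝ) using hP
  lift L to Finset (Set (ℝ × ℝ)) using hL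
  have hI : Incidences P L = ((P ×ˢ L).filter fun x => x.1 ∈ x.2 : Finset _) := by
    ext x
    simp [Incidences, and_assoc]
  simp only [hI, Set.ncard_coe_finset]
  exact ⟨_, card_incidences_le hinj hl, card_consecutiveSegs_le hinj⟩

/-- The horizontal shear of the plane with parameter `t`. -/
def shear (t : ℝ) : ℝ × ℝ ≃ ℝ × ℝ where
  toFun p := (p.1 + t * p.2, p.2)
  invFun p := (p.1 - t * p.2, p.2)
  left_inv p := by simp
  right_inv p := by simp

lemma IsLine.shear {l : Set (ℝ × ℝ)} (hl : IsLine l) (t : ℝ) : IsLine (shear t '' l) := by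
  obtain ⟨a, b, c, hab, rfl⟩ := hl
  refine ⟨a, b - a * t, c, fun h => hab ?_, ?_⟩
  · simp only [Prod.mk.injEq] at h ⊢
    refine ⟨h.1, ?_⟩
    simpa [h.1] using h.2
  · ext p
    rw [Equiv.image_eq_preimage_symm]
    simp only [_root_.shear, Equiv.coe_fn_symm_mk, Set.mem_preimage, Set.mem_ofPred_eq]
    constructor <;> intro h <;> linarith

lemma exists_shear_injOn {P : Set (ℝ × ℝ)} (hP : P.Finite) :
    ∃ t, Set.InjOn Prod.fst (shear t '' P) := by
  have hfin := (hP.prod hP).image fun x : (ℝ × ℝ) × (ℝ × ℝ) =>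
    (x.2.1 - x.1.1) / (x.1.2 - x.2.2)
  obtain ⟨t, ht⟩ := hfin.exists_notMem
  refine ⟨t, ?_⟩
  rintro _ ⟨p, hp, rfl⟩ _ ⟨q, hq, rfl⟩ h
  simp only [shear, Equiv.coe_fn_mk] at h
  congr 1
  by_cases h2 : p.2 = q.2
  · rw [h2] at h
    exact Prod.ext (by linarith) h2
  · refine absurd ⟨(p, q), ⟨hp, hq⟩, ?_⟩ ht
    have : p.2 - q.2 ≠ 0 := sub_ne_zero.2 h2
    simp only
    rw [div_eq_iff this]
    linarith

/-- The **Szemerédi–Trotter theorem**. -/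
theorem szemeredi_trotter {P : Set (ℝ × ℝ)} {L : Set (Set (ℝ × ℝ))} (hP : P.Finite)
    (hL : L.Finite) (hl : ∀ l ∈ L, IsLine l) :
    ∃ N : ℕ, (Incidences P L).ncard ≤ N + L.ncard ∧
      (N ≤ 8 * P.ncard ∨ N ^ 3 ≤ 128 * P.ncard ^ 2 * L.ncard ^ 2) := by
  obtain ⟨t, ht⟩ := exists_shear_injOn hP
  have hinj : Function.Injective (Set.image (shear t)) := (shear t).injective.image_injective
  have h := szemeredi_trotter_of_injOn (hP.image (shear t)) (hL.image (Set.image (shear t)))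
    (by rintro _ ⟨l, hlL, rfl⟩; exact (hl l hlL).shear t) ht
  have hI : Incidences (shear t '' P) (Set.image (shear t) '' L) =
      Prod.map (shear t) (Set.image (shear t)) '' Incidences P L := by
    ext ⟨p, l⟩
    constructor
    · rintro ⟨⟨q, hq, rfl⟩, ⟨k, hk, rfl⟩, hqk⟩
      exact ⟨(q, k), ⟨hq, hk, (shear t).injective.mem_set_image.1 hqk⟩, rfl⟩
    · rintro ⟨⟨q, k⟩, ⟨hq, hk, hqk⟩, hh⟩
      obtain ⟨rfl, rfl⟩ := Prod.mk.inj hh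
      exact ⟨⟨q, hq, rfl⟩, ⟨k, hk, rfl⟩, ⟨q, hqk, rfl⟩⟩
  rwa [hI, Set.ncard_image_of_injective _ ((shear t).injective.prodMap hinj),
    Set.ncard_image_of_injective _ (shear t).injective, Set.ncard_image_of_injective _ hinj] at h

/-- Cleaning step (lower bound on the number of points): for constants `α, β`
with `α + 2β = 1`, `β ≤ 2/3` and `A, B > 0`, there are `c > 0` and `C₁ ≥ 1`
such that whenever `m ≤ n²/C₁`, `n ≤ m²/C₁`, `|L| ≤ A m^α n^β` and
`|I(P,L)| ≥ B m^{α-1/3} n^{β+2/3}`, we get `|P| ≥ c m^{α/2-1/2} n^{β/2+1}`. -/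
theorem cleaning_points (α β A B : ℝ) (hαβ : α + 2 * β = 1) (hβ : β ≤ 2 / 3)
    (hA : 0 < A) (hB : 0 < B) :
    ∃ c C₁ : ℝ, 0 < c ∧ 1 ≤ C₁ ∧
      ∀ m n : ℕ, 0 < m → 0 < n →
        (m : ℝ) ≤ (n : ℝ) ^ 2 / C₁ → (n : ℝ) ≤ (m : ℝ) ^ 2 / C₁ →
        ∀ (P : Set (ℝ × ℝ)) (L : Set (Set (ℝ × ℝ))),
          P.Finite → L.Finite → (∀ l ∈ L, IsLine l) →
          (L.ncard : ℝ) ≤ A * (m : ℝ) ^ α * (n : ℝ) ^ β →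
          B * (m : ℝ) ^ (α - 1 / 3) * (n : ℝ) ^ (β + 2 / 3) ≤
            ((Incidences P L).ncard : ℝ) →
          c * (m : ℝ) ^ (α / 2 - 1 / 2) * (n : ℝ) ^ (β / 2 + 1) ≤
            (P.ncard : ℝ) := by
  refine ⟨min (B / 16) √(B ^ 3 / (1024 * A ^ 2)), max 1 ((2 * A / B) ^ 3),
    lt_min (by positivity) (Real.sqrt_pos.2 (by positivity)), le_max_left _ _, ?_⟩
  intro m n hm hn hmn hnm P L hP hL hl hLcard hI
  obtain ⟨N, hN, hN'⟩ := szemeredi_trotter hP hL hl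
  have hm0 : (0 : ℝ) < m := by exact_mod_cast hm
  have hn0 : (0 : ℝ) < n := by exact_mod_cast hn
  set C := max 1 ((2 * A / B) ^ 3) with hC
  have hC1 : 1 ≤ C := le_max_left _ _
  have hC0 : 0 < C := zero_lt_one.trans_le hC1
  rw [le_div_iff₀ hC0] at hmn hnm
  rw [mul_assoc] at hI hLcard ⊢
  set Q := (m : ℝ) ^ (α - 1 / 3) * (n : ℝ) ^ (β + 2 / 3) with hQ
  set T := (m : ℝ) ^ α * (n : ℝ) ^ β with hT
  set R := (m : ℝ) ^ (α / 2 - 1 / 2) * (n : ℝ) ^ (β / 2 + 1) with hR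
  have hQ0 : 0 < Q := by positivity
  have hT0 : 0 < T := by positivity
  have hR0 : 0 < R := by positivity
  have hTQ3 : T ^ 3 * n ^ 2 = Q ^ 3 * m := by
    simp only [hT, hQ, mul_pow, ← Real.rpow_mul_natCast hm0.le, ← Real.rpow_mul_natCast hn0.le]
    rw [← Real.rpow_natCast (n : ℝ) 2, mul_assoc, ← Real.rpow_add hn0]
    rw [mul_right_comm, ← Real.rpow_add_one hm0.ne']
    congr 2 <;> push_cast <;> ring
  have hQR : Q ^ 3 = R ^ 2 * T ^ 2 := by
    simp only [hT, hQ, hR, mul_pow, ← Real.rpow_mul_natCast hm0.le,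
      ← Real.rpow_mul_natCast hn0.le]
    rw [mul_mul_mul_comm, ← Real.rpow_add hn0, ← Real.rpow_add hm0]
    congr 2 <;> push_cast <;> ring
  have hRQ : R ≤ Q := by
    have hnm2 : (n : ℝ) ≤ (m : ℝ) ^ 2 := by nlinarith
    have hpow : (n : ℝ) ^ (1 / 3 - β / 2) ≤ (m : ℝ) ^ (2 / 3 - β) := by
      calc (n : ℝ) ^ (1 / 3 - β / 2) ≤ ((m : ℝ) ^ 2) ^ (1 / 3 - β / 2) :=
            Real.rpow_le_rpow hn0.le hnm2 (by linarith)
        _ = (m : ℝ) ^ (2 / 3 - β) := by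
            rw [← Real.rpow_natCast (m : ℝ) 2, ← Real.rpow_mul hm0.le]
            congr 1
            push_cast
            ring
    have e1 : R = (m : ℝ) ^ (α / 2 - 1 / 2) * (n : ℝ) ^ (β + 2 / 3) *
        (n : ℝ) ^ (1 / 3 - β / 2) := by
      rw [hR, mul_assoc, ← Real.rpow_add hn0]
      congr 2
      ring
    have e2 : Q = (m : ℝ) ^ (α / 2 - 1 / 2) * (n : ℝ) ^ (β + 2 / 3) *
        (m : ℝ) ^ (2 / 3 - β) := by
      rw [hQ, mul_right_comm, ← Real.rpow_add hm0]
      congr 2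
      linarith
    rw [e1, e2]
    exact mul_le_mul_of_nonneg_left hpow (by positivity)
  have hAT : A * T ≤ B / 2 * Q := by
    have h1 : (2 * A / B) ^ 3 * m ≤ n ^ 2 := by
      nlinarith [le_max_right 1 ((2 * A / B) ^ 3)]
    have h2 : (2 * A / B * T) ^ 3 * n ^ 2 ≤ Q ^ 3 * n ^ 2 := by
      calc (2 * A / B * T) ^ 3 * n ^ 2 = (2 * A / B) ^ 3 * (T ^ 3 * n ^ 2) := by ring
        _ = Q ^ 3 * ((2 * A / B) ^ 3 * m) := by rw [hTQ3]; ring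
        _ ≤ Q ^ 3 * n ^ 2 := mul_le_mul_of_nonneg_left h1 (by positivity)
    have h3 : 2 * A / B * T ≤ Q :=
      le_of_pow_le_pow_left₀ three_ne_zero hQ0.le (le_of_mul_le_mul_right h2 (by positivity))
    calc A * T = B / 2 * (2 * A / B * T) := by field_simp
      _ ≤ B / 2 * Q := mul_le_mul_of_nonneg_left h3 (by positivity)
  have hNQ : B / 2 * Q ≤ N := by
    have : ((Incidences P L).ncard : ℝ) ≤ N + L.ncard := by exact_mod_cast hN
    linarith
  rcases hN' with h | h
  · have h' : (N : ℝ) ≤ 8 * P.ncard := by exact_mod_cast h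
    have h1 : min (B / 16) √(B ^ 3 / (1024 * A ^ 2)) * R ≤ B / 16 * Q :=
      mul_le_mul (min_le_left _ _) hRQ hR0.le (by positivity)
    linarith
  · have h' : (N : ℝ) ^ 3 ≤ 128 * P.ncard ^ 2 * L.ncard ^ 2 := by exact_mod_cast h
    have h1 : (B / 2 * Q) ^ 3 ≤ 128 * (P.ncard : ℝ) ^ 2 * (A * T) ^ 2 :=
      calc (B / 2 * Q) ^ 3 ≤ (N : ℝ) ^ 3 := pow_le_pow_left₀ (by positivity) hNQ 3
        _ ≤ _ := h'
        _ ≤ _ := by gcongr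
    have h2 : B ^ 3 / (1024 * A ^ 2) * R ^ 2 ≤ (P.ncard : ℝ) ^ 2 := by
      rw [div_mul_eq_mul_div, div_le_iff₀ (by positivity)]
      refine le_of_mul_le_mul_right ?_ (pow_pos hT0 2)
      calc B ^ 3 * R ^ 2 * T ^ 2 = 8 * (B / 2 * Q) ^ 3 := by
            rw [mul_pow _ Q, hQR]
            ring
        _ ≤ _ := by linarith
    refine le_of_pow_le_pow_left₀ two_ne_zero (by positivity) ?_
    rw [mul_pow]
    refine le_trans (mul_le_mul_of_nonneg_right ?_ (by positivity)) h2
    calc (min (B / 16) √(B ^ 3 / (1024 * A ^ 2))) ^ 2 ≤ √(B ^ 3 / (1024 * A ^ 2)) ^ 2 :=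
          pow_le_pow_left₀ (le_min (by positivity) (Real.sqrt_nonneg _)) (min_le_right _ _) 2
      _ = B ^ 3 / (1024 * A ^ 2) := Real.sq_sqrt (by positivity)
end

section
/- Let Δ > 0, let P be a set of n points and L a set of m lines in ℝ² (with n, m ≥ 1) such that |I(P,L)| ≥ Δ n^{2/3} m^{2/3}. Then there exist subsets P' ⊆ P and L' ⊆ L such that every point of P' lies on at least (Δ/4)·m^{2/3}/n^{1/3} lines of L', every line of L' contains at least (Δ/4)·n^{2/3}/m^{1/3} points of P', and |I(P',L')| ≥ (Δ/2) n^{2/3} m^{2/3}. -/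
theorem Incidences.finite {P : Set (ℝ × ℝ)} {L : Set (Set (ℝ × ℝ))} (hP : P.Finite)
    (hL : L.Finite) : (Incidences P L).Finite :=
  (hP.prod hL).subset fun _ h => ⟨h.1, h.2.1⟩

/-- Deleting a point loses at most as many incidences as there are lines through it. -/
theorem ncard_incidences_le_diff_point {P : Set (ℝ × ℝ)} {L : Set (Set (ℝ × ℝ))} (hP : P.Finite)
    (hL : L.Finite) (p : ℝ × ℝ) :
    (Incidences P L).ncard ≤ (Incidences (P \ {p}) L).ncard + {l ∈ L | p ∈ l}.ncard := by
  have hfin : {l ∈ L | p ∈ l}.Finite := hL.subset (Set.sep_subset _ _)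
  have hsub : Incidences P L ⊆ Incidences (P \ {p}) L ∪ Prod.mk p '' {l ∈ L | p ∈ l} := by
    rintro ⟨q, l⟩ ⟨hq, hl, hql⟩
    by_cases hqp : q = p
    · subst hqp
      exact Or.inr ⟨l, ⟨hl, hql⟩, rfl⟩
    · exact Or.inl ⟨⟨hq, hqp⟩, hl, hql⟩
  exact (Set.ncard_le_ncard hsub
    ((Incidences.finite hP.sdiff hL).union (hfin.image _))).trans <|
      (Set.ncard_union_le _ _).trans <| Nat.add_le_add_left (Set.ncard_image_le hfin) _

/-- Deleting a line loses at most as many incidences as there are points on it. -/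
theorem ncard_incidences_le_diff_line {P : Set (ℝ × ℝ)} {L : Set (Set (ℝ × ℝ))} (hP : P.Finite)
    (hL : L.Finite) (l : Set (ℝ × ℝ)) :
    (Incidences P L).ncard ≤ (Incidences P (L \ {l})).ncard + {p ∈ P | p ∈ l}.ncard := by
  have hfin : {p ∈ P | p ∈ l}.Finite := hP.subset (Set.sep_subset _ _)
  have hsub : Incidences P L ⊆
      Incidences P (L \ {l}) ∪ (fun p => (p, l)) '' {p ∈ P | p ∈ l} := by
    rintro ⟨q, k⟩ ⟨hq, hk, hqk⟩
    by_cases hkl : k = l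
    · subst hkl
      exact Or.inr ⟨q, ⟨hq, hqk⟩, rfl⟩
    · exact Or.inl ⟨hq, ⟨hk, hkl⟩, hqk⟩
  exact (Set.ncard_le_ncard hsub
    ((Incidences.finite hP hL.sdiff).union (hfin.image _))).trans <|
      (Set.ncard_union_le _ _).trans <| Nat.add_le_add_left (Set.ncard_image_le hfin) _

/-- Every finite configuration has a subconfiguration in which all points are `a`-rich and all
lines are `b`-rich, losing at most `a` incidences per point and `b` incidences per line. It is
found by maximizing the number of incidences minus `a` per point and `b` per line. -/
theorem exists_rich_subconfiguration {P : Set (ℝ × ℝ)} {L : Set (Set (ℝ × ℝ))} (hP : P.Finite)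
    (hL : L.Finite) {a b : ℝ} (ha : 0 ≤ a) (hb : 0 ≤ b) :
    ∃ P' ⊆ P, ∃ L' ⊆ L,
      (∀ p ∈ P', a ≤ ({l ∈ L' | p ∈ l}.ncard : ℝ)) ∧
      (∀ l ∈ L', b ≤ ({p ∈ P' | p ∈ l}.ncard : ℝ)) ∧
      ((Incidences P L).ncard : ℝ) - a * P.ncard - b * L.ncard ≤ (Incidences P' L').ncard := by
  obtain ⟨⟨P', L'⟩, ⟨hP', hL'⟩, hmax⟩ := Set.exists_max_image (𝒫 P ×ˢ 𝒫 L)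
    (fun x => ((Incidences x.1 x.2).ncard : ℝ) - a * x.1.ncard - b * x.2.ncard)
    (hP.powerset.prod hL.powerset) ⟨(P, L), Set.Subset.rfl, Set.Subset.rfl⟩
  simp only [Set.mem_powerset_iff] at hP' hL'
  have hPf := hP.subset hP'
  have hLf := hL.subset hL'
  refine ⟨P', hP', L', hL', fun p hp => ?_, fun l hl => ?_, ?_⟩
  · have hdel := hmax (P' \ {p}, L') ⟨Set.sdiff_subset.trans hP', hL'⟩
    have hcard : ((P' \ {p}).ncard : ℝ) + 1 = P'.ncard :=
      mod_cast Set.ncard_sdiff_singleton_add_one hp hPf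
    have hinc : ((Incidences P' L').ncard : ℝ) ≤
        (Incidences (P' \ {p}) L').ncard + {l ∈ L' | p ∈ l}.ncard :=
      mod_cast ncard_incidences_le_diff_point hPf hLf p
    simp only [← hcard] at hdel
    linarith
  · have hdel := hmax (P', L' \ {l}) ⟨hP', Set.sdiff_subset.trans hL'⟩
    have hcard : ((L' \ {l}).ncard : ℝ) + 1 = L'.ncard :=
      mod_cast Set.ncard_sdiff_singleton_add_one hl hLf
    have hinc : ((Incidences P' L').ncard : ℝ) ≤
        (Incidences P' (L' \ {l})).ncard + {p ∈ P' | p ∈ l}.ncard :=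
      mod_cast ncard_incidences_le_diff_line hPf hLf l
    simp only [← hcard] at hdel
    linarith
  · have hall := hmax (P, L) ⟨Set.Subset.rfl, Set.Subset.rfl⟩
    have hPn : 0 ≤ a * (P'.ncard : ℝ) := by positivity
    have hLn : 0 ≤ b * (L'.ncard : ℝ) := by positivity
    simp only at hall
    linarith

theorem div_rpow_third_mul_self {x : ℝ} (hx : 0 < x) (c : ℝ) :
    c / x ^ ((1 : ℝ) / 3) * x = c * x ^ ((2 : ℝ) / 3) := by
  have h : x ^ ((2 : ℝ) / 3) * x ^ ((1 : ℝ) / 3) = x := by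
    rw [← Real.rpow_add hx]
    norm_num
  have hne : x ^ ((1 : ℝ) / 3) ≠ 0 := (Real.rpow_pos_of_pos hx _).ne'
  rw [div_mul_eq_mul_div, div_eq_iff hne, mul_assoc, h]

/-- Cleaning to rich subconfigurations: if `n` points and `m` lines determine at
least `Δ n^{2/3} m^{2/3}` incidences, then there are subsets `P' ⊆ P`, `L' ⊆ L`
such that every point of `P'` lies on at least `(Δ/4) m^{2/3} n^{-1/3}` lines of
`L'`, every line of `L'` contains at least `(Δ/4) n^{2/3} m^{-1/3}` points of
`P'`, and `P', L'` still determine at least `(Δ/2) n^{2/3} m^{2/3}`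
incidences. -/
theorem rich_cleaning (Δ : ℝ) (hΔ : 0 < Δ) (n m : ℕ) (hn : 1 ≤ n) (hm : 1 ≤ m)
    (P : Set (ℝ × ℝ)) (L : Set (Set (ℝ × ℝ)))
    (hPfin : P.Finite) (hLfin : L.Finite) (hLl : ∀ l ∈ L, IsLine l)
    (hPn : P.ncard = n) (hLm : L.ncard = m)
    (hI : Δ * (n : ℝ) ^ ((2 : ℝ) / 3) * (m : ℝ) ^ ((2 : ℝ) / 3) ≤
      ((Incidences P L).ncard : ℝ)) :
    ∃ P' ⊆ P, ∃ L' ⊆ L,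
      (∀ p ∈ P',
        Δ / 4 * (m : ℝ) ^ ((2 : ℝ) / 3) / (n : ℝ) ^ ((1 : ℝ) / 3) ≤
          ({l ∈ L' | p ∈ l}.ncard : ℝ)) ∧
      (∀ l ∈ L',
        Δ / 4 * (n : ℝ) ^ ((2 : ℝ) / 3) / (m : ℝ) ^ ((1 : ℝ) / 3) ≤
          ({p ∈ P' | p ∈ l}.ncard : ℝ)) ∧
      Δ / 2 * (n : ℝ) ^ ((2 : ℝ) / 3) * (m : ℝ) ^ ((2 : ℝ) / 3) ≤
        ((Incidences P' L').ncard : ℝ) := by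
  have hn0 : (0 : ℝ) < n := by exact_mod_cast hn
  have hm0 : (0 : ℝ) < m := by exact_mod_cast hm
  obtain ⟨P', hP', L', hL', hpoints, hlines, hinc⟩ := exists_rich_subconfiguration hPfin hLfin
    (a := Δ / 4 * (m : ℝ) ^ ((2 : ℝ) / 3) / (n : ℝ) ^ ((1 : ℝ) / 3))
    (b := Δ / 4 * (n : ℝ) ^ ((2 : ℝ) / 3) / (m : ℝ) ^ ((1 : ℝ) / 3))
    (by positivity) (by positivity)
  refine ⟨P', hP', L', hL', hpoints, hlines, ?_⟩
  rw [hPn, hLm, div_rpow_third_mul_self hn0, div_rpow_third_mul_self hm0] at hinc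
  linarith
end
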